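/- Let D₁, D₂ be semilocal finite-dimensional Prüfer domains, and suppose there is an order isomorphism ν : hiSpec(D₁) → hiSpec(D₂) such that ε(M) = ε(ν(M)) for every M ∈ Max(D₁). (a) If ω(P) = ω(ν(P)) for every P ∈ hiSpec(D₁), then the order isomorphisms 𝛎 : SStar(D₁) → SStar(D₂) and 𝛎_F : FStar(D₁) → FStar(D₂) restrict to order isomorphisms between the sets of (semi)star operations on D₁ and on D₂ and between Star(D₁) and Star(D₂). (b) If ω(P) = ω(ν(P)) for every P ∈ hiSpec(D₁) that is not minimal in hiSpec(D₁) \ {(0)}, then there is an order isomorphism between Star(D₁) and Star(D₂). -/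

import Mathlib

/- Common background: Prüfer domains, semistar and (fractional) star operations,
standard decomposition, skeleton, supports, `hiSpec`, the rings `Z(P)`,
and the invariants `ω` and `ε`, following Spirito,
"Semistar operations on semilocal Prüfer domains". -/

set_option linter.unusedSectionVars false
set_option maxHeartbeats 1000000

open Pointwise

noncomputable section

namespace Paper

variable (D : Type*) [CommRing D] [IsDomain D]
variable (K : Type*) [Field K] [Algebra D K] [IsFractionRing D K]

/-- The localization of `D` at a prime ideal `P`, viewed as an overring of `D`
inside its quotient field `K`. -/
def locAt (P : Ideal D) (hP : P.IsPrime) : Subalgebra D K :=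
  Localization.subalgebra K (@Ideal.primeCompl D _ P hP)
    (fun _ hx => mem_nonZeroDivisors_of_ne_zero fun h => hx (h ▸ P.zero_mem))

/-- A Prüfer domain: every localization at a prime ideal is a valuation domain
(any two elements are comparable w.r.t. divisibility). -/
def IsPrufer : Prop :=
  ∀ (P : Ideal D) (hP : P.IsPrime), ∀ x y : locAt D K P hP, ∃ z, x * z = y ∨ y * z = x

/-- A semilocal ring: finitely many maximal ideals. -/
def IsSemilocal : Prop := {I : Ideal D | I.IsMaximal}.Finite

/-- Two ideals are dependent if some nonzero prime ideal is contained in both. -/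
def Dependent (M N : Ideal D) : Prop :=
  ∃ P : Ideal D, P.IsPrime ∧ P ≠ ⊥ ∧ P ≤ M ∧ P ≤ N

/-- The member of the standard decomposition corresponding to the dependence class
of the maximal ideal `M`: the intersection of the localizations of `D` at the
maximal ideals dependent on `M`. -/
def TOf (M : Ideal D) : Subalgebra D K :=
  sInf {A | ∃ (N : Ideal D) (hN : N.IsMaximal), Dependent D M N ∧ A = locAt D K N hN.isPrime}

/-- The standard decomposition of `D`. -/
def stdDecomp : Set (Subalgebra D K) :=
  {T | ∃ M : Ideal D, M.IsMaximal ∧ T = TOf D K M}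

/-- The skeleton of `Over(D)`: all intersections of subsets of the standard
decomposition (including the empty intersection `K` and the total one `D`). -/
def SkOver : Set (Subalgebra D K) :=
  {A | ∃ S ⊆ stdDecomp D K, A = sInf S}

/-- `I` is a fractional ideal of the overring `A` of `D`: it is an `A`-submodule
of `K` and `dI ⊆ A` for some nonzero `d ∈ K`. -/
def IsFracOf (A : Subalgebra D K) (I : Submodule D K) : Prop :=
  (∀ a ∈ A, ∀ x ∈ I, a * x ∈ I) ∧ ∃ d : K, d ≠ 0 ∧ ∀ x ∈ I, d * x ∈ A

end Paper

namespace Paper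

/-- A semistar operation on a domain `R` with quotient field `K`: an extensive,
order-preserving, idempotent self-map of the set of `R`-submodules of `K` such
that `(xI)^⋆ = x·I^⋆` for every nonzero `x ∈ K`. -/
structure Semistar (R : Type*) [CommRing R] (K : Type*) [Field K] [Algebra R K] where
  toFun : Submodule R K → Submodule R K
  le_star' : ∀ I, I ≤ toFun I
  mono' : ∀ ⦃I J⦄, I ≤ J → toFun I ≤ toFun J
  idem' : ∀ I, toFun (toFun I) = toFun I
  smul' : ∀ (x : K), x ≠ 0 → ∀ I,
    toFun (Submodule.span R {x} * I) = Submodule.span R {x} * toFun I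

namespace Semistar

variable {R : Type*} [CommRing R] {K : Type*} [Field K] [Algebra R K]

theorem ext' {s t : Semistar R K} (h : s.toFun = t.toFun) : s = t := by
  cases s; cases t; cases h; rfl

instance : PartialOrder (Semistar R K) where
  le s t := ∀ I, s.toFun I ≤ t.toFun I
  le_refl _ _ := le_rfl
  le_trans _ _ _ hab hbc I := (hab I).trans (hbc I)
  le_antisymm _ _ h h' := ext' (funext fun I => le_antisymm (h I) (h' I))

end Semistar

/-- The identity semistar operation `d`. -/
def dOp (R : Type*) [CommRing R] (K : Type*) [Field K] [Algebra R K] : Semistar R K where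
  toFun I := I
  le_star' _ := le_rfl
  mono' _ _ h := h
  idem' _ := rfl
  smul' _ _ _ := rfl

end Paper

namespace Paper

variable (D : Type*) [CommRing D] [IsDomain D]
variable (K : Type*) [Field K] [Algebra D K] [IsFractionRing D K]

/-- A fractional star operation on an overring `A` of `D` (inside `K`): a
semistar-like closure operation defined on the fractional ideals of `A`.
In particular `FracStar D K ⊥` is the set of fractional star operations on `D`. -/
structure FracStar (A : Subalgebra D K) where
  toFun : {I : Submodule D K // IsFracOf D K A I} → {I : Submodule D K // IsFracOf D K A I}
  le_star' : ∀ I, I.1 ≤ (toFun I).1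
  mono' : ∀ I J, I.1 ≤ J.1 → (toFun I).1 ≤ (toFun J).1
  idem' : ∀ I, toFun (toFun I) = toFun I
  smul' : ∀ (x : K), x ≠ 0 → ∀ I J, J.1 = Submodule.span D {x} * I.1 →
    (toFun J).1 = Submodule.span D {x} * (toFun I).1

namespace FracStar

variable {D K} {A : Subalgebra D K}

theorem ext' {s t : FracStar D K A} (h : s.toFun = t.toFun) : s = t := by
  cases s; cases t; cases h; rfl

instance : PartialOrder (FracStar D K A) where
  le s t := ∀ I, (s.toFun I).1 ≤ (t.toFun I).1
  le_refl _ _ := le_rfl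
  le_trans _ _ _ hab hbc I := (hab I).trans (hbc I)
  le_antisymm _ _ h h' := ext' (funext fun I => Subtype.ext (le_antisymm (h I) (h' I)))

end FracStar

/-- A fractional star operation on the overring `A` is a *star operation* if it
closes `A` itself. -/
def FracStar.IsStarOp {A : Subalgebra D K} (f : FracStar D K A) : Prop :=
  ∀ h : IsFracOf D K A (Subalgebra.toSubmodule A),
    (f.toFun ⟨Subalgebra.toSubmodule A, h⟩).1 = Subalgebra.toSubmodule A

/-- The support of a semistar operation on `D`: the elements `A` of the skeleton
such that `A^⋆` is a fractional ideal of `A`. -/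
def supp (s : Semistar D K) : Set (Subalgebra D K) :=
  {A | A ∈ SkOver D K ∧ IsFracOf D K A (s.toFun (Subalgebra.toSubmodule A))}

/-- The image of an ideal of `D` inside `K`. -/
def idealToK (P : Ideal D) : Submodule D K := Submodule.map (Algebra.linearMap D K) P

end Paper

namespace Paper

/-- An abstract fractional star operation on a commutative ring `A`, acting on
the fractional ideals of `A` inside its fraction ring. -/
structure AFracStar (A : Type*) [CommRing A] where
  toFun : FractionalIdeal (nonZeroDivisors A) (FractionRing A) →
    FractionalIdeal (nonZeroDivisors A) (FractionRing A)
  le_star' : ∀ I, I ≤ toFun I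
  mono' : ∀ ⦃I J⦄, I ≤ J → toFun I ≤ toFun J
  idem' : ∀ I, toFun (toFun I) = toFun I
  smul' : ∀ (x : FractionRing A), x ≠ 0 → ∀ I,
    toFun (FractionalIdeal.spanSingleton (nonZeroDivisors A) x * I) =
      FractionalIdeal.spanSingleton (nonZeroDivisors A) x * toFun I

namespace AFracStar

variable {A : Type*} [CommRing A]

theorem ext' {s t : AFracStar A} (h : s.toFun = t.toFun) : s = t := by
  cases s; cases t; cases h; rfl

instance : PartialOrder (AFracStar A) where
  le s t := ∀ I, s.toFun I ≤ t.toFun I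
  le_refl _ _ := le_rfl
  le_trans _ _ _ hab hbc I := (hab I).trans (hbc I)
  le_antisymm _ _ h h' := ext' (funext fun I => le_antisymm (h I) (h' I))

end AFracStar

/-- Abstract star operations on `A`: fractional star operations closing `A`. -/
def AStar (A : Type*) [CommRing A] : Type _ := {s : AFracStar A // s.toFun 1 = 1}

instance (A : Type*) [CommRing A] : PartialOrder (AStar A) :=
  inferInstanceAs (PartialOrder {s : AFracStar A // s.toFun 1 = 1})

end Paper

namespace Paper

variable (D : Type*) [CommRing D] [IsDomain D]

/-- `P` is a branching point of `Spec(D)`: the infimum (among the primes) of a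
family of pairwise incomparable primes not containing `P`. -/
def IsBranchPoint (P : Ideal D) : Prop :=
  ∃ S : Set (Ideal D), (∀ Q ∈ S, Q.IsPrime) ∧
    (S.Pairwise fun Q₁ Q₂ => ¬Q₁ ≤ Q₂ ∧ ¬Q₂ ≤ Q₁) ∧ P ∉ S ∧
    (∀ Q ∈ S, P ≤ Q) ∧ ∀ P' : Ideal D, P'.IsPrime → (∀ Q ∈ S, P' ≤ Q) → P' ≤ P

/-- The homeomorphically irreducible tree underlying `Spec(D)`: the zero ideal,
the maximal ideals and the branching points, ordered by inclusion. -/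
def hiSpec : Set (Ideal D) :=
  {P | P.IsPrime ∧ (P = ⊥ ∨ P.IsMaximal ∨ IsBranchPoint D P)}

/-- `Q` is the element of `hiSpec D` directly below `P`. -/
def DirectlyBelow (Q P : Ideal D) : Prop :=
  Q ∈ hiSpec D ∧ P ∈ hiSpec D ∧ Q < P ∧ ∀ R ∈ hiSpec D, Q < R → ¬R < P

/-- The localization of `D` at the prime ideal `P`, as an abstract ring. -/
abbrev locRing (P : Ideal D) (hP : P.IsPrime) : Type _ :=
  Localization (@Ideal.primeCompl D _ P hP)

/-- The valuation ring `Z(P) = D_P / Q·D_P`. -/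
abbrev Zring (P Q : Ideal D) (hP : P.IsPrime) : Type _ :=
  locRing D P hP ⧸ Ideal.map (algebraMap D (locRing D P hP)) Q

/-- `ω(P) = |FStar(Z(P))|`, where `Q` is the element of `hiSpec D` directly
below `P`. -/
def omegaAt (P Q : Ideal D) (hP : P.IsPrime) : ℕ :=
  Nat.card (AFracStar (Zring D P Q hP))

open Classical in
/-- `ε(P) = |Star(D_P)| ∈ {1,2}` for a (nonzero) prime `P`. -/
def epsilonOf (A : Ideal D) : ℕ :=
  if h : A.IsPrime then Nat.card (AStar (locRing D A h)) else 0

end Paper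

namespace Paper

theorem mem_hiSpec_prime {D : Type*} [CommRing D] [IsDomain D] {P : Ideal D}
    (h : P ∈ hiSpec D) : P.IsPrime := h.1

theorem maximal_mem_hiSpec {D : Type*} [CommRing D] [IsDomain D] {M : Ideal D}
    (h : M.IsMaximal) : M ∈ hiSpec D := ⟨h.isPrime, Or.inr (Or.inl h)⟩

end Paper

namespace Paper

/-! ### Equivariant closure operators -/

/-- A closure operator on `X` commuting with every map of the family `act`. -/
structure Clo {G X : Type*} [PartialOrder X] (act : G → X → X) where
  toFun : X → X
  le_cl : ∀ x, x ≤ toFun x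
  mono : ∀ ⦃x y⦄, x ≤ y → toFun x ≤ toFun y
  idem : ∀ x, toFun (toFun x) = toFun x
  equivariant : ∀ g x, toFun (act g x) = act g (toFun x)

/-- The maps of the family `act` fix the top element. -/
class FixesTop {G X : Type*} [PartialOrder X] [OrderTop X] (act : G → X → X) : Prop where
  act_top : ∀ g, act g ⊤ = ⊤

namespace Clo

variable {G X : Type*} [PartialOrder X] {act : G → X → X}

theorem ext' {s t : Clo act} (h : ∀ x, s.toFun x = t.toFun x) : s = t := by
  cases s; cases t; congr; exact funext h

instance : PartialOrder (Clo act) where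
  le s t := ∀ x, s.toFun x ≤ t.toFun x
  le_refl _ _ := le_rfl
  le_trans _ _ _ hab hbc x := (hab x).trans (hbc x)
  le_antisymm _ _ h h' := ext' fun x => le_antisymm (h x) (h' x)

instance [OrderTop X] [FixesTop act] : OrderTop (Clo act) where
  top := ⟨fun _ => ⊤, fun _ => le_top, fun _ _ _ => le_rfl, fun _ => rfl,
    fun g _ => (FixesTop.act_top (act := act) g).symm⟩
  le_top _ _ := le_top

@[simp] theorem toFun_top [OrderTop X] (c : Clo act) : c.toFun ⊤ = ⊤ :=
  top_le_iff.1 (c.le_cl ⊤)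

/-- A closure operator which sends some proper element to the top is the top operator, as soon
as every proper element can be moved below any other element. -/
theorem eq_top_of_toFun_eq_top [OrderTop X] [FixesTop act]
    (hcof : ∀ x y : X, x ≠ ⊤ → ∃ g, act g x ≤ y) {c : Clo act} {x : X} (hx : x ≠ ⊤)
    (h : c.toFun x = ⊤) : c = ⊤ := by
  refine ext' fun y => ?_
  obtain ⟨g, hg⟩ := hcof x y hx
  have := c.mono hg
  rw [c.equivariant, h, FixesTop.act_top (act := act)] at this
  exact top_le_iff.1 this

/-- Transport of equivariant closure operators along an order isomorphism. -/
def congr {H Y : Type*} [PartialOrder Y] {act' : H → Y → Y} (e : X ≃o Y)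
    (h₁ : ∀ g, ∃ h, ∀ x, e (act g x) = act' h (e x))
    (h₂ : ∀ h, ∃ g, ∀ x, e (act g x) = act' h (e x)) : Clo act ≃o Clo act' where
  toFun c :=
    { toFun := fun y => e (c.toFun (e.symm y))
      le_cl := fun y => by rw [← e.symm_apply_le]; exact c.le_cl _
      mono := fun y z h => e.monotone (c.mono (e.symm.monotone h))
      idem := fun y => by simp [c.idem]
      equivariant := fun h y => by
        obtain ⟨g, hg⟩ := h₂ h
        have : e.symm (act' h y) = act g (e.symm y) := by
          rw [e.symm_apply_eq, hg, e.apply_symm_apply]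
        rw [this, c.equivariant, hg] }
  invFun c :=
    { toFun := fun x => e.symm (c.toFun (e x))
      le_cl := fun y => by rw [e.le_symm_apply]; exact c.le_cl _
      mono := fun y z h => e.symm.monotone (c.mono (e.monotone h))
      idem := fun y => by simp [c.idem]
      equivariant := fun g x => by
        obtain ⟨h, hh⟩ := h₁ g
        rw [hh, c.equivariant, e.symm_apply_eq, hh, e.apply_symm_apply] }
  left_inv c := ext' fun x => by simp
  right_inv c := ext' fun x => by simp
  map_rel_iff' {c c'} := by
    constructor
    · intro h x
      simpa using h (e x)
    · intro h y
      exact e.monotone (h _)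

theorem congr_toFun {H Y : Type*} [PartialOrder Y] {act' : H → Y → Y} (e : X ≃o Y)
    (h₁ : ∀ g, ∃ h, ∀ x, e (act g x) = act' h (e x))
    (h₂ : ∀ h, ∃ g, ∀ x, e (act g x) = act' h (e x)) (c : Clo act) (x : X) :
    (congr e h₁ h₂ c).toFun (e x) = e (c.toFun x) := by
  simp [congr]

end Clo

/-! ### Compatible families -/

/-- Families of elements of the posets `Q i`, indexed by the members of `𝒜`, describing the
closure operators on a product of posets. -/
abbrev Fam {ι : Type*} (𝒜 : Set (Set ι)) (Q : ι → Type*) [∀ i, PartialOrder (Q i)]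
    [∀ i, OrderTop (Q i)] : Type _ :=
  {F : 𝒜 → ∀ i, Q i // (∀ A i, i ∉ A.1 → F A i = ⊤) ∧ (∀ A A', A.1 ⊆ A'.1 → F A' ≤ F A) ∧
    ∀ A, ∃ A' : 𝒜, A'.1 = {i | F A i ≠ ⊤} ∧ F A' = F A}

namespace Fam

variable {ι : Type*} {𝒜 : Set (Set ι)} {Q : ι → Type*} [∀ i, PartialOrder (Q i)]
  [∀ i, OrderTop (Q i)]

theorem le_def {F F' : Fam 𝒜 Q} : F ≤ F' ↔ ∀ A i, F.1 A i ≤ F'.1 A i := Iff.rfl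

/-- The map on families induced by order isomorphisms. -/
def map {Q' : ι → Type*} [∀ i, PartialOrder (Q' i)] [∀ i, OrderTop (Q' i)]
    (e : ∀ i, Q i ≃o Q' i) (F : Fam 𝒜 Q) : Fam 𝒜 Q' :=
  ⟨fun A i => e i (F.1 A i), fun A i hi => by simp [F.2.1 A i hi],
    fun A A' h i => (e i).monotone (F.2.2.1 A A' h i), fun A => by
      obtain ⟨A', h, h'⟩ := F.2.2.2 A
      exact ⟨A', by simpa using h, by funext i; simp only [h']⟩⟩

/-- Families of elements of isomorphic posets correspond to each other. -/
def congr {Q' : ι → Type*} [∀ i, PartialOrder (Q' i)] [∀ i, OrderTop (Q' i)]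
    (e : ∀ i, Q i ≃o Q' i) : Fam 𝒜 Q ≃o Fam 𝒜 Q' where
  toFun := map e
  invFun := map fun i => (e i).symm
  left_inv F := Subtype.ext <| funext fun A => funext fun i => by simp [map]
  right_inv F := Subtype.ext <| funext fun A => funext fun i => by simp [map]
  map_rel_iff' {F F'} := by
    simp only [le_def]
    exact forall_congr' fun A => forall_congr' fun i => (e i).le_iff_le

end Fam

section Product

variable {ι : Type*} (𝒜 : Set (Set ι)) {G L : ι → Type*} [∀ i, PartialOrder (L i)]
  [∀ i, OrderTop (L i)] (act : ∀ i, G i → L i → L i)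

/-- The elements of the product whose set of proper coordinates belongs to `𝒜`. -/
abbrev ProdOn (L : ι → Type*) [∀ i, PartialOrder (L i)] [∀ i, OrderTop (L i)] : Type _ :=
  {J : ∀ i, L i // {i | J i ≠ ⊤} ∈ 𝒜}

/-- Hypotheses on the actions on the factors. -/
class GoodAct {G X : Type*} [PartialOrder X] [OrderTop X] (act : G → X → X) : Prop
    extends FixesTop act where
  ne_top : ∀ g x, x ≠ ⊤ → act g x ≠ ⊤
  exists_id : ∃ g, ∀ x, act g x = x
  cofinal : ∀ x y : X, x ≠ ⊤ → ∃ g, act g x ≤ y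
  exists_ne_top : ∃ x : X, x ≠ ⊤

variable [∀ i, GoodAct (act i)]

theorem act_ne_top_iff {i : ι} {g : G i} {x : L i} : act i g x ≠ ⊤ ↔ x ≠ ⊤ :=
  ⟨fun h hx => h (by rw [hx, FixesTop.act_top (act := act i)]), GoodAct.ne_top g x⟩

theorem Clo.eq_top_of_apply {i : ι} {c : Clo (act i)} {x : L i} (hx : x ≠ ⊤)
    (h : c.toFun x = ⊤) : c = ⊤ :=
  Clo.eq_top_of_toFun_eq_top GoodAct.cofinal hx h

/-- The coordinatewise action of the product. -/
def prodAct (g : ∀ i, G i) (J : ProdOn 𝒜 L) : ProdOn 𝒜 L :=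
  ⟨fun i => act i (g i) (J.1 i), by simpa only [act_ne_top_iff] using J.2⟩

/-- The closure operator attached to a compatible family. -/
def Fam.toClo (F : Fam 𝒜 fun i => Clo (act i)) : Clo (prodAct 𝒜 act) where
  toFun J := ⟨fun i => (F.1 ⟨_, J.2⟩ i).toFun (J.1 i), by
    obtain ⟨A', h, -⟩ := F.2.2.2 ⟨_, J.2⟩
    convert A'.2 using 1
    rw [h]
    ext i
    simp only [Set.mem_ofPred_eq]
    constructor
    · intro h1 h2
      apply h1
      rw [h2]; rfl
    · intro h1 h2
      apply h1
      apply Clo.eq_top_of_apply act _ h2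
      intro h3
      exact h1 (F.2.1 _ i (by simpa using h3))⟩
  le_cl J i := (F.1 _ i).le_cl _
  mono J J' h i := by
    refine le_trans (F.2.2.1 ⟨_, J'.2⟩ ⟨_, J.2⟩ ?_ i _) ((F.1 _ i).mono (h i))
    intro j hj hj'
    exact hj (top_le_iff.1 (hj' ▸ h j))
  idem J := by
    obtain ⟨A', h, h'⟩ := F.2.2.2 ⟨_, J.2⟩
    apply Subtype.ext
    funext i
    simp only
    have key : ∀ (S : Set ι) (hS : S ∈ 𝒜), S = A'.1 → F.1 ⟨S, hS⟩ = F.1 ⟨_, J.2⟩ := by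
      rintro S hS rfl
      exact h'
    rw [key _ _ ?_, Clo.idem]
    rw [h]
    ext j
    simp only [Set.mem_ofPred_eq]
    constructor
    · intro h1 h2
      apply h1
      rw [h2]; rfl
    · intro h1 h2
      apply h1
      apply Clo.eq_top_of_apply act _ h2
      intro h3
      exact h1 (F.2.1 _ j (by simpa using h3))
  equivariant g J := by
    apply Subtype.ext
    funext i
    have key : ∀ (S : Set ι) (hS : S ∈ 𝒜), S = {i | J.1 i ≠ ⊤} →
        F.1 ⟨S, hS⟩ = F.1 ⟨_, J.2⟩ := by
      rintro S hS rfl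
      rfl
    simp only [prodAct]
    rw [key _ _ (by simp only [act_ne_top_iff]), Clo.equivariant]

theorem Fam.toClo_apply (F : Fam 𝒜 fun i => Clo (act i)) (J : ProdOn 𝒜 L) (i : ι) :
    ((F.toClo 𝒜 act).toFun J).1 i = (F.1 ⟨_, J.2⟩ i).toFun (J.1 i) := rfl

variable {𝒜} in
open Classical in
/-- The tuple with coordinate `x` at `i`, fixed proper coordinates at the other elements of
`A`, and top coordinates elsewhere. -/
def baseTuple (A : Set ι) (i : ι) (x : L i) : ∀ j, L j :=
  Function.update (fun j => if j ∈ A then (GoodAct.exists_ne_top (act j)).choose else ⊤) i x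

variable {act}

@[simp] theorem baseTuple_same (A : Set ι) (i : ι) (x : L i) : baseTuple act A i x i = x := by
  simp [baseTuple]

theorem baseTuple_of_ne (A : Set ι) {i j : ι} (h : j ≠ i) (x y : L i) :
    baseTuple act A i x j = baseTuple act A i y j := by
  simp [baseTuple, h]

theorem baseTuple_ne_top {A : Set ι} {i : ι} {x : L i} (hi : i ∈ A) (hx : x ≠ ⊤) :
    {j | baseTuple act A i x j ≠ ⊤} = A := by
  ext j
  by_cases h : j = i
  · subst h; simp [hi, hx]
  · by_cases hA : j ∈ A <;> simp [baseTuple, h, hA]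
    exact (GoodAct.exists_ne_top (act j)).choose_spec

theorem baseTuple_le {A A' : Set ι} (h : A ⊆ A') (i : ι) (x : L i) :
    baseTuple act A' i x ≤ baseTuple act A i x := by
  intro j
  by_cases hj : j = i
  · subst hj; simp
  · by_cases hA : j ∈ A
    · simp [baseTuple, hj, hA, h hA]
    · simp [baseTuple, hj, hA]

variable {𝒜}

theorem Clo.prod_exists_act {J J' : ProdOn 𝒜 L} {i : ι} (hi : J.1 i ≤ J'.1 i)
    (hs : ∀ j, J.1 j = ⊤ → J'.1 j = ⊤) :
    ∃ g : ∀ j, G j, (∀ x, act i (g i) x = x) ∧ prodAct 𝒜 act g J ≤ J' := by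
  classical
  have hg : ∀ j, ∃ g : G j, (j = i → ∀ x, act j g x = x) ∧ act j g (J.1 j) ≤ J'.1 j := by
    intro j
    by_cases hj : j = i
    · subst hj
      obtain ⟨g, hg⟩ := GoodAct.exists_id (act := act j)
      exact ⟨g, fun _ => hg, by rw [hg]; exact hi⟩
    · by_cases ht : J.1 j = ⊤
      · obtain ⟨g, hg⟩ := GoodAct.exists_id (act := act j)
        exact ⟨g, fun _ => hg, by rw [hs j ht]; exact le_top⟩
      · obtain ⟨g, hg⟩ := GoodAct.cofinal (act := act j) (J.1 j) (J'.1 j) ht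
        exact ⟨g, fun h => absurd h hj, hg⟩
  choose g hg using hg
  exact ⟨g, (hg i).1 rfl, fun j => (hg j).2⟩

theorem Clo.prod_apply_le (c : Clo (prodAct 𝒜 act)) {J J' : ProdOn 𝒜 L} {i : ι}
    (hi : J.1 i ≤ J'.1 i) (hs : ∀ j, J.1 j = ⊤ → J'.1 j = ⊤) :
    (c.toFun J).1 i ≤ (c.toFun J').1 i := by
  obtain ⟨g, hg, hle⟩ := Clo.prod_exists_act (act := act) hi hs
  have := c.mono hle i
  rw [c.equivariant] at this
  simpa [prodAct, hg] using this

theorem Clo.prod_apply_eq_top (c : Clo (prodAct 𝒜 act)) {J J' : ProdOn 𝒜 L} {i : ι}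
    (hs : ∀ j, J.1 j = ⊤ → J'.1 j = ⊤) (h : (c.toFun J).1 i = ⊤) :
    (c.toFun J').1 i = ⊤ := by
  classical
  by_cases ht : J.1 i = ⊤
  · exact top_le_iff.1 ((hs i ht).ge.trans (c.le_cl J' i))
  have hg : ∀ j, ∃ g : G j, act j g (J.1 j) ≤ J'.1 j := by
    intro j
    by_cases ht : J.1 j = ⊤
    · obtain ⟨g, hg⟩ := GoodAct.exists_id (act := act j)
      exact ⟨g, by rw [hs j ht]; exact le_top⟩
    · exact GoodAct.cofinal (act := act j) (J.1 j) (J'.1 j) ht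
  choose g hg using hg
  have : (c.toFun (prodAct 𝒜 act g J)).1 i ≤ (c.toFun J').1 i := c.mono (fun j => hg j) i
  rw [c.equivariant] at this
  have h2 : act i (g i) ((c.toFun J).1 i) ≤ (c.toFun J').1 i := this
  rw [h, FixesTop.act_top (act := act i)] at h2
  exact top_le_iff.1 h2

open Classical in
/-- The component of a closure operator on a product. -/
def Clo.component (c : Clo (prodAct 𝒜 act)) (A : 𝒜) {i : ι} (hi : i ∈ A.1) : Clo (act i) where
  toFun x := if hx : x = ⊤ then ⊤ else
    (c.toFun ⟨baseTuple act A.1 i x, by rw [baseTuple_ne_top hi hx]; exact A.2⟩).1 i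
  le_cl x := by
    split_ifs with hx
    · exact le_top
    · simpa using c.le_cl ⟨baseTuple act A.1 i x, by rw [baseTuple_ne_top hi hx]; exact A.2⟩ i
  mono x y h := by
    by_cases hy : y = ⊤
    · simp [hy]
    · have hx : x ≠ ⊤ := fun hx => hy (top_le_iff.1 (hx ▸ h))
      simp only [hx, hy, dif_neg, not_false_iff]
      refine c.mono ?_ i
      intro j
      by_cases hj : j = i
      · subst hj; simpa using h
      · exact (baseTuple_of_ne (act := act) _ hj _ _).le
  idem x := by
    by_cases hx : x = ⊤
    · simp [hx]
    simp only [hx, dif_neg, not_false_iff]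
    set N := c.toFun ⟨baseTuple act A.1 i x, by rw [baseTuple_ne_top hi hx]; exact A.2⟩ with hN
    split_ifs with hz
    · exact hz.symm
    · refine le_antisymm ?_ ?_
      · have hNN : c.toFun N = N := by rw [hN, c.idem]
        refine (c.mono (?_ : _ ≤ N) i).trans_eq (by rw [hNN])
        intro j
        by_cases hj : j = i
        · subst hj; simp [hN]
        · refine (baseTuple_of_ne (act := act) A.1 hj _ x).le.trans ?_
          exact c.le_cl ⟨baseTuple act A.1 i x, by rw [baseTuple_ne_top hi hx]; exact A.2⟩ j
      · simpa using c.le_cl ⟨baseTuple act A.1 i (N.1 i),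
          by rw [baseTuple_ne_top hi hz]; exact A.2⟩ i
  equivariant g x := by
    by_cases hx : x = ⊤
    · simp [hx, FixesTop.act_top (act := act i)]
    have hgx : act i g x ≠ ⊤ := GoodAct.ne_top g x hx
    simp only [hx, hgx, dif_neg, not_false_iff]
    choose g0 hg0 using fun j => GoodAct.exists_id (act := act j)
    have := congrArg (fun J : ProdOn 𝒜 L => J.1 i) (c.equivariant (Function.update g0 i g)
      ⟨baseTuple act A.1 i x, by rw [baseTuple_ne_top hi hx]; exact A.2⟩)
    simp only [prodAct, Function.update_self] at this
    rw [← this]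
    refine congrArg (fun J : ProdOn 𝒜 L => (c.toFun J).1 i) (Subtype.ext (funext fun j => ?_))
    by_cases hj : j = i
    · subst hj; simp
    · simp only [Function.update_of_ne hj, hg0]
      exact baseTuple_of_ne (act := act) _ hj _ _

theorem Clo.component_apply (c : Clo (prodAct 𝒜 act)) (A : 𝒜) {i : ι} (hi : i ∈ A.1) {x : L i}
    (hx : x ≠ ⊤) : (c.component A hi).toFun x =
      (c.toFun ⟨baseTuple act A.1 i x, by rw [baseTuple_ne_top hi hx]; exact A.2⟩).1 i := by
  simp [component, hx]

theorem Clo.component_apply_of_eq (c : Clo (prodAct 𝒜 act)) (J : ProdOn 𝒜 L) (A : 𝒜) {i : ι}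
    (hA : A.1 = {j | J.1 j ≠ ⊤}) (hi : i ∈ A.1) :
    (c.component A hi).toFun (J.1 i) = (c.toFun J).1 i := by
  have hx : J.1 i ≠ ⊤ := by rw [hA] at hi; exact hi
  rw [c.component_apply A hi hx]
  have hb := baseTuple_ne_top (act := act) hi hx
  have hiff : ∀ j, baseTuple act A.1 i (J.1 i) j = ⊤ ↔ J.1 j = ⊤ := by
    intro j
    have := Set.ext_iff.1 (hb.trans hA) j
    simpa [not_iff_not] using this
  refine le_antisymm (c.prod_apply_le ?_ ?_) (c.prod_apply_le ?_ ?_)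
  · simp
  · intro j; exact (hiff j).1
  · simp
  · intro j; exact (hiff j).2

theorem Clo.component_eq_top_iff (c : Clo (prodAct 𝒜 act)) (J : ProdOn 𝒜 L) (A : 𝒜) {i : ι}
    (hA : A.1 = {j | J.1 j ≠ ⊤}) (hi : i ∈ A.1) :
    c.component A hi = ⊤ ↔ (c.toFun J).1 i = ⊤ := by
  have hx : J.1 i ≠ ⊤ := by rw [hA] at hi; exact hi
  rw [← c.component_apply_of_eq J A hA hi]
  constructor
  · intro h; rw [h]; rfl
  · exact Clo.eq_top_of_apply act hx

theorem exists_prodOn (act : ∀ i, G i → L i → L i) [∀ i, GoodAct (act i)] (A : 𝒜) :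
    ∃ J : ProdOn 𝒜 L, A.1 = {j | J.1 j ≠ ⊤} := by
  classical
  have : {j | (fun j => if j ∈ A.1 then (GoodAct.exists_ne_top (act j)).choose else ⊤) j ≠ ⊤}
      = A.1 := by
    ext j
    by_cases hA : j ∈ A.1 <;> simp [hA]
    exact (GoodAct.exists_ne_top (act j)).choose_spec
  exact ⟨⟨fun j => if j ∈ A.1 then (GoodAct.exists_ne_top (act j)).choose else ⊤,
    by rw [this]; exact A.2⟩, this.symm⟩

variable (𝒜 act)

theorem Fam.toClo_surjective : Function.Surjective (Fam.toClo 𝒜 act) := by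
  classical
  intro c
  have hsupp : ∀ (A : 𝒜) (J : ProdOn 𝒜 L), A.1 = {j | J.1 j ≠ ⊤} →
      {i | (fun i => if hi : i ∈ A.1 then c.component A hi else ⊤) i ≠ ⊤} =
        {i | (c.toFun J).1 i ≠ ⊤} := by
    intro A J hJ
    ext i
    by_cases hi : i ∈ A.1
    · simp only [hi, dif_pos, Set.mem_ofPred_eq]
      exact not_congr (c.component_eq_top_iff J A hJ hi)
    · simp only [hi, dif_neg, not_false_iff, Set.mem_ofPred_eq, ne_eq, not_true_eq_false,
        false_iff, not_not]
      rw [hJ] at hi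
      have hi : J.1 i = ⊤ := by simpa using hi
      exact top_le_iff.1 (hi.ge.trans (c.le_cl J i))
  refine ⟨⟨fun A i => if hi : i ∈ A.1 then c.component A hi else ⊤, ?_, ?_, ?_⟩, ?_⟩
  · intro A i hi
    simp [hi]
  · intro A A' hAA' i
    by_cases hi : i ∈ A.1
    · have hi' := hAA' hi
      simp only [hi, hi', dif_pos]
      intro x
      by_cases hx : x = ⊤
      · simp [hx]
      · rw [c.component_apply A hi hx, c.component_apply A' hi' hx]
        exact c.mono (baseTuple_le (act := act) hAA' i x) i
    · simp [hi]
  · intro A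
    obtain ⟨J, hJ⟩ := exists_prodOn act A
    refine ⟨⟨_, (c.toFun J).2⟩, (hsupp A J hJ).symm, ?_⟩
    funext i
    have hsub : ∀ {i}, (c.toFun J).1 i ≠ ⊤ → i ∈ A.1 := by
      intro i hi
      by_contra h
      rw [hJ] at h
      have h : J.1 i = ⊤ := by simpa using h
      exact hi (top_le_iff.1 (h.ge.trans (c.le_cl J i)))
    by_cases hi' : (c.toFun J).1 i = ⊤
    · have : ¬ i ∈ ({i | (c.toFun J).1 i ≠ ⊤} : Set ι) := by simpa using hi'
      simp only [this, dif_neg, not_false_iff]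
      by_cases hi : i ∈ A.1
      · simp only [hi, dif_pos]
        exact ((c.component_eq_top_iff J A hJ hi).2 hi').symm
      · simp [hi]
    · have hmem : i ∈ ({i | (c.toFun J).1 i ≠ ⊤} : Set ι) := hi'
      have hi := hsub hi'
      simp only [hmem, hi, dif_pos]
      refine Clo.ext' fun x => ?_
      by_cases hx : x = ⊤
      · simp [hx]
      rw [c.component_apply A hi hx,
        c.component_apply ⟨_, (c.toFun J).2⟩ hmem hx]
      refine le_antisymm ?_ ?_
      · set N := c.toFun ⟨baseTuple act A.1 i x, by
          rw [baseTuple_ne_top hi hx]; exact A.2⟩ with hN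
        have hNN : c.toFun N = N := by rw [hN, c.idem]
        conv_rhs => rw [← hNN]
        refine c.prod_apply_le ?_ ?_
        · simpa using c.le_cl ⟨baseTuple act A.1 i x, by
            rw [baseTuple_ne_top hi hx]; exact A.2⟩ i
        · intro j hj
          have h2 : ¬ j ∈ {j | baseTuple act {i | (c.toFun J).1 i ≠ ⊤} i x j ≠ ⊤} := by
            simpa using hj
          rw [baseTuple_ne_top hmem hx] at h2
          have h2 : (c.toFun J).1 j = ⊤ := by simpa using h2
          refine c.prod_apply_eq_top ?_ h2
          intro k hk
          have h3 : ¬ k ∈ A.1 := by rw [hJ]; simpa using hk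
          rw [← baseTuple_ne_top (act := act) hi hx] at h3
          simpa using h3
      · exact c.mono (baseTuple_le (act := act) (fun j hj => hsub hj) i x) i
  · refine Clo.ext' fun J => Subtype.ext <| funext fun i => ?_
    rw [Fam.toClo_apply]
    by_cases hi : i ∈ {j | J.1 j ≠ ⊤}
    · simp only [hi, dif_pos]
      exact c.component_apply_of_eq J ⟨_, J.2⟩ rfl hi
    · simp only [hi, dif_neg, not_false_iff]
      have hi : J.1 i = ⊤ := by simpa using hi
      exact (top_le_iff.1 (hi.ge.trans (c.le_cl J i))).symm

theorem Fam.toClo_le_iff (F F' : Fam 𝒜 fun i => Clo (act i)) :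
    F.toClo 𝒜 act ≤ F'.toClo 𝒜 act ↔ F ≤ F' := by
  constructor
  · intro h A i x
    by_cases hi : i ∈ A.1
    · by_cases hx : x = ⊤
      · simp [hx]
      · have hb := baseTuple_ne_top (act := act) hi hx
        have := h ⟨baseTuple act A.1 i x, by rw [hb]; exact A.2⟩ i
        rw [toClo_apply, toClo_apply] at this
        have key : ∀ (S : Set ι) (hS : S ∈ 𝒜), S = A.1 → (⟨S, hS⟩ : 𝒜) = A := by
          rintro S hS rfl
          rfl
        rw [key _ _ hb] at this
        simpa using this
    · rw [F.2.1 A i hi, F'.2.1 A i hi]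
  · intro h J i
    exact h _ i _

/-- Equivariant closure operators on a product are given by compatible families of equivariant
closure operators on the factors. -/
def Fam.isoClo : Fam 𝒜 (fun i => Clo (act i)) ≃o Clo (prodAct 𝒜 act) where
  toEquiv := Equiv.ofBijective (Fam.toClo 𝒜 act)
    ⟨fun F F' h => le_antisymm ((toClo_le_iff 𝒜 act F F').1 h.le)
      ((toClo_le_iff 𝒜 act F' F).1 h.ge), toClo_surjective 𝒜 act⟩
  map_rel_iff' := toClo_le_iff 𝒜 act _ _

end Product

/-! ### The valuations attached to the primes of a Prüfer domain -/

section Pruefer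

variable {D : Type*} [CommRing D] [IsDomain D]
variable {K : Type*} [Field K] [Algebra D K] [IsFractionRing D K]

theorem mem_locAt {P : Ideal D} (hP : P.IsPrime) {x : K} :
    x ∈ locAt D K P hP ↔ ∃ s ∉ P, ∃ a, algebraMap D K s * x = algebraMap D K a := by
  have hle : P.primeCompl ≤ nonZeroDivisors D :=
    fun _ hx => mem_nonZeroDivisors_of_ne_zero fun h => hx (h ▸ P.zero_mem)
  have h0 : ∀ s ∉ P, algebraMap D K s ≠ 0 := fun s hs h => hs <| by
    rw [(map_eq_zero_iff _ (IsFractionRing.injective D K)).1 h]; exact P.zero_mem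
  have : x ∈ locAt D K P hP ↔
      ∃ a s, ∃ hs : s ∈ P.primeCompl, x = IsLocalization.mk' K a ⟨s, hle hs⟩ := by
    rfl
  rw [this]
  constructor
  · rintro ⟨a, s, hs, rfl⟩
    exact ⟨s, hs, a, by rw [mul_comm]; exact IsLocalization.mk'_spec K a ⟨s, hle hs⟩⟩
  · rintro ⟨s, hs, a, h⟩
    exact ⟨a, s, hs, by rw [IsLocalization.eq_mk'_iff_mul_eq, ← h, mul_comm]⟩

variable (hp : IsPrufer D K) (P : PrimeSpectrum D)

/-- The localization at a prime of a Prüfer domain, as a valuation ring of the quotient field. -/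
def vr : ValuationSubring K :=
  { (locAt D K P.asIdeal P.isPrime).toSubring with
    mem_or_inv_mem' := fun x => by
      obtain ⟨a, b, hb, rfl⟩ := IsFractionRing.div_surjective (A := D) x
      have hb0 : algebraMap D K b ≠ 0 :=
        IsFractionRing.to_map_ne_zero_of_mem_nonZeroDivisors hb
      obtain ⟨z, hz | hz⟩ := hp P.asIdeal P.isPrime (algebraMap D _ a) (algebraMap D _ b)
      · right
        have hz : algebraMap D K a * z.1 = algebraMap D K b := congrArg Subtype.val hz
        have ha0 : algebraMap D K a ≠ 0 := by
          intro h
          rw [h, zero_mul] at hz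
          exact hb0 hz.symm
        have : (algebraMap D K a / algebraMap D K b)⁻¹ = z.1 := by
          rw [← hz, inv_div]; field_simp
        rw [this]
        exact z.2
      · left
        have hz : algebraMap D K b * z.1 = algebraMap D K a := congrArg Subtype.val hz
        have : algebraMap D K a / algebraMap D K b = z.1 := by
          rw [← hz]; field_simp
        rw [this]
        exact z.2 }

/-- The valuation of the quotient field attached to a prime of a Prüfer domain. -/
def vl : Valuation K (vr hp P).ValueGroup := (vr hp P).valuation

theorem vl_le_one_iff_mem {x : K} : vl hp P x ≤ 1 ↔ x ∈ locAt D K P.asIdeal P.isPrime :=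
  (vr hp P).valuation_le_one_iff x

theorem vl_le_one_iff {x : K} :
    vl hp P x ≤ 1 ↔ ∃ s ∉ P.asIdeal, ∃ a, algebraMap D K s * x = algebraMap D K a := by
  rw [vl_le_one_iff_mem, mem_locAt]

theorem vl_algebraMap_le (a : D) : vl hp P (algebraMap D K a) ≤ 1 :=
  (vl_le_one_iff_mem hp P).2 (Subalgebra.algebraMap_mem _ a)

theorem vl_algebraMap_eq_one {a : D} : vl hp P (algebraMap D K a) = 1 ↔ a ∉ P.asIdeal := by
  constructor
  · intro h ha
    have h1 : vl hp P (algebraMap D K a)⁻¹ ≤ 1 := by rw [map_inv₀, h, inv_one]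
    obtain ⟨s, hs, b, h2⟩ := (vl_le_one_iff hp P).1 h1
    have ha0 : algebraMap D K a ≠ 0 := by
      intro h0; rw [h0, map_zero] at h; exact zero_ne_one h
    have : algebraMap D K s = algebraMap D K (b * a) := by
      rw [map_mul, ← h2]; field_simp
    rw [IsFractionRing.injective D K this] at hs
    exact hs (P.asIdeal.mul_mem_left b ha)
  · intro ha
    refine le_antisymm (vl_algebraMap_le hp P a) ?_
    have ha0 : algebraMap D K a ≠ 0 := fun h => ha <| by
      rw [(map_eq_zero_iff _ (IsFractionRing.injective D K)).1 h]; exact P.asIdeal.zero_mem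
    have : vl hp P (algebraMap D K a)⁻¹ ≤ 1 :=
      (vl_le_one_iff hp P).2 ⟨a, ha, 1, by rw [map_one, mul_inv_cancel₀ ha0]⟩
    rw [map_inv₀] at this
    exact (inv_le_one₀ (by simpa [zero_lt_iff] using ha0)).1 this

theorem vl_algebraMap_lt_one {a : D} : vl hp P (algebraMap D K a) < 1 ↔ a ∈ P.asIdeal := by
  rw [lt_iff_le_and_ne, Ne, vl_algebraMap_eq_one]
  simp [vl_algebraMap_le]

theorem vl_lt_one_iff {x : K} : vl hp P x < 1 ↔
    ∃ s ∉ P.asIdeal, ∃ a ∈ P.asIdeal, algebraMap D K s * x = algebraMap D K a := by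
  constructor
  · intro h
    obtain ⟨s, hs, a, h2⟩ := (vl_le_one_iff hp P).1 h.le
    refine ⟨s, hs, a, ?_, h2⟩
    rw [← vl_algebraMap_lt_one hp, ← h2, map_mul, (vl_algebraMap_eq_one hp P).2 hs, one_mul]
    exact h
  · rintro ⟨s, hs, a, ha, h⟩
    rw [← vl_algebraMap_lt_one hp, ← h, map_mul, (vl_algebraMap_eq_one hp P).2 hs, one_mul] at ha
    exact ha

variable {P}

theorem vl_le_one_of_le {Q : PrimeSpectrum D} (h : P ≤ Q) {x : K} (hx : vl hp Q x ≤ 1) :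
    vl hp P x ≤ 1 := by
  obtain ⟨s, hs, a, h2⟩ := (vl_le_one_iff hp Q).1 hx
  exact (vl_le_one_iff hp P).2 ⟨s, fun h3 => hs (h h3), a, h2⟩

theorem vl_lt_one_of_le {Q : PrimeSpectrum D} (h : P ≤ Q) {x : K} (hx : vl hp P x < 1) :
    vl hp Q x < 1 := by
  by_contra hc
  rw [not_lt] at hc
  have hx0 : x ≠ 0 := by rintro rfl; simp at hc
  have h1 : vl hp Q x⁻¹ ≤ 1 := by
    rw [map_inv₀]
    exact inv_le_one_of_one_le₀ hc
  have := vl_le_one_of_le hp h h1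
  rw [map_inv₀, inv_le_one₀ (by simpa [zero_lt_iff] using hx0)] at this
  exact absurd hx (not_lt.2 this)

theorem vl_eq_one_of_le {Q : PrimeSpectrum D} (h : P ≤ Q) {x : K} (hx : vl hp Q x = 1) :
    vl hp P x = 1 :=
  le_antisymm (vl_le_one_of_le hp h hx.le) <| not_lt.1 fun hc =>
    (vl_lt_one_of_le hp h hc).ne hx

theorem vl_lt_of_lt {Q : PrimeSpectrum D} (h : P ≤ Q) {x y : K} (hx : vl hp P x < vl hp P y) :
    vl hp Q x < vl hp Q y := by
  have hy : y ≠ 0 := by rintro rfl; simp at hx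
  have h1 : vl hp P (x / y) < 1 := by
    rw [map_div₀, div_lt_one₀ (by simpa [zero_lt_iff] using hy)]; exact hx
  have := vl_lt_one_of_le hp h h1
  rwa [map_div₀, div_lt_one₀ (by simpa [zero_lt_iff] using hy)] at this

theorem vl_le_of_le {Q : PrimeSpectrum D} (h : P ≤ Q) {x y : K} (hx : vl hp Q x ≤ vl hp Q y) :
    vl hp P x ≤ vl hp P y :=
  not_lt.1 fun hc => not_lt.2 hx (vl_lt_of_lt hp h hc)

/-- The primes contained in a given prime of a Prüfer domain form a chain. -/
theorem le_total_of_le {Q Q' : PrimeSpectrum D} (hp : IsPrufer D K) (h : Q ≤ P) (h' : Q' ≤ P) :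
    Q ≤ Q' ∨ Q' ≤ Q := by
  by_contra! hc
  obtain ⟨a, ha, ha'⟩ := SetLike.not_le_iff_exists.1 (show ¬ Q.asIdeal ≤ Q'.asIdeal from hc.1)
  obtain ⟨b, hb, hb'⟩ := SetLike.not_le_iff_exists.1 (show ¬ Q'.asIdeal ≤ Q.asIdeal from hc.2)
  rcases le_total (vl hp P (algebraMap D K a)) (vl hp P (algebraMap D K b)) with h1 | h1
  · have := vl_le_of_le hp h' h1
    rw [(vl_algebraMap_eq_one hp Q').2 ha'] at this
    exact absurd ((vl_algebraMap_lt_one hp Q').2 hb) (not_lt.2 this)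
  · have := vl_le_of_le hp h h1
    rw [(vl_algebraMap_eq_one hp Q).2 hb'] at this
    exact absurd ((vl_algebraMap_lt_one hp Q).2 ha) (not_lt.2 this)

theorem exists_not_mem_of_forall_maximal {I : Ideal D}
    (h : ∀ M : PrimeSpectrum D, M.asIdeal.IsMaximal → ¬ I ≤ M.asIdeal) : I = ⊤ := by
  by_contra hI
  obtain ⟨M, hM, hle⟩ := Ideal.exists_le_maximal I hI
  exact h ⟨M, hM.isPrime⟩ hM hle

/-- An element of positive value at `p` is brought into the ring by an element congruent to one
modulo `p`. -/
theorem exists_one_add_smul_mem (p : PrimeSpectrum D) {x : K} (hx : vl hp p x < 1) :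
    ∃ d : D, d - 1 ∈ p.asIdeal ∧ ∃ a ∈ p.asIdeal, algebraMap D K d * x = algebraMap D K a := by
  let I : Ideal D := Submodule.comap (LinearMap.toSpanSingleton D K x)
    (Submodule.map (Algebra.linearMap D K) p.asIdeal)
  have hI : ∀ d, d ∈ I ↔ ∃ a ∈ p.asIdeal, algebraMap D K d * x = algebraMap D K a := by
    intro d
    simp [I, Algebra.smul_def, eq_comm]
  have key : I ⊔ p.asIdeal = ⊤ := by
    refine exists_not_mem_of_forall_maximal fun M hM hle => ?_
    have hpM : p ≤ M := le_sup_right.trans hle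
    obtain ⟨s, hs, a, h⟩ := (vl_le_one_iff hp M).1 (vl_lt_one_of_le hp hpM hx).le
    refine hs (hle (Ideal.mem_sup_left ((hI s).2 ⟨a, ?_, h⟩)))
    rw [← vl_algebraMap_lt_one hp, ← h, map_mul]
    exact mul_lt_one_of_nonneg_of_lt_one_right (vl_algebraMap_le hp p s) zero_le hx
  obtain ⟨d, hd, b, hb, hdb⟩ := Submodule.mem_sup.1 ((Ideal.eq_top_iff_one _).1 key)
  exact ⟨d, by rw [← hdb]; simpa using hb, (hI d).1 hd⟩

/-- The elements congruent to one modulo a prime. -/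
def oneAdd (p : PrimeSpectrum D) : Submonoid D where
  carrier := {d | d - 1 ∈ p.asIdeal}
  one_mem' := by simp
  mul_mem' {a b} ha hb := by
    have : a * b - 1 = a * (b - 1) + (a - 1) := by ring
    simp only [Set.mem_ofPred_eq] at *
    rw [this]
    exact add_mem (p.asIdeal.mul_mem_left a hb) ha

theorem mem_oneAdd {p : PrimeSpectrum D} {d : D} : d ∈ oneAdd p ↔ d - 1 ∈ p.asIdeal := Iff.rfl

theorem not_mem_of_mem_oneAdd {p q : PrimeSpectrum D} (h : q ≤ p) {d : D} (hd : d ∈ oneAdd p) :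
    d ∉ q.asIdeal := fun hq => p.isPrime.ne_top <| (Ideal.eq_top_iff_one _).2 <| by
  have : (1 : D) = d - (d - 1) := by ring
  rw [this]
  exact sub_mem (h hq) hd

theorem oneAdd_le {p q : PrimeSpectrum D} (h : p ≤ q) : oneAdd p ≤ oneAdd q := fun _ hd => h hd

/-- The maximal ideal of the localization at a prime. -/
def mP (P : PrimeSpectrum D) : Submodule D K where
  carrier := {x | vl hp P x < 1}
  zero_mem' := by simp
  add_mem' {a b} ha hb := show vl hp P (a + b) < 1 from
    lt_of_le_of_lt ((vl hp P).map_add a b) (max_lt ha hb)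
  smul_mem' d x hx := by
    simp only [Set.mem_ofPred_eq] at *
    rw [Algebra.smul_def, map_mul]
    exact mul_lt_one_of_nonneg_of_lt_one_right (vl_algebraMap_le hp P d) zero_le hx

/-- The localization at a prime, as a submodule of the quotient field. -/
def oP (P : PrimeSpectrum D) : Submodule D K where
  carrier := {x | vl hp P x ≤ 1}
  zero_mem' := by simp
  add_mem' {a b} ha hb := show vl hp P (a + b) ≤ 1 from
    le_trans ((vl hp P).map_add a b) (max_le ha hb)
  smul_mem' d x hx := by
    simp only [Set.mem_ofPred_eq] at *
    rw [Algebra.smul_def, map_mul]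
    exact mul_le_one' (vl_algebraMap_le hp P d) hx

variable {hp}
theorem mem_mP {x : K} : x ∈ mP hp P ↔ vl hp P x < 1 := Iff.rfl
theorem mem_oP {x : K} : x ∈ oP hp P ↔ vl hp P x ≤ 1 := Iff.rfl

theorem mP_lt_oP : mP hp P < oP hp P :=
  lt_of_le_of_ne (fun _ h => mem_oP.2 (le_of_lt (mem_mP.1 h))) fun h => by
    have : (1 : K) ∈ mP hp P := by rw [h, mem_oP, map_one]
    rw [mem_mP, map_one] at this
    exact this.false

/-- Scaling of submodules. -/
def scl (x : K) (J : Submodule D K) : Submodule D K := J.comap (LinearMap.mulLeft D x⁻¹)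

theorem mem_scl {x y : K} {J : Submodule D K} : y ∈ scl x J ↔ x⁻¹ * y ∈ J := Iff.rfl

theorem scl_mono {x : K} {J J' : Submodule D K} (h : J ≤ J') : scl x J ≤ scl x J' :=
  fun _ hy => h hy

theorem scl_scl (x y : K) (J : Submodule D K) : scl x (scl y J) = scl (x * y) J := by
  ext z; simp [mem_scl, mul_assoc]

theorem scl_one (J : Submodule D K) : scl 1 J = J := by ext z; simp [mem_scl]

theorem scl_scl_inv {x : K} (hx : x ≠ 0) (J : Submodule D K) : scl x (scl x⁻¹ J) = J := by
  rw [scl_scl, mul_inv_cancel₀ hx, scl_one]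

theorem scl_inv_scl {x : K} (hx : x ≠ 0) (J : Submodule D K) : scl x⁻¹ (scl x J) = J := by
  rw [scl_scl, inv_mul_cancel₀ hx, scl_one]

theorem scl_le_iff {x : K} (hx : x ≠ 0) {J J' : Submodule D K} :
    scl x J ≤ J' ↔ J ≤ scl x⁻¹ J' :=
  ⟨fun h => by simpa [scl_inv_scl hx] using scl_mono (x := x⁻¹) h,
    fun h => by simpa [scl_scl_inv hx] using scl_mono (x := x) h⟩

theorem scl_le_scl_iff {x : K} (hx : x ≠ 0) {J J' : Submodule D K} :
    scl x J ≤ scl x J' ↔ J ≤ J' := by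
  rw [scl_le_iff hx, scl_inv_scl hx]

theorem span_singleton_mul_eq_scl {x : K} (hx : x ≠ 0) (J : Submodule D K) :
    Submodule.span D {x} * J = scl x J := by
  ext y
  rw [Submodule.mem_span_singleton_mul, mem_scl]
  constructor
  · rintro ⟨z, hz, rfl⟩
    rwa [inv_mul_cancel_left₀ hx]
  · intro h
    exact ⟨_, h, mul_inv_cancel_left₀ hx y⟩

end Pruefer

/-! ### Modules between the maximal ideal and the localization at a prime -/

section Lattices

variable {D : Type*} [CommRing D] [IsDomain D]
variable {K : Type*} [Field K] [Algebra D K] [IsFractionRing D K]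
variable (hp : IsPrufer D K) (P : PrimeSpectrum D) (S : Submonoid D)

/-- The modules `J` with `P D_P < J ≤ D_P` which are saturated with respect to `S`. -/
abbrev Lat : Type _ :=
  {J : Submodule D K // mP hp P < J ∧ J ≤ oP hp P ∧
    ∀ d ∈ S, ∀ x, vl hp P x ≤ 1 → d • x ∈ J → x ∈ J}

instance : OrderTop (Lat hp P S) where
  top := ⟨oP hp P, mP_lt_oP, le_rfl, fun _ _ _ hx _ => hx⟩
  le_top J := J.2.2.1

theorem Lat.coe_top : (⊤ : Lat hp P S).1 = oP hp P := rfl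

variable {hp P S}

theorem ne_zero_of_vl_eq_one {x : K} (h : vl hp P x = 1) : x ≠ 0 := by
  rintro rfl; simp at h

theorem scl_mP {x : K} (h : vl hp P x = 1) : scl x (mP hp P) = mP hp P := by
  ext y; rw [mem_scl, mem_mP, mem_mP, map_mul, map_inv₀, h]; simp

theorem scl_oP {x : K} (h : vl hp P x = 1) : scl x (oP hp P) = oP hp P := by
  ext y; rw [mem_scl, mem_oP, mem_oP, map_mul, map_inv₀, h]; simp

variable (hp P S)

/-- The action of the units of the localization by scaling. -/
def latAct (g : {x : K // vl hp P x = 1}) (J : Lat hp P S) : Lat hp P S :=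
  ⟨scl g.1 J.1, by
    have h0 := ne_zero_of_vl_eq_one g.2
    refine ⟨?_, ?_, ?_⟩
    · rw [lt_iff_le_not_ge]
      constructor
      · exact (scl_mP g.2).ge.trans (scl_mono J.2.1.le)
      · exact fun h => J.2.1.not_ge ((scl_le_scl_iff h0).1 (h.trans (scl_mP g.2).ge))
    · exact (scl_mono J.2.2.1).trans (scl_oP g.2).le
    · intro d hd x hx h
      rw [mem_scl] at h ⊢
      refine J.2.2.2 d hd _ (by rw [map_mul, map_inv₀, g.2]; simpa using hx) ?_
      rwa [mul_smul_comm] at h⟩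

theorem latAct_coe (g : {x : K // vl hp P x = 1}) (J : Lat hp P S) :
    (latAct hp P S g J).1 = scl g.1 J.1 := rfl

instance : FixesTop (latAct hp P S) where
  act_top g := Subtype.ext (scl_oP g.2)

/-- The prime `P'` lies above `P`, avoids `S`, and all elements congruent to one modulo `P'`
belong to `S`. -/
structure Mid (P P' : PrimeSpectrum D) (S : Submonoid D) : Prop where
  lt : P < P'
  le : oneAdd P' ≤ S
  not_mem : ∀ d ∈ S, d ∉ P'.asIdeal

theorem mid_oneAdd {P P' : PrimeSpectrum D} (h : P < P') : Mid P P' (oneAdd P') :=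
  ⟨h, le_rfl, fun _ hd => not_mem_of_mem_oneAdd le_rfl hd⟩

variable {hp P S} {P' : PrimeSpectrum D}

theorem exists_mem_not_mem_of_lt (h : P < P') : ∃ a ∈ P'.asIdeal, a ∉ P.asIdeal :=
  SetLike.not_le_iff_exists.1 (show ¬ P'.asIdeal ≤ P.asIdeal from h.not_ge)

theorem oneAdd_smul {J : Submodule D K}
    (hsat : ∀ d ∈ S, ∀ x, vl hp P x ≤ 1 → d • x ∈ J → x ∈ J) (hJ : J ≤ oP hp P)
    (hm : Mid P P' S) {x y : K} (hx : x ∈ J) (hy : vl hp P' y < vl hp P' x) : y ∈ J := by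
  have hx0 : x ≠ 0 := by rintro rfl; simp at hy
  have h1 : vl hp P' (y / x) < 1 := by
    rw [map_div₀, div_lt_one₀ (by simpa [zero_lt_iff] using hx0)]; exact hy
  obtain ⟨d, hd, a, -, h⟩ := exists_one_add_smul_mem hp P' h1
  refine hsat d (hm.le hd) y ?_ ?_
  · exact (vl_le_of_le hp hm.lt.le hy.le).trans (hJ hx)
  · have : d • y = a • x := by
      rw [Algebra.smul_def, Algebra.smul_def, ← h]; field_simp
    rw [this]
    exact J.smul_mem _ hx

theorem Lat.mem_of_vl_lt (hm : Mid P P' S) (J : Lat hp P S) {x y : K} (hx : x ∈ J.1)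
    (hy : vl hp P' y < vl hp P' x) : y ∈ J.1 :=
  oneAdd_smul J.2.2.2 J.2.2.1 hm hx hy

theorem Lat.vl_le_of_not_mem (hm : Mid P P' S) (J : Lat hp P S) {x y : K} (hx : x ∈ J.1)
    (hy : y ∉ J.1) : vl hp P' x ≤ vl hp P' y :=
  not_lt.1 fun h => hy (J.mem_of_vl_lt hm hx h)

theorem Lat.exists_vl_eq_one (J : Lat hp P S) : ∃ y ∈ J.1, vl hp P y = 1 := by
  obtain ⟨y, hy, hy'⟩ := SetLike.exists_of_lt J.2.1
  exact ⟨y, hy, le_antisymm (J.2.2.1 hy) (not_lt.1 hy')⟩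

theorem Lat.vl_eq_one_of_not_mem (J : Lat hp P S) {z : K} (hz : z ∈ oP hp P) (hz' : z ∉ J.1) :
    vl hp P z = 1 :=
  le_antisymm hz (not_lt.1 fun h => hz' (J.2.1.le h))

theorem Lat.exists_not_mem_of_ne_top {J : Lat hp P S} (h : J ≠ ⊤) : ∃ z ∈ oP hp P, z ∉ J.1 := by
  by_contra! hc
  exact h (Subtype.ext (le_antisymm J.2.2.1 hc))

theorem mP_mono {P P' : PrimeSpectrum D} (h : P ≤ P') : mP hp P ≤ mP hp P' :=
  fun _ hx => mem_mP.2 (vl_lt_one_of_le hp h hx)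

theorem oP_anti {P P' : PrimeSpectrum D} (h : P ≤ P') : oP hp P' ≤ oP hp P :=
  fun _ hx => mem_oP.2 (vl_le_one_of_le hp h hx)

theorem exists_not_mem_oP (h : P < P') : ∃ z ∈ oP hp P, z ∉ oP hp P' := by
  obtain ⟨a, ha, ha'⟩ := exists_mem_not_mem_of_lt h
  refine ⟨(algebraMap D K a)⁻¹, ?_, ?_⟩
  · rw [mem_oP, map_inv₀, (vl_algebraMap_eq_one hp P).2 ha', inv_one]
  · rw [mem_oP, map_inv₀]
    have h1 := (vl_algebraMap_lt_one hp P').2 ha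
    have h0 : algebraMap D K a ≠ 0 := fun h => ha' <| by
      rw [(map_eq_zero_iff _ (IsFractionRing.injective D K)).1 h]; exact P.asIdeal.zero_mem
    rw [inv_le_one₀ (by simpa [zero_lt_iff] using h0)]
    exact h1.not_ge

/-- The localization at `P'` as a saturated module. -/
def latV (hp : IsPrufer D K) (hm : Mid P P' S) : Lat hp P S :=
  ⟨oP hp P', (mP_mono hm.lt.le).trans_lt mP_lt_oP, oP_anti hm.lt.le, fun d hd x _ h => by
    have := hm.not_mem d hd
    rw [← vl_algebraMap_eq_one hp] at this
    rwa [mem_oP, Algebra.smul_def, map_mul, this, one_mul] at h⟩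

theorem latV_ne_top (hm : Mid P P' S) : latV hp hm ≠ ⊤ := fun h => by
  obtain ⟨z, hz, hz'⟩ := exists_not_mem_oP (hp := hp) hm.lt
  apply hz'
  have : (latV hp hm).1 = oP hp P := by rw [h]; rfl
  rw [← this] at hz
  exact hz

theorem goodAct_lat (hm : Mid P P' S) : GoodAct (latAct hp P S) where
  ne_top g J hJ h := by
    obtain ⟨z, hz, hz'⟩ := Lat.exists_not_mem_of_ne_top hJ
    have h0 := ne_zero_of_vl_eq_one g.2
    have h1 : g.1 * z ∈ (latAct hp P S g J).1 := by
      rw [h, Lat.coe_top, mem_oP, map_mul, g.2, one_mul]; exact hz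
    rw [latAct_coe, mem_scl, inv_mul_cancel_left₀ h0] at h1
    exact hz' h1
  exists_id := ⟨⟨1, map_one _⟩, fun J => Subtype.ext (scl_one _)⟩
  cofinal J J' hJ := by
    obtain ⟨z, hz, hz'⟩ := Lat.exists_not_mem_of_ne_top hJ
    have hz1 := J.vl_eq_one_of_not_mem hz hz'
    obtain ⟨y, hy, hy1⟩ := J'.exists_vl_eq_one
    obtain ⟨a, ha, ha'⟩ := exists_mem_not_mem_of_lt hm.lt
    have hz0 := ne_zero_of_vl_eq_one hz1
    have hy0 := ne_zero_of_vl_eq_one hy1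
    have ha1 := (vl_algebraMap_eq_one hp P).2 ha'
    have ha0 := ne_zero_of_vl_eq_one ha1
    refine ⟨⟨algebraMap D K a * y / z, by rw [map_div₀, map_mul, ha1, hy1, hz1]; simp⟩, ?_⟩
    intro x hx
    rw [latAct_coe, mem_scl] at hx
    have h1 := J.vl_le_of_not_mem hm hx hz'
    refine J'.mem_of_vl_lt hm hy ?_
    have hx2 : x = algebraMap D K a * y / z * ((algebraMap D K a * y / z)⁻¹ * x) := by
      rw [mul_inv_cancel_left₀]; exact div_ne_zero (mul_ne_zero ha0 hy0) hz0
    have hvz : 0 < vl hp P' z := by simpa [zero_lt_iff] using hz0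
    have hvy : 0 < vl hp P' y := by simpa [zero_lt_iff] using hy0
    rw [hx2, map_mul, map_div₀, map_mul]
    calc vl hp P' (algebraMap D K a) * vl hp P' y / vl hp P' z *
          vl hp P' ((algebraMap D K a * y / z)⁻¹ * x)
        ≤ vl hp P' (algebraMap D K a) * vl hp P' y / vl hp P' z * vl hp P' z :=
          mul_le_mul_right h1 _
      _ = vl hp P' (algebraMap D K a) * vl hp P' y := div_mul_cancel₀ _ hvz.ne'
      _ < 1 * vl hp P' y :=
          mul_lt_mul_of_pos_right ((vl_algebraMap_lt_one hp P').2 ha) hvy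
      _ = vl hp P' y := one_mul _
  exists_ne_top := ⟨latV hp hm, latV_ne_top hm⟩

end Lattices

section Decomposition

variable {D : Type*} [CommRing D] [IsDomain D]
variable {K : Type*} [Field K] [Algebra D K] [IsFractionRing D K]

/-! ### Localizing at a multiplicative set -/

/-- The localization of the domain at a multiplicative set, as a submodule of the quotient
field. -/
def locS (K : Type*) [Field K] [Algebra D K] (S : Submonoid D) : Submodule D K where
  carrier := {x | ∃ d ∈ S, ∃ a, algebraMap D K d * x = algebraMap D K a}
  zero_mem' := ⟨1, S.one_mem, 0, by simp⟩
  add_mem' := by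
    rintro x y ⟨d, hd, a, h⟩ ⟨d', hd', a', h'⟩
    refine ⟨d * d', S.mul_mem hd hd', d' * a + d * a', ?_⟩
    simp only [map_mul, map_add, ← h, ← h']
    ring
  smul_mem' := by
    rintro r x ⟨d, hd, a, h⟩
    refine ⟨d, hd, r * a, ?_⟩
    simp only [map_mul, ← h, Algebra.smul_def]
    ring

theorem mem_locS {S : Submonoid D} {x : K} :
    x ∈ locS K S ↔ ∃ d ∈ S, ∃ a, algebraMap D K d * x = algebraMap D K a := Iff.rfl

theorem one_mem_locS (S : Submonoid D) : (1 : K) ∈ locS K S :=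
  ⟨1, S.one_mem, 1, by simp⟩

variable {hp : IsPrufer D K} {P P' : PrimeSpectrum D} {S : Submonoid D}

theorem locS_le_oP (h : ∀ d ∈ S, d ∉ P.asIdeal) : locS K S ≤ oP hp P :=
  fun _ ⟨d, hd, a, ha⟩ => (vl_le_one_iff hp P).2 ⟨d, h d hd, a, ha⟩

theorem mP_le_locS (h : oneAdd P ≤ S) : mP hp P ≤ locS K S := fun _ hx => by
  obtain ⟨d, hd, a, -, h'⟩ := exists_one_add_smul_mem hp P hx
  exact ⟨d, h hd, a, h'⟩

/-- The localization at `S` as a saturated module. -/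
def latT (hp : IsPrufer D K) (h : oneAdd P ≤ S) (h' : ∀ d ∈ S, d ∉ P.asIdeal) : Lat hp P S :=
  ⟨locS K S, lt_of_le_of_ne (mP_le_locS h) fun he => by
      have := one_mem_locS (K := K) S
      rw [← he, mem_mP, map_one] at this
      exact this.false,
    locS_le_oP h', fun d hd x _ hdx => by
      obtain ⟨d', hd', a, h⟩ := hdx
      exact ⟨d' * d, S.mul_mem hd' hd, a, by
        rw [← h, Algebra.smul_def, map_mul, mul_assoc]⟩⟩

/-- The operator closes the localization at `S`. -/
def Closes (c : Clo (latAct hp P S)) : Prop :=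
  ∀ J : Lat hp P S, J.1 = locS K S → c.toFun J = J

theorem closes_iff (h : oneAdd P ≤ S) (h' : ∀ d ∈ S, d ∉ P.asIdeal) {c : Clo (latAct hp P S)} :
    Closes c ↔ c.toFun (latT hp h h') = latT hp h h' :=
  ⟨fun hc => hc _ rfl, fun hc J hJ => by
    have : J = latT hp h h' := Subtype.ext hJ
    rwa [this]⟩

theorem Closes.anti {c c' : Clo (latAct hp P S)} (h : c ≤ c') (hc : Closes c') : Closes c :=
  fun J hJ => le_antisymm ((h J).trans (hc J hJ).le) (c.le_cl J)

variable (hp P S) in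
/-- The saturation of a module with respect to `S`. -/
def satur (J : Submodule D K) : Submodule D K where
  carrier := {x | vl hp P x ≤ 1 ∧ ∃ d ∈ S, d • x ∈ J}
  zero_mem' := ⟨by simp, 1, S.one_mem, by simp⟩
  add_mem' := by
    rintro x y ⟨hx, d, hd, h⟩ ⟨hy, d', hd', h'⟩
    refine ⟨(oP hp P).add_mem hx hy, d * d', S.mul_mem hd hd', ?_⟩
    have : (d * d') • (x + y) = d' • d • x + d • d' • y := by
      rw [smul_add, mul_smul, smul_comm, mul_smul]
    rw [this]
    exact J.add_mem (J.smul_mem _ h) (J.smul_mem _ h')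
  smul_mem' := by
    rintro r x ⟨hx, d, hd, h⟩
    exact ⟨(oP hp P).smul_mem r hx, d, hd, by rw [smul_comm]; exact J.smul_mem _ h⟩

theorem le_satur {J : Submodule D K} (h : J ≤ oP hp P) : J ≤ satur hp P S J :=
  fun x hx => ⟨h hx, 1, S.one_mem, by simpa using hx⟩

/-- Saturation as a map between lattices of saturated modules. -/
def saturLat (S' : Submonoid D) (J : Lat hp P S) : Lat hp P S' :=
  ⟨satur hp P S' J.1, J.2.1.trans_le (le_satur J.2.2.1), fun _ h => h.1, by
    rintro d hd x hx ⟨-, d', hd', h⟩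
    exact ⟨hx, d' * d, S'.mul_mem hd' hd, by rwa [mul_smul]⟩⟩

/-! ### The decomposition over the primes directly above -/

variable {ι : Type*} {p : ι → PrimeSpectrum D}

/-- The primes `p i` are pairwise independent over `P` and below all maximal ideals containing
`P` properly. -/
structure Kids (P : PrimeSpectrum D) (p : ι → PrimeSpectrum D) : Prop where
  lt : ∀ i, P < p i
  exists_le : ∀ M : PrimeSpectrum D, M.asIdeal.IsMaximal → P < M → ∃ i, p i ≤ M
  le_of_le : ∀ i j, i ≠ j → ∀ Q, Q ≤ p i → Q ≤ p j → Q ≤ P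

theorem le_or_le_of_disjoint_oneAdd (hp : IsPrufer D K) {Q q : PrimeSpectrum D}
    (h : ∀ d ∈ oneAdd q, d ∉ Q.asIdeal) : Q ≤ q ∨ q ≤ Q := by
  have : Q.asIdeal ⊔ q.asIdeal ≠ ⊤ := by
    intro htop
    obtain ⟨a, ha, b, hb, hab⟩ := Submodule.mem_sup.1 ((Ideal.eq_top_iff_one _).1 htop)
    refine h a ?_ ha
    rw [mem_oneAdd, ← hab]
    simpa using hb
  obtain ⟨M, hM, hle⟩ := Ideal.exists_le_maximal _ this
  exact le_total_of_le (P := ⟨M, hM.isPrime⟩) hp (le_sup_left.trans hle) (le_sup_right.trans hle)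

theorem Kids.exists_mul_eq (hp : IsPrufer D K) (hk : Kids P p) {i j : ι} (hij : i ≠ j) {s : D}
    (hs : s ∉ P.asIdeal) :
    ∃ d ∈ oneAdd (p i), ∃ d' ∈ oneAdd (p j), ∃ t, d * d' = s * t := by
  by_contra! hc
  have hdisj : Disjoint (Ideal.span {s} : Set D) (oneAdd (p i) ⊔ oneAdd (p j) : Submonoid D) := by
    rw [Set.disjoint_left]
    intro x hx hx'
    obtain ⟨t, rfl⟩ := Ideal.mem_span_singleton'.1 hx
    obtain ⟨d, hd, d', hd', h⟩ := Submonoid.mem_sup.1 hx'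
    exact hc d hd d' hd' t (by rw [h, mul_comm])
  obtain ⟨Q, hQ, hsQ, hQd⟩ := Ideal.exists_le_prime_disjoint _ _ hdisj
  rw [Set.disjoint_left] at hQd
  have h1 := le_or_le_of_disjoint_oneAdd (Q := ⟨Q, hQ⟩) (q := p i) hp
    fun d hd hdQ => hQd hdQ ((le_sup_left : oneAdd (p i) ≤ _) hd)
  have h2 := le_or_le_of_disjoint_oneAdd (Q := ⟨Q, hQ⟩) (q := p j) hp
    fun d hd hdQ => hQd hdQ ((le_sup_right : oneAdd (p j) ≤ _) hd)
  have hij' : ¬ p i ≤ p j := fun h => (hk.lt i).not_ge (hk.le_of_le i j hij _ le_rfl h)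
  have hji' : ¬ p j ≤ p i := fun h => (hk.lt j).not_ge (hk.le_of_le i j hij _ h le_rfl)
  rcases h1 with h1 | h1 <;> rcases h2 with h2 | h2
  · exact hs (hk.le_of_le i j hij _ h1 h2 (hsQ (Ideal.mem_span_singleton_self s)))
  · exact hji' (h2.trans h1)
  · exact hij' (h1.trans h2)
  · rcases le_total_of_le hp h1 h2 with h | h
    · exact hij' h
    · exact hji' h

theorem exists_smul_mem_of_le_one (J : Lat hp P S) {x : K} (hx : vl hp P x ≤ 1) :
    ∃ s ∉ P.asIdeal, s • x ∈ J.1 := by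
  obtain ⟨y, hy, hy1⟩ := J.exists_vl_eq_one
  have hy0 := ne_zero_of_vl_eq_one hy1
  obtain ⟨s, hs, a, h⟩ := (vl_le_one_iff hp P (x := x / y)).1
    (by rw [map_div₀, hy1]; simpa using hx)
  refine ⟨s, hs, ?_⟩
  have : s • x = a • y := by
    rw [Algebra.smul_def, Algebra.smul_def, ← h]; field_simp
  rw [this]
  exact J.1.smul_mem _ hy

theorem Kids.exists_smul_mem (hk : Kids P p) {i j : ι} (hij : i ≠ j)
    (J : Lat hp P (oneAdd (p i))) {x : K} (hx : vl hp P x ≤ 1) :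
    ∃ d ∈ oneAdd (p j), d • x ∈ J.1 := by
  obtain ⟨s, hs, hsx⟩ := exists_smul_mem_of_le_one J hx
  obtain ⟨d, hd, d', hd', t, h⟩ := hk.exists_mul_eq hp hij hs
  refine ⟨d', hd', J.2.2.2 d hd _ ((oP hp P).smul_mem d' hx) ?_⟩
  rw [← mul_smul, h, mul_comm, mul_smul]
  exact J.1.smul_mem _ hsx

theorem Kids.mem_of_forall_mem (hk : Kids P p) (J : Lat hp P S) {x : K} (hx : vl hp P x ≤ 1)
    (h : ∀ i, ∃ d ∈ oneAdd (p i), d • x ∈ J.1) : x ∈ J.1 := by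
  let C : Ideal D := J.1.comap (LinearMap.toSpanSingleton D K x)
  have hC : ∀ d, d ∈ C ↔ d • x ∈ J.1 := fun d => Iff.rfl
  have hPC : P.asIdeal ≤ C := fun a ha => by
    rw [hC]
    refine J.2.1.le ?_
    rw [mem_mP, Algebra.smul_def, map_mul]
    exact (mul_le_mul_right hx _).trans_lt (by simpa using (vl_algebraMap_lt_one hp P).2 ha)
  have : C = ⊤ := by
    refine exists_not_mem_of_forall_maximal fun M hM hle => ?_
    have hPM : P ≤ M := hPC.trans hle
    rcases hPM.eq_or_lt with rfl | hlt
    · obtain ⟨s, hs, hsx⟩ := exists_smul_mem_of_le_one J hx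
      exact hs (hle ((hC s).2 hsx))
    · obtain ⟨i, hi⟩ := hk.exists_le M hM hlt
      obtain ⟨d, hd, hdx⟩ := h i
      exact not_mem_of_mem_oneAdd le_rfl (oneAdd_le hi hd) (hle ((hC d).2 hdx))
  have h1 : (1 : D) ∈ C := by rw [this]; trivial
  simpa [hC] using h1

variable [Finite ι]

variable (hp) in
/-- The module glued from its localizations. -/
def glue (hk : Kids P p) (J : ∀ i, Lat hp P (oneAdd (p i))) : Lat hp P (oneAdd P) :=
  ⟨oP hp P ⊓ ⨅ i, (J i).1, by
    classical
    cases nonempty_fintype ι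
    obtain ⟨x, hx, hx'⟩ : ∃ x ∈ oP hp P ⊓ ⨅ i, (J i).1, x ∉ mP hp P := by
      choose s hs hs' using fun i => exists_smul_mem_of_le_one (J i) (x := 1) (by simp)
      refine ⟨(∏ i, s i) • 1, ?_, ?_⟩
      · simp only [Submodule.mem_inf, Submodule.mem_iInf]
        refine ⟨(oP hp P).smul_mem _ (by simp [mem_oP]), fun i => ?_⟩
        rw [← Finset.prod_erase_mul _ _ (Finset.mem_univ i), mul_smul]
        exact (J i).1.smul_mem _ (hs' i)
      · rw [mem_mP, Algebra.smul_def, mul_one, vl_algebraMap_lt_one,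
          P.isPrime.prod_mem_iff]
        simpa using hs
    refine lt_of_le_of_ne (le_inf mP_lt_oP.le (le_iInf fun i => (J i).2.1.le)) ?_
    intro h
    rw [← h] at hx
    exact hx' hx, inf_le_left, by
    intro d hd x hx h
    simp only [Submodule.mem_inf, Submodule.mem_iInf] at h ⊢
    exact ⟨hx, fun i => (J i).2.2.2 d (oneAdd_le (hk.lt i).le hd) x hx (h.2 i)⟩⟩

theorem mem_glue (hk : Kids P p) {J : ∀ i, Lat hp P (oneAdd (p i))} {x : K} :
    x ∈ (glue hp hk J).1 ↔ vl hp P x ≤ 1 ∧ ∀ i, x ∈ (J i).1 := by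
  simp [glue, mem_oP]

variable (hp) in
/-- The saturated modules at `P` are glued from those at the primes above. -/
def kidsIso (hk : Kids P p) : Lat hp P (oneAdd P) ≃o ∀ i, Lat hp P (oneAdd (p i)) where
  toFun J i := saturLat _ J
  invFun J := glue hp hk J
  left_inv J := by
    refine Subtype.ext (Submodule.ext fun x => ?_)
    rw [mem_glue]
    exact ⟨fun h => hk.mem_of_forall_mem J h.1 fun i => (h.2 i).2,
      fun h => ⟨J.2.2.1 h, fun i => le_satur J.2.2.1 h⟩⟩
  right_inv J := by
    classical
    cases nonempty_fintype ι
    refine funext fun j => Subtype.ext (Submodule.ext fun x => ?_)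
    constructor
    · rintro ⟨hx, d, hd, h⟩
      exact (J j).2.2.2 d hd x hx (((mem_glue hk).1 h).2 j)
    · intro hx
      have hx1 : vl hp P x ≤ 1 := (J j).2.2.1 hx
      have : ∀ i, ∃ d ∈ oneAdd (p j), d • x ∈ (J i).1 := by
        intro i
        by_cases hij : i = j
        · subst hij
          exact ⟨1, one_mem _, by simpa using hx⟩
        · exact hk.exists_smul_mem hij (J i) hx1
      choose d hd hdx using this
      refine ⟨hx1, ∏ i, d i, prod_mem fun i _ => hd i, ?_⟩
      rw [mem_glue]
      refine ⟨(oP hp P).smul_mem _ hx1, fun i => ?_⟩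
      rw [← Finset.prod_erase_mul _ _ (Finset.mem_univ i), mul_smul]
      exact (J i).1.smul_mem _ (hdx i)
  map_rel_iff' {J J'} := by
    constructor
    · intro h x hx
      refine hk.mem_of_forall_mem J' (J.2.2.1 hx) fun i => ?_
      exact (h i (le_satur J.2.2.1 hx)).2
    · rintro h i x ⟨hx, d, hd, hdx⟩
      exact ⟨hx, d, hd, h hdx⟩

theorem mem_kidsIso (hk : Kids P p) {J : Lat hp P (oneAdd P)} {i : ι} {x : K} :
    x ∈ (kidsIso hp hk J i).1 ↔ vl hp P x ≤ 1 ∧ ∃ d ∈ oneAdd (p i), d • x ∈ J.1 := Iff.rfl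

theorem scl_of_vl_sub_lt {J : Submodule D K} (hm : Mid P P' S)
    (hJ : J ≤ oP hp P) (hsat : ∀ d ∈ S, ∀ x, vl hp P x ≤ 1 → d • x ∈ J → x ∈ J) {u x : K}
    (hu : vl hp P' (u - 1) < 1) (hx : x ∈ J) : u * x ∈ J := by
  by_cases hx0 : x = 0
  · simp [hx0]
  have : u * x = (u - 1) * x + x := by ring
  rw [this]
  refine J.add_mem (oneAdd_smul hsat hJ hm hx ?_) hx
  rw [map_mul]
  simpa using mul_lt_mul_of_pos_right hu (show 0 < vl hp P' x by simpa [zero_lt_iff] using hx0)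

/-- Approximation of finitely many units of the localization at `P` at the primes above. -/
theorem Kids.exists_approx (hk : Kids P p) (x : ι → K) (hx : ∀ i, vl hp P (x i) = 1) :
    ∃ y, vl hp P y = 1 ∧ ∀ i, vl hp (p i) (y - x i) < vl hp (p i) (x i) := by
  classical
  cases nonempty_fintype ι
  rcases isEmpty_or_nonempty ι with h | ⟨⟨i₀⟩⟩
  · exact ⟨1, map_one _, fun i => (h.false i).elim⟩
  have hx0 := fun i => ne_zero_of_vl_eq_one (hx i)
  have : ∀ i j, ∃ d ∈ oneAdd (p i), i ≠ j → vl hp (p j) (algebraMap D K d * x i) <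
      vl hp (p j) (x j) := by
    intro i j
    by_cases hij : i = j
    · exact ⟨1, one_mem _, fun h => absurd hij h⟩
    obtain ⟨s, hs, a, h⟩ := (vl_le_one_iff hp P (x := x i / x j)).1 (by
      rw [map_div₀, hx, hx, div_one])
    obtain ⟨c, hc, hc'⟩ := exists_mem_not_mem_of_lt (hk.lt j)
    obtain ⟨d, hd, d', hd', t, h'⟩ := hk.exists_mul_eq hp hij
      (s := s * c) (fun h => (P.isPrime.mem_or_mem h).elim hs hc')
    refine ⟨d, hd, fun _ => ?_⟩
    have h1 : vl hp (p j) (algebraMap D K d') = 1 :=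
      (vl_algebraMap_eq_one hp (p j)).2 (not_mem_of_mem_oneAdd le_rfl hd')
    have h2 : algebraMap D K d' * (algebraMap D K d * x i) =
        algebraMap D K c * algebraMap D K t * algebraMap D K a * x j := by
      have : algebraMap D K d' * (algebraMap D K d * x i) = algebraMap D K (d * d') * x i := by
        rw [map_mul]; ring
      rw [this, h', ← h]
      have := hx0 j
      simp only [map_mul]
      field_simp
    have h3 : vl hp (p j) (algebraMap D K d * x i) = vl hp (p j)
        (algebraMap D K c * algebraMap D K t * algebraMap D K a * x j) := by
      rw [← h2, map_mul _ (algebraMap D K d'), h1, one_mul]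
    rw [h3, map_mul]
    have h4 : vl hp (p j) (algebraMap D K c * algebraMap D K t * algebraMap D K a) < 1 := by
      rw [← map_mul, ← map_mul, vl_algebraMap_lt_one, mul_assoc]
      exact Ideal.mul_mem_right _ _ hc
    simpa using mul_lt_mul_of_pos_right h4
      (show 0 < vl hp (p j) (x j) by simpa [zero_lt_iff] using hx0 j)
  choose d hd hdx using this
  have key : ∀ i, vl hp (p i) (∑ j, algebraMap D K (∏ k, d j k) * x j - x i) <
      vl hp (p i) (x i) := by
    intro i
    have hpos : 0 < vl hp (p i) (x i) := by simpa [zero_lt_iff] using hx0 i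
    have : ∑ j, algebraMap D K (∏ k, d j k) * x j - x i =
        ∑ j, (algebraMap D K (∏ k, d j k) * x j - if j = i then x i else 0) := by
      rw [Finset.sum_sub_distrib]; simp
    rw [this]
    refine Valuation.map_sum_lt _ hpos.ne' fun j _ => ?_
    by_cases hji : j = i
    · subst hji
      have h1 : ∏ k, d j k - 1 ∈ (p j).asIdeal :=
        mem_oneAdd.1 (prod_mem (S := oneAdd (p j)) fun k _ => hd j k)
      have h2 : algebraMap D K (∏ k, d j k) * x j - (if j = j then x j else 0) =
          algebraMap D K (∏ k, d j k - 1) * x j := by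
        simp only [if_true, map_sub, map_one]; ring
      rw [h2, map_mul]
      simpa using mul_lt_mul_of_pos_right ((vl_algebraMap_lt_one hp (p j)).2 h1) hpos
    · simp only [hji, if_false, sub_zero]
      rw [← Finset.prod_erase_mul _ _ (Finset.mem_univ i), map_mul (algebraMap D K), mul_assoc,
        map_mul]
      exact (mul_le_of_le_one_left' (vl_algebraMap_le hp _ _)).trans_lt (hdx j i hji)
  refine ⟨_, ?_, key⟩
  have h1 := key i₀
  set y := ∑ j, algebraMap D K (∏ k, d j k) * x j
  have h2 : vl hp (p i₀) y = vl hp (p i₀) (x i₀) := by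
    have := Valuation.map_add_eq_of_lt_left (vl hp (p i₀)) h1
    simpa using this
  have h3 : vl hp (p i₀) (y / x i₀) = 1 := by
    rw [map_div₀, h2, div_self]; simpa using hx0 i₀
  have := vl_eq_one_of_le hp (hk.lt i₀).le h3
  rwa [map_div₀, hx, div_one] at this

theorem scl_eq_of_approx (hm : Mid P P' S) (J : Lat hp P S) {x y : K} (hx : vl hp P x = 1)
    (hy : vl hp P y = 1) (h : vl hp P' (y - x) < vl hp P' x) : scl x J.1 = scl y J.1 := by
  have hx0 := ne_zero_of_vl_eq_one hx
  have hy0 := ne_zero_of_vl_eq_one hy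
  have hxy : vl hp P' y = vl hp P' x := by
    simpa using Valuation.map_add_eq_of_lt_left (vl hp P') h
  ext z
  rw [mem_scl, mem_scl]
  constructor
  · intro hz
    have : y⁻¹ * z = (x / y) * (x⁻¹ * z) := by field_simp
    rw [this]
    refine scl_of_vl_sub_lt hm J.2.2.1 J.2.2.2 ?_ hz
    have : x / y - 1 = -((y - x) / y) := by field_simp; ring
    rw [this, Valuation.map_neg, map_div₀, div_lt_one₀ (by simpa [zero_lt_iff] using hy0), hxy]
    exact h
  · intro hz
    have : x⁻¹ * z = (y / x) * (y⁻¹ * z) := by field_simp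
    rw [this]
    refine scl_of_vl_sub_lt hm J.2.2.1 J.2.2.2 ?_ hz
    have : y / x - 1 = (y - x) / x := by field_simp
    rw [this, map_div₀, div_lt_one₀ (by simpa [zero_lt_iff] using hx0)]
    exact h

end Decomposition

section Kids

variable {D : Type*} [CommRing D] [IsDomain D]
variable {K : Type*} [Field K] [Algebra D K] [IsFractionRing D K]
variable (hp : IsPrufer D K) {P : PrimeSpectrum D}
variable {ι : Type*} {p : ι → PrimeSpectrum D} [Finite ι]

theorem kidsIso_latAct (hk : Kids P p) (g : {x : K // vl hp P x = 1})
    (J : Lat hp P (oneAdd P)) (i : ι) : kidsIso hp hk (latAct hp P _ g J) i =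
      latAct hp P _ g (kidsIso hp hk J i) := by
  refine Subtype.ext (Submodule.ext fun x => ?_)
  rw [latAct_coe, mem_scl, mem_kidsIso, mem_kidsIso, map_mul, map_inv₀, g.2, inv_one, one_mul]
  refine and_congr_right fun _ => exists_congr fun d => and_congr_right fun _ => ?_
  rw [latAct_coe, mem_scl, mul_smul_comm]

theorem exists_latAct_eq (hk : Kids P p) (g : ∀ _ : ι, {x : K // vl hp P x = 1}) :
    ∃ h : {x : K // vl hp P x = 1}, ∀ (i : ι) (J : Lat hp P (oneAdd (p i))),
      latAct hp P _ (g i) J = latAct hp P _ h J := by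
  obtain ⟨y, hy, hyx⟩ := hk.exists_approx (fun i => (g i).1) (fun i => (g i).2)
  exact ⟨⟨y, hy⟩, fun i J => Subtype.ext
    (scl_eq_of_approx (mid_oneAdd (hk.lt i)) J (g i).2 hy (hyx i))⟩

theorem closes_oneAdd_iff {c : Clo (latAct hp P (oneAdd P))} : Closes c ↔
    c.toFun (latT hp le_rfl fun _ hd => not_mem_of_mem_oneAdd le_rfl hd) =
      latT hp le_rfl fun _ hd => not_mem_of_mem_oneAdd le_rfl hd :=
  closes_iff _ _

theorem kidsIso_latT (hk : Kids P p) (i : ι) :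
    (kidsIso hp hk (latT hp le_rfl fun _ hd => not_mem_of_mem_oneAdd le_rfl hd) i).1 =
      locS K (oneAdd (p i)) := by
  ext x
  rw [mem_kidsIso]
  constructor
  · rintro ⟨-, d, hd, d', hd', a, h⟩
    exact ⟨d' * d, mul_mem (oneAdd_le (hk.lt i).le hd') hd, a, by
      rw [← h, Algebra.smul_def, map_mul, mul_assoc]⟩
  · rintro ⟨d, hd, a, h⟩
    exact ⟨locS_le_oP (fun d hd => not_mem_of_mem_oneAdd (hk.lt i).le hd) ⟨d, hd, a, h⟩, d, hd,
      1, one_mem _, a, by rw [map_one, one_mul, Algebra.smul_def, h]⟩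

variable {hp} in
theorem ne_top_of_coe_eq_locS {P' : PrimeSpectrum D} {S : Submonoid D} (hm : Mid P P' S)
    {J : Lat hp P S} (hJ : J.1 = locS K S) : J ≠ ⊤ := by
  rintro rfl
  refine latV_ne_top (hp := hp) hm (top_le_iff.1 ?_)
  change (⊤ : Lat hp P S).1 ≤ oP hp P'
  rw [hJ]
  exact locS_le_oP hm.not_mem

/-- The product description of the saturated modules at `P`. -/
def kidsProd (hk : Kids P p) : Lat hp P (oneAdd P) ≃o
    ProdOn (Set.univ : Set (Set ι)) (fun i => Lat hp P (oneAdd (p i))) where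
  toFun J := ⟨kidsIso hp hk J, trivial⟩
  invFun J := (kidsIso hp hk).symm J.1
  left_inv J := by simp
  right_inv J := Subtype.ext (by simp)
  map_rel_iff' := (kidsIso hp hk).map_rel_iff'

/-- The closure operators at `P` in terms of closure operators at the primes above. -/
def kidsFam (hk : Kids P p) : Clo (latAct hp P (oneAdd P)) ≃o
    Fam (Set.univ : Set (Set ι)) (fun i => Clo (latAct hp P (oneAdd (p i)))) :=
  haveI := fun i => goodAct_lat (hp := hp) (mid_oneAdd (hk.lt i))
  (Clo.congr (act' := prodAct Set.univ (fun i => latAct hp P (oneAdd (p i)))) (kidsProd hp hk)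
    (fun g => ⟨fun _ => g, fun J => Subtype.ext <| funext fun i => kidsIso_latAct hp hk g J i⟩)
    (fun g => by
      obtain ⟨h, hh⟩ := exists_latAct_eq hp hk g
      exact ⟨h, fun J => Subtype.ext <| funext fun i =>
        (kidsIso_latAct hp hk h J i).trans (hh i _).symm⟩)).trans
    (Fam.isoClo Set.univ fun i => latAct hp P (oneAdd (p i))).symm

theorem kidsFam_apply (hk : Kids P p) (c : Clo (latAct hp P (oneAdd P)))
    (J : Lat hp P (oneAdd P)) (i : ι) :
    ((kidsFam hp hk c).1 ⟨{j | kidsIso hp hk J j ≠ ⊤}, trivial⟩ i).toFun (kidsIso hp hk J i) =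
      kidsIso hp hk (c.toFun J) i := by
  have := fun i => goodAct_lat (hp := hp) (mid_oneAdd (hk.lt i))
  have h1 := Fam.toClo_apply Set.univ (fun i => latAct hp P (oneAdd (p i)))
    (kidsFam hp hk c) (kidsProd hp hk J) i
  refine h1.symm.trans ?_
  have h2 : (kidsFam hp hk c).toClo Set.univ (fun i => latAct hp P (oneAdd (p i))) =
      Fam.isoClo Set.univ (fun i => latAct hp P (oneAdd (p i))) (kidsFam hp hk c) := rfl
  rw [h2, kidsFam, OrderIso.trans_apply, OrderIso.apply_symm_apply, Clo.congr_toFun]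
  rfl

theorem closes_kidsFam_iff (hk : Kids P p) (c : Clo (latAct hp P (oneAdd P))) :
    Closes c ↔ ∀ i, Closes ((kidsFam hp hk c).1 ⟨Set.univ, trivial⟩ i) := by
  rw [closes_oneAdd_iff]
  set T : Lat hp P (oneAdd P) := latT hp le_rfl fun _ hd => not_mem_of_mem_oneAdd le_rfl hd
    with hT
  have hc : ∀ i, kidsIso hp hk T i = latT hp (oneAdd_le (hk.lt i).le)
      (fun _ hd => not_mem_of_mem_oneAdd (hk.lt i).le hd) := fun i =>
    Subtype.ext (kidsIso_latT hp hk i)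
  have hu : {j | kidsIso hp hk T j ≠ ⊤} = Set.univ := Set.eq_univ_of_forall fun i =>
    ne_top_of_coe_eq_locS (mid_oneAdd (hk.lt i)) (kidsIso_latT hp hk i)
  have key : ∀ i, ((kidsFam hp hk c).1 ⟨Set.univ, trivial⟩ i).toFun (kidsIso hp hk T i) =
      kidsIso hp hk (c.toFun T) i := by
    intro i
    have h1 := kidsFam_apply hp hk c T i
    have h2 : (⟨{j | kidsIso hp hk T j ≠ ⊤}, trivial⟩ : (Set.univ : Set (Set ι))) =
        ⟨Set.univ, trivial⟩ := Subtype.ext hu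
    rwa [h2] at h1
  rw [← (kidsIso hp hk).injective.eq_iff, funext_iff]
  refine forall_congr' fun i => ?_
  rw [← key, hc, closes_iff]

end Kids

/-! ### Splitting closure operators at an intermediate prime -/

section Split

variable {D : Type*} [CommRing D] [IsDomain D]
variable {K : Type*} [Field K] [Algebra D K] [IsFractionRing D K]
variable {hp : IsPrufer D K} {P P' : PrimeSpectrum D} {S : Submonoid D}

theorem Mid.primeCompl (hm : Mid P P' S) : Mid P P' P'.asIdeal.primeCompl :=
  ⟨hm.lt, fun _ hd => not_mem_of_mem_oneAdd le_rfl hd, fun _ hd => hd⟩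

theorem Lat.mul_mem_of_vl_le_one (J : Lat hp P P'.asIdeal.primeCompl) (h : P ≤ P') {v x : K}
    (hv : vl hp P' v ≤ 1) (hx : x ∈ J.1) : v * x ∈ J.1 := by
  obtain ⟨s, hs, a, h'⟩ := (vl_le_one_iff hp P').1 hv
  refine J.2.2.2 s hs _ ?_ ?_
  · rw [map_mul]
    exact mul_le_one' (vl_le_one_of_le hp h hv) (J.2.2.1 hx)
  · have : s • (v * x) = a • x := by
      rw [Algebra.smul_def, Algebra.smul_def, ← h', mul_assoc]
    rw [this]
    exact J.1.smul_mem _ hx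

theorem Lat.mem_of_vl_le (J : Lat hp P P'.asIdeal.primeCompl) (h : P ≤ P') {x y : K}
    (hx : x ∈ J.1) (hy : vl hp P' y ≤ vl hp P' x) : y ∈ J.1 := by
  by_cases hx0 : x = 0
  · have : y = 0 := by simpa [hx0] using hy
    simp [this]
  have : y = y / x * x := by field_simp
  rw [this]
  refine J.mul_mem_of_vl_le_one h ?_ hx
  rw [map_div₀, div_le_one₀ (by simpa [zero_lt_iff] using hx0)]
  exact hy

/-- Saturated modules at the larger prime are saturated modules at the smaller one. -/
def embLat (hm : Mid P P' S) (N : Lat hp P' S) : Lat hp P S :=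
  ⟨N.1, (mP_mono hm.lt.le).trans_lt N.2.1, N.2.2.1.trans (oP_anti hm.lt.le), by
    intro d hd x _ h
    refine N.2.2.2 d hd x ?_ h
    have h1 := (vl_algebraMap_eq_one hp P').2 (hm.not_mem d hd)
    have h2 := N.2.2.1 h
    rwa [mem_oP, Algebra.smul_def, map_mul, h1, one_mul] at h2⟩

/-- Modules over the localization at `P'` are saturated. -/
def inclLat (hm : Mid P P' S) (J : Lat hp P P'.asIdeal.primeCompl) : Lat hp P S :=
  ⟨J.1, J.2.1, J.2.2.1, fun d hd => J.2.2.2 d (hm.not_mem d hd)⟩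

/-- `J` is the multiple of `N` by the unit `z` of the localization at `P`. -/
def IsScl (J : Lat hp P S) (z : {x : K // vl hp P x = 1}) (N : Lat hp P' S) : Prop :=
  J.1 = scl z.1 N.1

theorem IsScl.vl_le_vl {J J' : Lat hp P S} (hJ : J ≤ J')
    {z z' : {x : K // vl hp P x = 1}} {N N' : Lat hp P' S} (h : IsScl J z N)
    (h' : IsScl J' z' N') : vl hp P' z.1 ≤ vl hp P' z'.1 := by
  obtain ⟨n, hn, hn1⟩ := N.exists_vl_eq_one
  have hz0 := ne_zero_of_vl_eq_one z.2
  have hz0' := ne_zero_of_vl_eq_one z'.2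
  have h1 : z.1 * n ∈ J.1 := by rw [h, mem_scl, inv_mul_cancel_left₀ hz0]; exact hn
  have h2 := hJ h1
  rw [h', mem_scl] at h2
  have h3 := N'.2.2.1 h2
  rw [mem_oP, map_mul, map_mul, hn1, mul_one, map_inv₀,
    inv_mul_le_one₀ (by simpa [zero_lt_iff] using hz0')] at h3
  exact h3

theorem IsScl.scl_toFun_le (c : Clo (latAct hp P' S)) {J J' : Lat hp P S}
    (hJ : J ≤ J') {z z' : {x : K // vl hp P x = 1}} {N N' : Lat hp P' S} (h : IsScl J z N)
    (h' : IsScl J' z' N') : scl z.1 (c.toFun N).1 ≤ scl z'.1 (c.toFun N').1 := by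
  have hz0 := ne_zero_of_vl_eq_one z.2
  have hz0' := ne_zero_of_vl_eq_one z'.2
  rcases (IsScl.vl_le_vl hJ h h').eq_or_lt with he | hlt
  · have hu : vl hp P' (z'.1⁻¹ * z.1) = 1 := by
      rw [map_mul, map_inv₀, he, inv_mul_cancel₀ (by simpa using hz0')]
    have h1 : latAct hp P' S ⟨_, hu⟩ N ≤ N' := by
      change scl (z'.1⁻¹ * z.1) N.1 ≤ N'.1
      rw [← scl_scl, scl_le_iff (inv_ne_zero hz0'), inv_inv, ← h, ← h']
      exact hJ
    have h2 := c.mono h1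
    rw [c.equivariant] at h2
    have h3 : scl (z'.1⁻¹ * z.1) (c.toFun N).1 ≤ (c.toFun N').1 := h2
    rwa [← scl_scl, scl_le_iff (inv_ne_zero hz0'), inv_inv] at h3
  · intro x hx
    rw [mem_scl] at hx ⊢
    refine (c.le_cl N') (N'.2.1.le ?_)
    have h1 := (c.toFun N).2.2.1 hx
    rw [mem_oP, map_mul, map_inv₀, inv_mul_le_one₀ (by simpa [zero_lt_iff] using hz0)] at h1
    rw [mem_mP, map_mul, map_inv₀, inv_mul_lt_one₀ (by simpa [zero_lt_iff] using hz0')]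
    exact h1.trans_lt hlt

theorem IsScl.scl_toFun_eq (c : Clo (latAct hp P' S)) {J : Lat hp P S}
    {z z' : {x : K // vl hp P x = 1}} {N N' : Lat hp P' S} (h : IsScl J z N)
    (h' : IsScl J z' N') : scl z.1 (c.toFun N).1 = scl z'.1 (c.toFun N').1 :=
  le_antisymm (h.scl_toFun_le c le_rfl h') (h'.scl_toFun_le c le_rfl h)

theorem exists_isScl_or (hm : Mid P P' S) (J : Lat hp P S) :
    (∃ z : {x : K // vl hp P x = 1}, ∃ N : Lat hp P' S, IsScl J z N) ∨
      ∃ I : Lat hp P P'.asIdeal.primeCompl, J = inclLat hm I := by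
  by_cases hJ : ∀ d ∈ P'.asIdeal.primeCompl, ∀ x, vl hp P x ≤ 1 → d • x ∈ J.1 → x ∈ J.1
  · exact Or.inr ⟨⟨J.1, J.2.1, J.2.2.1, hJ⟩, rfl⟩
  left
  push Not at hJ
  obtain ⟨s, hs, z, hz, hsz, hzJ⟩ := hJ
  have hz1 := J.vl_eq_one_of_not_mem hz hzJ
  have hz0 := ne_zero_of_vl_eq_one hz1
  have hs1 := (vl_algebraMap_eq_one hp P').2 hs
  refine ⟨⟨z, hz1⟩, ⟨scl z⁻¹ J.1, ?_, ?_, ?_⟩, ?_⟩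
  · refine lt_of_le_of_ne (fun x hx => ?_) fun he => ?_
    · rw [mem_scl, inv_inv]
      refine J.mem_of_vl_lt hm hsz ?_
      rw [Algebra.smul_def, map_mul, map_mul, hs1, one_mul]
      simpa using mul_lt_mul_of_pos_left (mem_mP.1 hx)
        (show 0 < vl hp P' z by simpa [zero_lt_iff] using hz0)
    · have : algebraMap D K s ∈ scl z⁻¹ J.1 := by
        rw [mem_scl, inv_inv, mul_comm, ← Algebra.smul_def]; exact hsz
      rw [← he, mem_mP, hs1] at this
      exact this.false
  · intro x hx
    rw [mem_scl, inv_inv] at hx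
    have := J.vl_le_of_not_mem hm hx hzJ
    rw [map_mul] at this
    rw [mem_oP]
    exact le_of_mul_le_mul_left (by simpa using this)
      (show 0 < vl hp P' z by simpa [zero_lt_iff] using hz0)
  · intro d hd x hx h
    rw [mem_scl, inv_inv] at h ⊢
    refine J.2.2.2 d hd _ ?_ ?_
    · rw [map_mul, hz1, one_mul]; exact vl_le_one_of_le hp hm.lt.le hx
    · rwa [mul_smul_comm] at h
  · exact (scl_scl_inv hz0 _).symm

/-- The multiple of `N` by `z`. -/
def sclLat (hm : Mid P P' S) (z : {x : K // vl hp P x = 1}) (N : Lat hp P' S) : Lat hp P S :=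
  latAct hp P S z (embLat hm N)

theorem isScl_sclLat (hm : Mid P P' S) (z : {x : K // vl hp P x = 1}) (N : Lat hp P' S) :
    IsScl (sclLat hm z N) z N := rfl

theorem isScl_emb (hm : Mid P P' S) (N : Lat hp P' S) :
    IsScl (embLat hm N) ⟨1, map_one _⟩ N := (scl_one _).symm

theorem IsScl.eq_sclLat (hm : Mid P P' S) {J : Lat hp P S} {z : {x : K // vl hp P x = 1}}
    {N : Lat hp P' S} (h : IsScl J z N) : J = sclLat hm z N := Subtype.ext h

open Classical in
/-- The value at `J` of the extension of a closure operator at `P'`. -/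
def extFun (hm : Mid P P' S) (c : Clo (latAct hp P' S)) (J : Lat hp P S) : Lat hp P S :=
  if h : ∃ z : {x : K // vl hp P x = 1}, ∃ N : Lat hp P' S, IsScl J z N then
    sclLat hm h.choose (c.toFun h.choose_spec.choose) else J

theorem extFun_of_isScl (hm : Mid P P' S) (c : Clo (latAct hp P' S)) {J : Lat hp P S}
    {z : {x : K // vl hp P x = 1}} {N : Lat hp P' S} (h : IsScl J z N) :
    extFun hm c J = sclLat hm z (c.toFun N) := by
  have h' : ∃ z : {x : K // vl hp P x = 1}, ∃ N : Lat hp P' S, IsScl J z N := ⟨z, N, h⟩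
  rw [extFun, dif_pos h']
  exact Subtype.ext (h'.choose_spec.choose_spec.scl_toFun_eq c h)

theorem extFun_of_not (hm : Mid P P' S) (c : Clo (latAct hp P' S)) {J : Lat hp P S}
    (h : ¬ ∃ z : {x : K // vl hp P x = 1}, ∃ N : Lat hp P' S, IsScl J z N) :
    extFun hm c J = J := dif_neg h

theorem le_extFun (hm : Mid P P' S) (c : Clo (latAct hp P' S)) (J : Lat hp P S) :
    J ≤ extFun hm c J := by
  by_cases h : ∃ z : {x : K // vl hp P x = 1}, ∃ N : Lat hp P' S, IsScl J z N
  · obtain ⟨z, N, h⟩ := h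
    rw [extFun_of_isScl hm c h]
    exact h.le.trans (scl_mono (c.le_cl N))
  · rw [extFun_of_not hm c h]

theorem isScl_latAct (g : {x : K // vl hp P x = 1}) {J : Lat hp P S}
    {z : {x : K // vl hp P x = 1}} {N : Lat hp P' S} (h : IsScl J z N) :
    IsScl (latAct hp P S g J) ⟨g.1 * z.1, by rw [map_mul, g.2, z.2, one_mul]⟩ N := by
  rw [IsScl, latAct_coe, h, scl_scl]

theorem sclLat_le (hm : Mid P P' S) (z : {x : K // vl hp P x = 1}) (N N' : Lat hp P' S)
    (I : Lat hp P P'.asIdeal.primeCompl) (h : sclLat hm z N ≤ inclLat hm I) :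
    sclLat hm z N' ≤ inclLat hm I := by
  obtain ⟨n, hn, hn1⟩ := N.exists_vl_eq_one
  have hz0 := ne_zero_of_vl_eq_one z.2
  have h1 : z.1 * n ∈ I.1 := h (by
    change z.1⁻¹ * _ ∈ N.1
    rw [inv_mul_cancel_left₀ hz0]; exact hn)
  intro x hx
  have hx : z.1⁻¹ * x ∈ N'.1 := hx
  have hx := N'.2.2.1 hx
  rw [mem_oP, map_mul, map_inv₀, inv_mul_le_one₀ (by simpa [zero_lt_iff] using hz0)] at hx
  exact I.mem_of_vl_le hm.lt.le h1 (by rwa [map_mul, hn1, mul_one])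

/-- The extension of a closure operator at `P'` to the modules at `P`. -/
def extClo (hm : Mid P P' S) (c : Clo (latAct hp P' S)) : Clo (latAct hp P S) where
  toFun := extFun hm c
  le_cl := le_extFun hm c
  mono J J' hJ := by
    by_cases h : ∃ z : {x : K // vl hp P x = 1}, ∃ N : Lat hp P' S, IsScl J z N
    · obtain ⟨z, N, h⟩ := h
      rw [extFun_of_isScl hm c h]
      rcases exists_isScl_or hm J' with ⟨z', N', h'⟩ | ⟨I, rfl⟩
      · rw [extFun_of_isScl hm c h']
        exact h.scl_toFun_le c hJ h'
      · refine le_trans ?_ (le_extFun hm c _)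
        refine sclLat_le hm z N _ I ?_
        rwa [← h.eq_sclLat hm]
    · rw [extFun_of_not hm c h]
      exact hJ.trans (le_extFun hm c J')
  idem J := by
    by_cases h : ∃ z : {x : K // vl hp P x = 1}, ∃ N : Lat hp P' S, IsScl J z N
    · obtain ⟨z, N, h⟩ := h
      rw [extFun_of_isScl hm c h, extFun_of_isScl hm c (isScl_sclLat hm z _), c.idem]
    · rw [extFun_of_not hm c h, extFun_of_not hm c h]
  equivariant g J := by
    by_cases h : ∃ z : {x : K // vl hp P x = 1}, ∃ N : Lat hp P' S, IsScl J z N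
    · obtain ⟨z, N, h⟩ := h
      rw [extFun_of_isScl hm c h, extFun_of_isScl hm c (isScl_latAct g h)]
      exact Subtype.ext (scl_scl _ _ _).symm
    · rw [extFun_of_not hm c h, extFun_of_not hm c]
      rintro ⟨z, N, h'⟩
      have hg0 := ne_zero_of_vl_eq_one g.2
      have hg : vl hp P g.1⁻¹ = 1 := by rw [map_inv₀, g.2, inv_one]
      refine h ⟨⟨g.1⁻¹ * z.1, by rw [map_mul, hg, z.2, one_mul]⟩, N, ?_⟩
      · have := isScl_latAct ⟨_, hg⟩ h'
        have h2 : latAct hp P S ⟨_, hg⟩ (latAct hp P S g J) = J :=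
          Subtype.ext (scl_inv_scl hg0 _)
        rwa [h2] at this

theorem extClo_emb (hm : Mid P P' S) (c : Clo (latAct hp P' S)) (N : Lat hp P' S) :
    (extClo hm c).toFun (embLat hm N) = embLat hm (c.toFun N) := by
  refine (extFun_of_isScl hm c (isScl_emb hm N)).trans (Subtype.ext (scl_one _))

variable (P') in
/-- The module over the localization at `P'` generated by `J`. -/
def extLat (J : Lat hp P S) : Lat hp P P'.asIdeal.primeCompl := saturLat _ J

theorem le_extLat (hm : Mid P P' S) (J : Lat hp P S) : J ≤ inclLat hm (extLat P' J) :=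
  le_satur J.2.2.1

theorem extLat_incl (hm : Mid P P' S) (I : Lat hp P P'.asIdeal.primeCompl) :
    extLat P' (inclLat hm I) = I := by
  refine Subtype.ext (le_antisymm ?_ (le_satur I.2.2.1))
  rintro x ⟨hx, d, hd, h⟩
  exact I.2.2.2 d hd x hx h

theorem extLat_mono {J J' : Lat hp P S} (h : J ≤ J') : extLat P' J ≤ extLat P' J' := by
  rintro x ⟨hx, d, hd, h'⟩
  exact ⟨hx, d, hd, h h'⟩

theorem extLat_latAct (g : {x : K // vl hp P x = 1}) (J : Lat hp P S) :
    extLat P' (latAct hp P S g J) = latAct hp P _ g (extLat P' J) := by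
  refine Subtype.ext (Submodule.ext fun x => ?_)
  rw [latAct_coe, mem_scl]
  change _ ∧ _ ↔ _ ∧ _
  rw [map_mul, map_inv₀, g.2, inv_one, one_mul]
  refine and_congr_right fun _ => exists_congr fun d => and_congr_right fun _ => ?_
  rw [latAct_coe, mem_scl, mul_smul_comm]

theorem extLat_sclLat_ge (hm : Mid P P' S) (z : {x : K // vl hp P x = 1}) (N N' : Lat hp P' S) :
    sclLat hm z N' ≤ inclLat hm (extLat P' (sclLat hm z N)) :=
  sclLat_le hm z N N' _ (le_extLat hm _)

/-- The closure operator on all modules induced by one on the modules over the localization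
at `P'`. -/
def coarseClo (hm : Mid P P' S) (c : Clo (latAct hp P P'.asIdeal.primeCompl)) :
    Clo (latAct hp P S) where
  toFun J := inclLat hm (c.toFun (extLat P' J))
  le_cl J := (le_extLat hm J).trans (c.le_cl _)
  mono J J' h := c.mono (extLat_mono h)
  idem J := by rw [extLat_incl, c.idem]
  equivariant g J := by rw [extLat_latAct, c.equivariant]; rfl

theorem coarseClo_incl (hm : Mid P P' S) (c : Clo (latAct hp P P'.asIdeal.primeCompl))
    (I : Lat hp P P'.asIdeal.primeCompl) :
    (coarseClo hm c).toFun (inclLat hm I) = inclLat hm (c.toFun I) := by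
  change inclLat hm (c.toFun (extLat P' (inclLat hm I))) = _
  rw [extLat_incl]

theorem extClo_le_extClo (hm : Mid P P' S) {c c' : Clo (latAct hp P' S)} :
    extClo hm c ≤ extClo hm c' ↔ c ≤ c' := by
  constructor
  · intro h N
    have := h (embLat hm N)
    rw [extClo_emb, extClo_emb] at this
    exact this
  · intro h J
    change extFun hm c J ≤ extFun hm c' J
    by_cases h' : ∃ z : {x : K // vl hp P x = 1}, ∃ N : Lat hp P' S, IsScl J z N
    · obtain ⟨z, N, h'⟩ := h'
      rw [extFun_of_isScl hm c h', extFun_of_isScl hm c' h']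
      exact scl_mono (h N)
    · rw [extFun_of_not hm c h', extFun_of_not hm c' h']

theorem coarseClo_le_coarseClo (hm : Mid P P' S)
    {c c' : Clo (latAct hp P P'.asIdeal.primeCompl)} :
    coarseClo hm c ≤ coarseClo hm c' ↔ c ≤ c' := by
  constructor
  · intro h I
    have := h (inclLat hm I)
    rw [coarseClo_incl, coarseClo_incl] at this
    exact this
  · intro h J
    exact h _

theorem extClo_le_coarseClo (hm : Mid P P' S) (c : Clo (latAct hp P' S))
    (c' : Clo (latAct hp P P'.asIdeal.primeCompl)) : extClo hm c ≤ coarseClo hm c' := by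
  intro J
  refine le_trans ?_ (show inclLat hm (extLat P' J) ≤ _ from c'.le_cl _)
  change extFun hm c J ≤ _
  by_cases h' : ∃ z : {x : K // vl hp P x = 1}, ∃ N : Lat hp P' S, IsScl J z N
  · obtain ⟨z, N, h'⟩ := h'
    rw [extFun_of_isScl hm c h', h'.eq_sclLat hm]
    exact extLat_sclLat_ge hm _ _ _
  · rw [extFun_of_not hm c h']
    exact le_extLat hm J

theorem embLat_top_le (hm : Mid P P' S) (N : Lat hp P' S) :
    embLat hm ⊤ ≤ inclLat hm (extLat P' (embLat hm N)) := by
  have := extLat_sclLat_ge hm ⟨1, map_one _⟩ N ⊤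
  rwa [← (isScl_emb hm N).eq_sclLat hm, ← (isScl_emb hm ⊤).eq_sclLat hm] at this

theorem not_coarseClo_le_extClo (hm : Mid P P' S) {c : Clo (latAct hp P' S)} (hc : c ≠ ⊤)
    (c' : Clo (latAct hp P P'.asIdeal.primeCompl)) : ¬ coarseClo hm c' ≤ extClo hm c := by
  intro h
  apply hc
  refine Clo.ext' fun N => top_le_iff.1 ?_
  have h1 := h (embLat hm N)
  rw [extClo_emb] at h1
  have h2 : embLat hm ⊤ ≤ embLat hm (c.toFun N) := by
    refine ((embLat_top_le hm N).trans ?_).trans h1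
    exact c'.le_cl _
  exact h2

theorem exists_coarseClo_eq (hm : Mid P P' S) {c : Clo (latAct hp P S)}
    (h : ∀ N : Lat hp P' S, embLat hm ⊤ ≤ c.toFun (embLat hm N)) :
    ∃ c', coarseClo hm c' = c := by
  have key : ∀ J, inclLat hm (extLat P' J) ≤ c.toFun J := by
    intro J
    rcases exists_isScl_or hm J with ⟨z, N, h'⟩ | ⟨I, rfl⟩
    · rw [h'.eq_sclLat hm]
      have h1 : inclLat hm (extLat P' (sclLat hm z N)) ≤ sclLat hm z ⊤ := by
        rintro x ⟨hx, d, hd, hdx⟩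
        have hdx := N.2.2.1 (show z.1⁻¹ * d • x ∈ N.1 from hdx)
        rw [mul_smul_comm, mem_oP, Algebra.smul_def, map_mul,
          (vl_algebraMap_eq_one hp P').2 hd, one_mul] at hdx
        exact hdx
      refine h1.trans ?_
      rw [sclLat, sclLat, c.equivariant]
      exact scl_mono (h N)
    · rw [extLat_incl]
      exact c.le_cl _
  have key2 : ∀ J, inclLat hm (extLat P' (c.toFun J)) = c.toFun J := fun J =>
    le_antisymm ((key _).trans_eq (c.idem J)) (le_extLat hm _)
  have key3 : ∀ J, c.toFun (inclLat hm (extLat P' J)) = c.toFun J := fun J =>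
    le_antisymm ((c.mono (key J)).trans_eq (c.idem J)) (c.mono (le_extLat hm J))
  refine ⟨⟨fun I => extLat P' (c.toFun (inclLat hm I)), fun I => ?_, fun I I' hI => ?_,
    fun I => ?_, fun g I => ?_⟩, ?_⟩
  · exact (extLat_incl hm I).ge.trans (extLat_mono (c.le_cl _))
  · exact extLat_mono (c.mono (show inclLat hm I ≤ inclLat hm I' from hI))
  · rw [key2, c.idem]
  · rw [← extLat_latAct, ← c.equivariant]; rfl
  · refine Clo.ext' fun J => ?_
    change inclLat hm (extLat P' (c.toFun (inclLat hm (extLat P' J)))) = _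
    rw [key2, key3]

theorem exists_extClo_eq (hm : Mid P P' S) {c : Clo (latAct hp P S)} {N₀ : Lat hp P' S}
    (h : ¬ embLat hm ⊤ ≤ c.toFun (embLat hm N₀)) :
    ∃ c', c' ≠ ⊤ ∧ extClo hm c' = c := by
  obtain ⟨v, hv, hv'⟩ := SetLike.not_le_iff_exists.1
    (show ¬ (embLat hm ⊤).1 ≤ (c.toFun (embLat hm N₀)).1 from h)
  have hv1 : vl hp P' v = 1 := by
    refine le_antisymm hv (not_lt.1 fun hlt => hv' ?_)
    exact c.le_cl (embLat hm N₀) (N₀.2.1.le hlt)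
  have hv0 := ne_zero_of_vl_eq_one hv1
  have key : ∀ I, c.toFun (inclLat hm I) = inclLat hm I := by
    refine fun I => le_antisymm (fun y hy => ?_) (c.le_cl _)
    by_contra hyI
    have hy1 := I.vl_eq_one_of_not_mem ((c.toFun _).2.2.1 hy) hyI
    have hy0 := ne_zero_of_vl_eq_one hy1
    have hyv : vl hp P (y / v) = 1 := by
      rw [map_div₀, hy1, vl_eq_one_of_le hp hm.lt.le hv1, div_one]
    have h1 : inclLat hm I ≤ latAct hp P S ⟨_, hyv⟩ (embLat hm N₀) := by
      intro x hx
      rw [latAct_coe, mem_scl]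
      refine N₀.2.1.le ?_
      have h2 : vl hp P' x < vl hp P' y := not_le.1 fun hle =>
        hyI (I.mem_of_vl_le hm.lt.le hx hle)
      rw [mem_mP, map_mul, map_inv₀, map_div₀, hv1, div_one,
        inv_mul_lt_one₀ (by simpa [zero_lt_iff] using hy0)]
      exact h2
    have h2 := c.mono h1 hy
    rw [c.equivariant, latAct_coe, mem_scl] at h2
    have h3 : (y / v)⁻¹ * y = v := by field_simp
    rw [h3] at h2
    exact hv' h2
  have hV : c.toFun (embLat hm ⊤) = embLat hm ⊤ := by
    have : embLat hm (⊤ : Lat hp P' S) = inclLat hm (latV hp hm.primeCompl) := rfl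
    rw [this, key]
  have hle : ∀ N, c.toFun (embLat hm N) ≤ embLat hm ⊤ := fun N =>
    (c.mono (show embLat hm N ≤ embLat hm ⊤ from le_top (a := N))).trans_eq hV
  let f : Lat hp P' S → Lat hp P' S := fun N => ⟨(c.toFun (embLat hm N)).1,
    N.2.1.trans_le (c.le_cl (embLat hm N)), hle N, fun d hd x hx =>
      (c.toFun (embLat hm N)).2.2.2 d hd x (vl_le_one_of_le hp hm.lt.le hx)⟩
  have hf : ∀ N, embLat hm (f N) = c.toFun (embLat hm N) := fun N => rfl
  have hinj : ∀ {N N' : Lat hp P' S}, embLat hm N = embLat hm N' → N = N' := fun {N N'} h => by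
    have h3 : (embLat hm N).1 = (embLat hm N').1 := congrArg Subtype.val h
    exact Subtype.ext h3
  refine ⟨⟨f, fun N => c.le_cl (embLat hm N), fun N N' h => c.mono
    (show embLat hm N ≤ embLat hm N' from h), fun N => hinj ?_, fun g N => hinj ?_⟩, ?_, ?_⟩
  · rw [hf, hf, c.idem]
  · exact c.equivariant ⟨g.1, vl_eq_one_of_le hp hm.lt.le g.2⟩ (embLat hm N)
  · intro htop
    have : f N₀ = ⊤ := congrArg (fun c : Clo (latAct hp P' S) => c.toFun N₀) htop
    apply h
    rw [← hf, this]
  · refine Clo.ext' fun J => ?_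
    rcases exists_isScl_or hm J with ⟨z, N, h'⟩ | ⟨I, rfl⟩
    · refine (extFun_of_isScl hm _ h').trans ?_
      rw [h'.eq_sclLat hm, sclLat, sclLat, c.equivariant]
      rfl
    · rw [key]
      refine le_antisymm ?_ (Clo.le_cl _ _)
      refine (extClo_le_coarseClo hm _ ⟨fun I => I, fun _ => le_rfl, fun _ _ h => h,
        fun _ => rfl, fun _ _ => rfl⟩ _).trans ?_
      rw [coarseClo_incl]

/-- Closure operators at `P` are either extensions of nontrivial closure operators at `P'`, or
come from closure operators on the modules over the localization at `P'`. -/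
def splitIso (hm : Mid P P' S) : {c : Clo (latAct hp P' S) // c ≠ ⊤} ⊕ₗ
    Clo (latAct hp P P'.asIdeal.primeCompl) ≃o Clo (latAct hp P S) :=
  RelIso.ofSurjective (OrderEmbedding.ofMapLEIff
    (fun x : _ ⊕ₗ _ => Sum.elim (fun c => extClo hm c.1) (coarseClo hm) (ofLex x)) (by
      rintro (c | c) (c' | c')
      · change _ ↔ toLex (Sum.inl c) ≤ toLex (Sum.inl c')
        rw [Sum.Lex.inl_le_inl_iff]
        exact extClo_le_extClo hm
      · change _ ↔ toLex (Sum.inl c) ≤ toLex (Sum.inr c')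
        exact iff_of_true (extClo_le_coarseClo hm _ _) (Sum.Lex.inl_le_inr _ _)
      · change _ ↔ toLex (Sum.inr c) ≤ toLex (Sum.inl c')
        exact iff_of_false (not_coarseClo_le_extClo hm c'.2 c) Sum.Lex.not_inr_le_inl
      · change _ ↔ toLex (Sum.inr c) ≤ toLex (Sum.inr c')
        exact (coarseClo_le_coarseClo hm).trans Sum.Lex.inr_le_inr_iff.symm)) (by
    intro c
    by_cases h : ∀ N : Lat hp P' S, embLat hm ⊤ ≤ c.toFun (embLat hm N)
    · obtain ⟨c', h'⟩ := exists_coarseClo_eq hm h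
      exact ⟨Sum.inrₗ c', h'⟩
    · push Not at h
      obtain ⟨N₀, h⟩ := h
      obtain ⟨c', h1, h2⟩ := exists_extClo_eq hm h
      exact ⟨Sum.inlₗ ⟨c', h1⟩, h2⟩)

theorem closes_extClo_iff (hm : Mid P P' S) {c : Clo (latAct hp P' S)} :
    Closes (extClo hm c) ↔ Closes c := by
  constructor
  · intro h N hN
    have := h (embLat hm N) hN
    rw [extClo_emb] at this
    have h3 : (embLat hm (c.toFun N)).1 = (embLat hm N).1 := congrArg Subtype.val this
    exact Subtype.ext h3
  · intro h J hJ
    have h1 := h (latT hp hm.le hm.not_mem) rfl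
    have h2 : J = embLat hm (latT hp hm.le hm.not_mem) := Subtype.ext hJ
    rw [h2, extClo_emb, h1]

theorem locS_primeCompl (hp : IsPrufer D K) (P : PrimeSpectrum D) :
    locS K P.asIdeal.primeCompl = oP hp P := by
  ext x
  exact (vl_le_one_iff hp P).symm

theorem closes_coarseClo_iff (hm : Mid P P' S) {c : Clo (latAct hp P P'.asIdeal.primeCompl)} :
    Closes (coarseClo hm c) ↔ locS K S = oP hp P' ∧ Closes c := by
  have hT : extLat P' (embLat hm (latT hp hm.le hm.not_mem)) = latV hp hm.primeCompl := by
    refine Subtype.ext (le_antisymm ?_ (embLat_top_le hm _))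
    rintro x ⟨-, d, hd, h⟩
    have h := locS_le_oP (hp := hp) hm.not_mem h
    rw [mem_oP, Algebra.smul_def, map_mul, (vl_algebraMap_eq_one hp P').2 hd, one_mul] at h
    exact h
  have hTV : Closes (coarseClo hm c) ↔ (c.toFun (latV hp hm.primeCompl)).1 = locS K S := by
    rw [← hT]
    constructor
    · intro h
      exact congrArg Subtype.val (h (embLat hm (latT hp hm.le hm.not_mem)) rfl)
    · intro h J hJ
      have h2 : J = embLat hm (latT hp hm.le hm.not_mem) := Subtype.ext hJ
      rw [h2]
      exact Subtype.ext h
  have hc : Closes c ↔ c.toFun (latV hp hm.primeCompl) = latV hp hm.primeCompl := by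
    have h1 : oneAdd P ≤ P'.asIdeal.primeCompl := (oneAdd_le hm.lt.le).trans hm.primeCompl.le
    have h2 : ∀ d ∈ P'.asIdeal.primeCompl, d ∉ P.asIdeal := fun d hd h => hd (hm.lt.le h)
    rw [closes_iff h1 h2]
    have : latT hp h1 h2 =
      latV hp hm.primeCompl := Subtype.ext (locS_primeCompl hp P')
    rw [this]
  rw [hTV]
  constructor
  · intro h
    have h1 : oP hp P' ≤ locS K S := by
      rw [← h]; exact c.le_cl (latV hp hm.primeCompl)
    have h2 : locS K S = oP hp P' := le_antisymm (locS_le_oP hm.not_mem) h1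
    exact ⟨h2, hc.2 (Subtype.ext (h.trans h2))⟩
  · rintro ⟨h, h'⟩
    rw [hc.1 h', h]; rfl

end Split

/-! ### Finite chains -/

/-- Two finite chains of the same size are isomorphic, and the isomorphism matches lower sets of
the same size. -/
theorem exists_orderIso_of_total {α β : Type*} [PartialOrder α] [PartialOrder β] [Finite α]
    [Finite β] (hα : ∀ a b : α, a ≤ b ∨ b ≤ a) (hβ : ∀ a b : β, a ≤ b ∨ b ≤ a)
    (h : Nat.card α = Nat.card β) (p : α → Prop) (q : β → Prop) (hpl : ∀ a b, a ≤ b → p b → p a)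
    (hql : ∀ a b, a ≤ b → q b → q a) (hpq : Nat.card {a // p a} = Nat.card {b // q b}) :
    ∃ e : α ≃o β, ∀ a, p a ↔ q (e a) := by
  classical
  let iα : LinearOrder α := { (inferInstance : PartialOrder α) with
    le_total := hα, toDecidableLE := Classical.decRel _ }
  let iβ : LinearOrder β := { (inferInstance : PartialOrder β) with
    le_total := hβ, toDecidableLE := Classical.decRel _ }
  have := Fintype.ofFinite α
  have := Fintype.ofFinite β
  rw [Nat.card_eq_fintype_card, Nat.card_eq_fintype_card] at h
  let e : α ≃o β := (Fintype.orderIsoFinOfCardEq α h).symm.trans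
    (Fintype.orderIsoFinOfCardEq β rfl)
  have hcard : Set.ncard {a | p a} = Set.ncard {a | q (e a)} := by
    have h1 : Nat.card {a // q (e a)} = Nat.card {b // q b} :=
      Nat.card_congr (e.toEquiv.subtypeEquiv fun _ => Iff.rfl)
    exact hpq.trans h1.symm
  have hl : ∀ a b, a ≤ b → q (e b) → q (e a) := fun a b hab => hql _ _ (e.monotone hab)
  refine ⟨e, fun a => ?_⟩
  have key : {a | p a} = {a | q (e a)} := by
    by_cases hsub : {a | p a} ⊆ {a | q (e a)}
    · exact Set.eq_of_subset_of_ncard_le hsub hcard.ge (Set.toFinite _)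
    · obtain ⟨x, hx, hx'⟩ := Set.not_subset.1 hsub
      refine (Set.eq_of_subset_of_ncard_le (fun y hy => ?_) hcard.le (Set.toFinite _)).symm
      rcases hα x y with hxy | hxy
      · exact absurd (hl _ _ hxy hy) hx'
      · exact hpl _ _ hxy hx
  exact Set.ext_iff.1 key a

section Spec

variable {D : Type*} [CommRing D] [IsDomain D]
variable {K : Type*} [Field K] [Algebra D K] [IsFractionRing D K]

theorem finite_Iic (hp : IsPrufer D K) (hdim : ringKrullDim D < ⊤) (P : PrimeSpectrum D) :
    Finite (Set.Iic P) := by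
  classical
  by_contra hinf
  rw [not_finite_iff_infinite] at hinf
  have htot : ∀ a b : Set.Iic P, a ≤ b ∨ b ≤ a := fun a b => le_total_of_le hp a.2 b.2
  let iα : LinearOrder (Set.Iic P) := { (inferInstance : PartialOrder (Set.Iic P)) with
    le_total := htot, toDecidableLE := Classical.decRel _ }
  have hall : ∀ n : ℕ, (n : WithBot ℕ∞) ≤ ringKrullDim D := by
    intro n
    obtain ⟨s, hs⟩ := Infinite.exists_subset_card_eq (Set.Iic P) (n + 1)
    let f := s.orderEmbOfFin hs
    let l : LTSeries (PrimeSpectrum D) :=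
      ⟨n, fun i => (f i).1, fun i => by
        have : f i.castSucc < f i.succ := f.strictMono i.castSucc_lt_succ
        exact this⟩
    exact Order.LTSeries.length_le_krullDim l
  have : ringKrullDim D = ⊤ := by
    refine top_le_iff.1 (le_of_forall_lt fun c hc => ?_)
    induction c with
    | bot => exact lt_of_lt_of_le (WithBot.bot_lt_coe _) (hall 0)
    | coe c =>
      have hc' : c < ⊤ := WithBot.coe_lt_coe.1 hc
      obtain ⟨n, rfl⟩ := ENat.ne_top_iff_exists.1 hc'.ne
      refine lt_of_lt_of_le ?_ (hall (n + 1))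
      exact_mod_cast Nat.lt_succ_self n
  exact hdim.ne this

theorem finite_primeSpectrum (hp : IsPrufer D K) (hsl : IsSemilocal D)
    (hdim : ringKrullDim D < ⊤) : Finite (PrimeSpectrum D) := by
  have h1 : {M : PrimeSpectrum D | M.asIdeal.IsMaximal}.Finite :=
    Set.Finite.of_finite_image (f := PrimeSpectrum.asIdeal)
      (hsl.subset (by rintro _ ⟨M, h, rfl⟩; exact h))
      (fun _ _ _ _ h => PrimeSpectrum.ext h)
  have h2 := h1.biUnion (t := fun M => Set.Iic M)
    fun M _ => Set.finite_coe_iff.1 (finite_Iic hp hdim M)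
  refine Set.finite_univ_iff.1 (h2.subset fun Q _ => ?_)
  obtain ⟨M, hM, hQ⟩ := Q.asIdeal.exists_le_maximal Q.2.ne_top
  exact Set.mem_biUnion (show (⟨M, hM.isPrime⟩ : PrimeSpectrum D) ∈ _ from hM) hQ

end Spec

section Chains

variable {D : Type*} [CommRing D] [IsDomain D]
variable {K : Type*} [Field K] [Algebra D K] [IsFractionRing D K]
variable {hp : IsPrufer D K} {P P' : PrimeSpectrum D} {S : Submonoid D}

theorem Lat.le_total (h : P ≤ P') (J J' : Lat hp P P'.asIdeal.primeCompl) : J ≤ J' ∨ J' ≤ J := by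
  by_contra! hc
  obtain ⟨x, hx, hx'⟩ := SetLike.not_le_iff_exists.1 (show ¬ J.1 ≤ J'.1 from hc.1)
  obtain ⟨y, hy, hy'⟩ := SetLike.not_le_iff_exists.1 (show ¬ J'.1 ≤ J.1 from hc.2)
  rcases _root_.le_total (vl hp P' x) (vl hp P' y) with h1 | h1
  · exact hx' (J'.mem_of_vl_le h hy h1)
  · exact hy' (J.mem_of_vl_le h hx h1)

theorem Clo.mem_latAct_iff (c : Clo (latAct hp P S)) (g : {x : K // vl hp P x = 1}) {J x} :
    x ∈ (c.toFun (latAct hp P S g J)).1 ↔ g.1⁻¹ * x ∈ (c.toFun J).1 := by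
  rw [c.equivariant, latAct_coe, mem_scl]

theorem Clo.le_total (h : P ≤ P') (c c' : Clo (latAct hp P P'.asIdeal.primeCompl)) :
    c ≤ c' ∨ c' ≤ c := by
  by_contra! hc
  have key : ∀ c c' : Clo (latAct hp P P'.asIdeal.primeCompl), ¬ c ≤ c' →
      ∃ I x, c'.toFun I = I ∧ x ∈ (c.toFun I).1 ∧ x ∉ I.1 ∧ vl hp P x = 1 := by
    intro c c' hcc
    obtain ⟨J, hJ⟩ := not_forall.1 hcc
    obtain ⟨x, hx, hx'⟩ := SetLike.not_le_iff_exists.1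
      (show ¬ (c.toFun J).1 ≤ (c'.toFun J).1 from hJ)
    exact ⟨c'.toFun J, x, c'.idem J, c.mono (c'.le_cl J) hx, hx',
      (c'.toFun J).vl_eq_one_of_not_mem ((c.toFun J).2.2.1 hx) hx'⟩
  obtain ⟨I, x, hI, hx, hxI, hx1⟩ := key c c' hc.1
  obtain ⟨J, y, hJ, hy, hyJ, hy1⟩ := key c' c hc.2
  have hx0 := ne_zero_of_vl_eq_one hx1
  have hy0 := ne_zero_of_vl_eq_one hy1
  let g : {x : K // vl hp P x = 1} := ⟨x / y, by rw [map_div₀, hx1, hy1, div_one]⟩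
  have hgx : g.1⁻¹ * x = y := by simp only [g]; field_simp
  have hJ' : c.toFun (latAct hp P _ g J) = latAct hp P _ g J := by rw [c.equivariant, hJ]
  have hx2 : x ∈ (c'.toFun (latAct hp P _ g J)).1 := by rwa [c'.mem_latAct_iff, hgx]
  have hx3 : x ∉ (latAct hp P _ g J).1 := by rwa [latAct_coe, mem_scl, hgx]
  rcases Lat.le_total h I (latAct hp P _ g J) with h1 | h1
  · have := c.mono h1 hx
    rw [hJ'] at this
    exact hx3 this
  · have := c'.mono h1 hx2
    rw [hI] at this
    exact hxI this

/-- The elements of `D` lying in some module whose closure does not contain `1`. -/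
def Clo.trace (c : Clo (latAct hp P S)) : Set D :=
  {a | ∃ J : Lat hp P S, 1 ∉ (c.toFun J).1 ∧ algebraMap D K a ∈ J.1}

/-- There is a largest module whose closure does not contain `1`. -/
def Clo.Attained (c : Clo (latAct hp P S)) : Prop :=
  ∃ J : Lat hp P S, 1 ∉ (c.toFun J).1 ∧ ∀ J' : Lat hp P S, 1 ∉ (c.toFun J').1 → J' ≤ J

theorem Lat.exists_algebraMap (h : P ≤ P') {x : K} (hx : vl hp P' x ≤ 1) :
    ∃ a : D, ∀ J : Lat hp P P'.asIdeal.primeCompl, algebraMap D K a ∈ J.1 ↔ x ∈ J.1 := by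
  obtain ⟨s, hs, a, h'⟩ := (vl_le_one_iff hp P').1 hx
  refine ⟨a, fun J => ?_⟩
  have hv : vl hp P' (algebraMap D K a) = vl hp P' x := by
    rw [← h', map_mul, (vl_algebraMap_eq_one hp P').2 hs, one_mul]
  exact ⟨fun h1 => J.mem_of_vl_le h h1 hv.ge, fun h1 => J.mem_of_vl_le h h1 hv.le⟩

theorem Lat.vl_lt_one_of_one_not_mem (h : P ≤ P') {J : Lat hp P P'.asIdeal.primeCompl}
    (h1 : (1 : K) ∉ J.1) {x : K} (hx : x ∈ J.1) : vl hp P' x < 1 := by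
  by_contra! hc
  exact h1 (J.mem_of_vl_le h hx (by rwa [map_one]))

theorem Clo.trace_eq (h : P ≤ P') (c : Clo (latAct hp P P'.asIdeal.primeCompl)) :
    c.trace = ∅ ∨ ∃ Q : Set.Iic P', c.trace = (Q.1.asIdeal : Set D) := by
  refine or_iff_not_imp_left.2 fun hne => ?_
  obtain ⟨a₀, J₀, h₀, -⟩ := Set.nonempty_iff_ne_empty.2 hne
  have hlow : ∀ {J J' : Lat hp P P'.asIdeal.primeCompl}, J ≤ J' → 1 ∉ (c.toFun J').1 →
      1 ∉ (c.toFun J).1 := fun hJ h1 h2 => h1 (c.mono hJ h2)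
  let I : Ideal D :=
    { carrier := c.trace
      zero_mem' := ⟨J₀, h₀, by simp⟩
      add_mem' := by
        rintro a b ⟨J, h1, h2⟩ ⟨J', h1', h2'⟩
        rcases Lat.le_total h J J' with h3 | h3
        · exact ⟨J', h1', by rw [map_add]; exact J'.1.add_mem (h3 h2) h2'⟩
        · exact ⟨J, h1, by rw [map_add]; exact J.1.add_mem h2 (h3 h2')⟩
      smul_mem' := by
        rintro r a ⟨J, h1, h2⟩
        exact ⟨J, h1, by rw [smul_eq_mul, map_mul, ← Algebra.smul_def]; exact J.1.smul_mem r h2⟩ }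
  have hle : ∀ a ∈ I, a ∈ P'.asIdeal := by
    rintro a ⟨J, h1, h2⟩
    exact (vl_algebraMap_lt_one hp P').1
      (J.vl_lt_one_of_one_not_mem h (fun h3 => h1 (c.le_cl J h3)) h2)
  have hI : I.IsPrime := by
    refine ⟨fun hI => P'.2.ne_top (top_le_iff.1 (hI ▸ hle)), fun {a b} hab => ?_⟩
    obtain ⟨J, h1, h2⟩ := hab
    refine or_iff_not_imp_right.2 fun hb => ?_
    have hJ2 : 1 ∉ (c.toFun (c.toFun J)).1 := by rwa [c.idem]
    have hbJ : algebraMap D K b ∉ (c.toFun J).1 := fun h3 => hb ⟨_, hJ2, h3⟩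
    have hb1 := (c.toFun J).vl_eq_one_of_not_mem (vl_algebraMap_le hp P b) hbJ
    let g : {x : K // vl hp P x = 1} := ⟨(algebraMap D K b)⁻¹, by rw [map_inv₀, hb1, inv_one]⟩
    refine ⟨latAct hp P _ g J, ?_, ?_⟩
    · rw [c.mem_latAct_iff]
      simpa [g] using hbJ
    · rw [latAct_coe, mem_scl]
      rw [map_mul, mul_comm] at h2
      simpa [g] using h2
  exact ⟨⟨⟨I, hI⟩, hle⟩, rfl⟩

theorem Clo.le_of_trace_eq (h : P ≤ P') {c c' : Clo (latAct hp P P'.asIdeal.primeCompl)}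
    (ht : c.trace = c'.trace) (ha : c.Attained ↔ c'.Attained) : c' ≤ c := by
  have hlow : ∀ {J J' : Lat hp P P'.asIdeal.primeCompl}, J ≤ J' → 1 ∉ (c'.toFun J').1 →
      1 ∉ (c'.toFun J).1 := fun hJ h1 h2 => h1 (c'.mono hJ h2)
  have key : ∀ J, 1 ∉ (c.toFun J).1 → 1 ∉ (c'.toFun J).1 := by
    intro J hJ
    by_cases hc : c.Attained
    · obtain ⟨J₁, h1, h1'⟩ := hc
      obtain ⟨J₂, h2, h2'⟩ := ha.1 ⟨J₁, h1, h1'⟩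
      refine hlow ((h1' J hJ).trans fun x hx => ?_) h2
      have hx1 := J₁.vl_lt_one_of_one_not_mem h (fun h3 => h1 (c.le_cl _ h3)) hx
      obtain ⟨a, ha⟩ := Lat.exists_algebraMap h hx1.le
      have h3 : a ∈ c'.trace := ht ▸ ⟨J₁, h1, (ha J₁).2 hx⟩
      obtain ⟨J₃, h4, h5⟩ := h3
      exact (ha J₂).1 (h2' _ h4 h5)
    · have : ∃ J', 1 ∉ (c.toFun J').1 ∧ ¬ J' ≤ J := by
        by_contra! hcon
        exact hc ⟨J, hJ, hcon⟩
      obtain ⟨J₁, h1, h2⟩ := this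
      obtain ⟨x, hx, hx'⟩ := SetLike.not_le_iff_exists.1 (show ¬ J₁.1 ≤ J.1 from h2)
      have hx1 := J₁.vl_lt_one_of_one_not_mem h (fun h3 => h1 (c.le_cl _ h3)) hx
      obtain ⟨a, ha⟩ := Lat.exists_algebraMap h hx1.le
      have h3 : a ∈ c'.trace := ht ▸ ⟨J₁, h1, (ha J₁).2 hx⟩
      obtain ⟨J₃, h4, h5⟩ := h3
      refine hlow ?_ h4
      rcases Lat.le_total h J J₃ with h6 | h6
      · exact h6
      · exact absurd ((ha J).1 (h6 h5)) hx'
  intro J x hx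
  by_contra hx'
  have hx1 := (c.toFun J).vl_eq_one_of_not_mem ((c'.toFun J).2.2.1 hx) hx'
  have hx0 := ne_zero_of_vl_eq_one hx1
  refine key (latAct hp P _ ⟨x⁻¹, by rw [map_inv₀, hx1, inv_one]⟩ J) ?_ ?_
  · rw [c.mem_latAct_iff]; simpa using hx'
  · rw [c'.mem_latAct_iff]; simpa using hx

theorem finite_clo (hdim : ringKrullDim D < ⊤) (h : P ≤ P') :
    Finite (Clo (latAct hp P P'.asIdeal.primeCompl)) := by
  have := finite_Iic hp hdim P'
  let T : Set (Set D) := insert ∅ (Set.range fun Q : Set.Iic P' => (Q.1.asIdeal : Set D))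
  have hT : T.Finite := (Set.finite_range _).insert _
  have := hT.to_subtype
  let f : Clo (latAct hp P P'.asIdeal.primeCompl) → T × Prop := fun c => (⟨c.trace, by
    rcases c.trace_eq h with h1 | ⟨Q, h1⟩
    · exact Or.inl h1
    · exact Or.inr ⟨Q, h1.symm⟩⟩, c.Attained)
  refine Finite.of_injective f fun c c' hcc => ?_
  have h1 : c.trace = c'.trace := congrArg (fun z => z.1.1) hcc
  have h2 : c.Attained = c'.Attained := congrArg (fun z => z.2) hcc
  exact le_antisymm (Clo.le_of_trace_eq h h1.symm (by rw [h2]))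
    (Clo.le_of_trace_eq h h1 (by rw [h2]))

end Chains

/-! ### Closure operators which close the ring -/

section Closers

variable {D : Type*} [CommRing D] [IsDomain D]
variable {K : Type*} [Field K] [Algebra D K] [IsFractionRing D K]
variable {hp : IsPrufer D K} {P P' : PrimeSpectrum D} {S : Submonoid D}

theorem locS_oneAdd_eq_iff (hp : IsPrufer D K) (P : PrimeSpectrum D) :
    locS K (oneAdd P) = oP hp P ↔ P.asIdeal.IsMaximal := by
  constructor
  · intro h
    by_contra hP
    obtain ⟨M, hM, hle⟩ := P.asIdeal.exists_le_maximal P.2.ne_top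
    have hne : ¬ M ≤ P.asIdeal := fun h' => hP (le_antisymm hle h' ▸ hM)
    obtain ⟨m, hm, hm'⟩ := SetLike.not_le_iff_exists.1 hne
    have hm1 := (vl_algebraMap_eq_one hp P).2 hm'
    have hm0 := ne_zero_of_vl_eq_one hm1
    have : (algebraMap D K m)⁻¹ ∈ oP hp P := by
      rw [mem_oP, map_inv₀, hm1, inv_one]
    rw [← h] at this
    obtain ⟨d, hd, a, hda⟩ := this
    have h2 : d = a * m := by
      apply IsFractionRing.injective D K
      rw [map_mul, ← hda]
      field_simp
    have hdM : d ∈ M := h2 ▸ M.mul_mem_left a hm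
    exact hM.ne_top ((Ideal.eq_top_iff_one _).2
      (by simpa using M.sub_mem hdM (hle (mem_oneAdd.1 hd))))
  · intro hM
    refine le_antisymm (locS_le_oP fun _ hd => not_mem_of_mem_oneAdd le_rfl hd) ?_
    intro x hx
    obtain ⟨s, hs, a, h⟩ := (vl_le_one_iff hp P).1 hx
    obtain ⟨y, i, hi, hy⟩ := hM.exists_inv hs
    refine ⟨y * s, ?_, y * a, by rw [map_mul, map_mul, mul_assoc, h]⟩
    rw [mem_oneAdd, ← hy]
    simpa using neg_mem hi

theorem subsingleton_clo (hM : P.asIdeal.IsMaximal) :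
    Subsingleton (Clo (latAct hp P (oneAdd P))) := by
  have hk : Kids P (fun i : Fin 0 => i.elim0) :=
    ⟨fun i => i.elim0, fun M _ h => absurd (hM.eq_of_le M.2.ne_top h.le) fun h' =>
      h.ne (PrimeSpectrum.ext h'), fun i => i.elim0⟩
  have key : ∀ J : Lat hp P (oneAdd P), J = ⊤ := fun J =>
    top_le_iff.1 fun x hx => hk.mem_of_forall_mem J hx fun i => i.elim0
  exact ⟨fun c c' => Clo.ext' fun J => (key _).trans (key _).symm⟩

/-- If the localization at `P'` is not the localization at `S`, closing the latter can be tested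
on the modules at `P'`. -/
theorem closersExt (hm : Mid P P' S) (h : locS K S ≠ oP hp P') :
    Nonempty ({c : Clo (latAct hp P' S) // Closes c} ≃o
      {c : Clo (latAct hp P S) // Closes c}) := by
  refine ⟨RelIso.ofSurjective (OrderEmbedding.ofMapLEIff
    (fun c => ⟨extClo hm c.1, (closes_extClo_iff hm).2 c.2⟩)
    fun c c' => extClo_le_extClo hm) ?_⟩
  rintro ⟨c, hc⟩
  obtain ⟨c | c, rfl⟩ := (splitIso hm).surjective c
  · exact ⟨⟨c.1, (closes_extClo_iff hm).1 hc⟩, rfl⟩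
  · exact absurd ((closes_coarseClo_iff hm).1 hc).1 h

theorem closersCoarse (hP' : P'.asIdeal.IsMaximal) (h : P < P') :
    Nonempty ({c : Clo (latAct hp P P'.asIdeal.primeCompl) // Closes c} ≃o
      {c : Clo (latAct hp P (oneAdd P')) // Closes c}) := by
  have hm := mid_oneAdd h
  refine ⟨RelIso.ofSurjective (OrderEmbedding.ofMapLEIff
    (fun c => ⟨coarseClo hm c.1, (closes_coarseClo_iff hm).2
      ⟨(locS_oneAdd_eq_iff hp P').2 hP', c.2⟩⟩) fun c c' => coarseClo_le_coarseClo hm) ?_⟩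
  rintro ⟨c, hc⟩
  have := subsingleton_clo (hp := hp) hP'
  obtain ⟨c | c, rfl⟩ := (splitIso hm).surjective c
  · exact absurd (Subsingleton.elim _ _) c.2
  · exact ⟨⟨c, ((closes_coarseClo_iff hm).1 hc).2⟩, rfl⟩

end Closers

/-- The restriction of an order isomorphism to the elements different from the largest one. -/
def neTopOrderIso {α β : Type*} [PartialOrder α] [OrderTop α] [PartialOrder β] [OrderTop β]
    (e : α ≃o β) : {a : α // a ≠ ⊤} ≃o {b : β // b ≠ ⊤} where
  toEquiv := e.toEquiv.subtypeEquiv fun a => not_congr <| by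
    change a = ⊤ ↔ e a = ⊤
    rw [← e.map_top, e.injective.eq_iff]
  map_rel_iff' := e.map_rel_iff

section Match

variable {D₁ : Type*} [CommRing D₁] [IsDomain D₁]
variable {K₁ : Type*} [Field K₁] [Algebra D₁ K₁] [IsFractionRing D₁ K₁]
variable {D₂ : Type*} [CommRing D₂] [IsDomain D₂]
variable {K₂ : Type*} [Field K₂] [Algebra D₂ K₂] [IsFractionRing D₂ K₂]
variable {hp₁ : IsPrufer D₁ K₁} {hp₂ : IsPrufer D₂ K₂}

/-- The closure operators at `P₁` and `P₂`, with respect to `S₁` and `S₂`, are isomorphic by an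
isomorphism matching those which close the ring. -/
def Matches (hp₁ : IsPrufer D₁ K₁) (hp₂ : IsPrufer D₂ K₂) (P₁ : PrimeSpectrum D₁)
    (S₁ : Submonoid D₁) (P₂ : PrimeSpectrum D₂) (S₂ : Submonoid D₂) : Prop :=
  ∃ e : Clo (latAct hp₁ P₁ S₁) ≃o Clo (latAct hp₂ P₂ S₂), ∀ c, Closes c ↔ Closes (e c)

variable {P₁ Q₁ : PrimeSpectrum D₁} {P₂ Q₂ : PrimeSpectrum D₂}

theorem Matches.extend (hd₁ : ringKrullDim D₁ < ⊤) (hd₂ : ringKrullDim D₂ < ⊤)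
    (h₁ : P₁ < Q₁) (h₂ : P₂ < Q₂)
    (h : Matches hp₁ hp₂ Q₁ (oneAdd Q₁) Q₂ (oneAdd Q₂))
    (hmax : Q₁.asIdeal.IsMaximal ↔ Q₂.asIdeal.IsMaximal)
    (hcard : Nat.card (Clo (latAct hp₁ P₁ Q₁.asIdeal.primeCompl)) =
      Nat.card (Clo (latAct hp₂ P₂ Q₂.asIdeal.primeCompl)))
    (hcl : Q₁.asIdeal.IsMaximal →
      Nat.card {c : Clo (latAct hp₁ P₁ Q₁.asIdeal.primeCompl) // Closes c} =
        Nat.card {c : Clo (latAct hp₂ P₂ Q₂.asIdeal.primeCompl) // Closes c}) :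
    Matches hp₁ hp₂ P₁ (oneAdd Q₁) P₂ (oneAdd Q₂) := by
  obtain ⟨e, he⟩ := h
  have := finite_clo (hp := hp₁) hd₁ h₁.le
  have := finite_clo (hp := hp₂) hd₂ h₂.le
  obtain ⟨f, hf⟩ := exists_orderIso_of_total (Clo.le_total (hp := hp₁) h₁.le)
    (Clo.le_total (hp := hp₂) h₂.le) hcard (fun c => Q₁.asIdeal.IsMaximal ∧ Closes c)
    (fun c => Q₁.asIdeal.IsMaximal ∧ Closes c) (fun a b hab hb => ⟨hb.1, hb.2.anti hab⟩)
    (fun a b hab hb => ⟨hb.1, hb.2.anti hab⟩) (by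
      by_cases hM : Q₁.asIdeal.IsMaximal
      · simpa only [hM, true_and] using hcl hM
      · simp [hM])
  have m₁ := mid_oneAdd h₁
  have m₂ := mid_oneAdd h₂
  refine ⟨(splitIso m₁).symm.trans ((OrderIso.sumLexCongr (neTopOrderIso e) f).trans (splitIso m₂)),
    fun c => ?_⟩
  obtain ⟨x, rfl⟩ := (splitIso m₁).surjective c
  rw [OrderIso.trans_apply, OrderIso.symm_apply_apply, OrderIso.trans_apply]
  rcases x with c | c
  · change Closes (extClo m₁ c.1) ↔ Closes (extClo m₂ (e c.1))
    rw [closes_extClo_iff, closes_extClo_iff, he]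
  · change Closes (coarseClo m₁ c) ↔ Closes (coarseClo m₂ (f c))
    rw [closes_coarseClo_iff, closes_coarseClo_iff, locS_oneAdd_eq_iff, locS_oneAdd_eq_iff,
      ← hmax]
    exact hf c

theorem Matches.glue {ι : Type*} [Finite ι] {p₁ : ι → PrimeSpectrum D₁}
    {p₂ : ι → PrimeSpectrum D₂} (hk₁ : Kids P₁ p₁) (hk₂ : Kids P₂ p₂)
    (h : ∀ i, Matches hp₁ hp₂ P₁ (oneAdd (p₁ i)) P₂ (oneAdd (p₂ i))) :
    Matches hp₁ hp₂ P₁ (oneAdd P₁) P₂ (oneAdd P₂) := by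
  choose e he using h
  refine ⟨(kidsFam hp₁ hk₁).trans ((Fam.congr e).trans (kidsFam hp₂ hk₂).symm), fun c => ?_⟩
  rw [closes_kidsFam_iff hp₁ hk₁, closes_kidsFam_iff hp₂ hk₂]
  rw [OrderIso.trans_apply, OrderIso.trans_apply, OrderIso.apply_symm_apply]
  exact forall_congr' fun i => he i _

end Match

/-! ### Operations as closure operators on nonzero modules -/

section Nonzero

variable (D : Type*) [CommRing D] [IsDomain D]
variable (K : Type*) [Field K] [Algebra D K] [IsFractionRing D K]

/-- The nonzero submodules of the quotient field. -/
abbrev NzMod : Type _ := {J : Submodule D K // J ≠ ⊥}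

/-- The nonzero fractional ideals, as submodules of the quotient field. -/
abbrev NzFrac : Type _ :=
  {J : Submodule D K // J ≠ ⊥ ∧ ∃ d : K, d ≠ 0 ∧ ∀ x ∈ J, ∃ r, algebraMap D K r = d * x}

variable {D K}

theorem scl_ne_bot {g : K} (hg : g ≠ 0) {J : Submodule D K} (hJ : J ≠ ⊥) : scl g J ≠ ⊥ := by
  obtain ⟨x, hx, hx0⟩ := Submodule.exists_mem_ne_zero_of_ne_bot hJ
  refine (Submodule.ne_bot_iff _).2 ⟨g * x, ?_, mul_ne_zero hg hx0⟩
  rwa [mem_scl, inv_mul_cancel_left₀ hg]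

theorem scl_bot {g : K} (hg : g ≠ 0) : scl g (⊥ : Submodule D K) = ⊥ := by
  ext x; simp [mem_scl, hg]

theorem scl_top (g : K) : scl g (⊤ : Submodule D K) = ⊤ := rfl

theorem eq_bot_or_eq_top_of_scl {J : Submodule D K} (h : ∀ g : K, g ≠ 0 → scl g J = J) :
    J = ⊥ ∨ J = ⊤ := by
  refine or_iff_not_imp_left.2 fun hJ => eq_top_iff.2 fun x _ => ?_
  obtain ⟨y, hy, hy0⟩ := Submodule.exists_mem_ne_zero_of_ne_bot hJ
  by_cases hx : x = 0
  · simp [hx]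
  · rw [← h (x / y) (div_ne_zero hx hy0), mem_scl]
    have : (x / y)⁻¹ * x = y := by field_simp
    rwa [this]

variable (D K)

/-- Scaling on nonzero submodules. -/
def modAct (g : {x : K // x ≠ 0}) (J : NzMod D K) : NzMod D K := ⟨scl g.1 J.1, scl_ne_bot g.2 J.2⟩

/-- Scaling on nonzero fractional ideals. -/
def fracAct (g : {x : K // x ≠ 0}) (J : NzFrac D K) : NzFrac D K :=
  ⟨scl g.1 J.1, scl_ne_bot g.2 J.2.1, by
    obtain ⟨d, hd, h⟩ := J.2.2
    refine ⟨d * g.1⁻¹, mul_ne_zero hd (inv_ne_zero g.2), fun x hx => ?_⟩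
    rw [mul_assoc]
    exact h _ hx⟩

/-- The ring as a nonzero fractional ideal. -/
def fracOne : NzFrac D K := ⟨1, one_ne_zero, 1, one_ne_zero, fun x hx => by
  obtain ⟨r, rfl⟩ := Submodule.mem_one.1 hx
  exact ⟨r, (one_mul _).symm⟩⟩

open Classical in
/-- The semistar operation defined by a closure operator on the nonzero submodules, fixing `0`;
the extra top element gives the operation sending everything to the quotient field. -/
def toSemistar : WithTop (Clo (modAct D K)) → Semistar D K
  | ⊤ => ⟨fun _ => ⊤, fun _ => le_top, fun _ _ _ => le_rfl, fun _ => rfl, fun x hx _ => by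
      rw [span_singleton_mul_eq_scl hx, scl_top]⟩
  | (c : Clo (modAct D K)) =>
    { toFun := fun I => if h : I = ⊥ then ⊥ else (c.toFun ⟨I, h⟩).1
      le_star' := fun I => by
        split_ifs with h
        · exact h.le
        · exact c.le_cl ⟨I, h⟩
      mono' := fun I J hIJ => by
        split_ifs with h h'
        · exact le_rfl
        · exact bot_le
        · rename_i h'
          exact absurd (le_bot_iff.1 (h' ▸ hIJ)) h
        · exact c.mono hIJ
      idem' := fun I => by
        by_cases h : I = ⊥
        · simp [h]
        · simp only [h, dif_neg, not_false_iff, (c.toFun ⟨I, h⟩).2]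
          exact congrArg Subtype.val (c.idem ⟨I, h⟩)
      smul' := fun x hx I => by
        simp only [span_singleton_mul_eq_scl hx]
        by_cases h : I = ⊥
        · simp [h, scl_bot hx]
        · simp only [h, scl_ne_bot hx h, dif_neg, not_false_iff]
          exact congrArg Subtype.val (c.equivariant ⟨x, hx⟩ ⟨I, h⟩) }

theorem toSemistar_coe_bot (c : Clo (modAct D K)) :
    (toSemistar D K (c : WithTop (Clo (modAct D K)))).toFun ⊥ = ⊥ := by
  simp [toSemistar]

theorem toSemistar_coe_of_ne (c : Clo (modAct D K)) (I : NzMod D K) :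
    (toSemistar D K (c : WithTop (Clo (modAct D K)))).toFun I.1 = (c.toFun I).1 := by
  simp [toSemistar, I.2]

/-- Semistar operations are closure operators on the nonzero submodules, and one more. -/
def semistarIso : WithTop (Clo (modAct D K)) ≃o Semistar D K :=
  RelIso.ofSurjective (OrderEmbedding.ofMapLEIff (toSemistar D K) (by
    intro a b
    induction b using WithTop.recTopCoe with
    | top => exact iff_of_true (fun _ => le_top) le_top
    | coe b =>
      induction a using WithTop.recTopCoe with
      | top =>
        refine iff_of_false (fun h => ?_) (WithTop.not_top_le_coe b)
        have := h ⊥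
        rw [toSemistar_coe_bot] at this
        exact top_ne_bot (le_bot_iff.1 this)
      | coe a =>
        rw [WithTop.coe_le_coe]
        constructor
        · intro h I
          have := h I.1
          rwa [toSemistar_coe_of_ne, toSemistar_coe_of_ne] at this
        · intro h I
          by_cases hI : I = ⊥
          · rw [hI, toSemistar_coe_bot, toSemistar_coe_bot]
          · have := h ⟨I, hI⟩
            rw [toSemistar_coe_of_ne D K a ⟨I, hI⟩, toSemistar_coe_of_ne D K b ⟨I, hI⟩]
            exact this)) (by
    intro s
    have h0 : s.toFun ⊥ = ⊥ ∨ s.toFun ⊥ = ⊤ := by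
      refine eq_bot_or_eq_top_of_scl fun g hg => ?_
      rw [← span_singleton_mul_eq_scl hg, ← s.smul' g hg, span_singleton_mul_eq_scl hg, scl_bot hg]
    rcases h0 with h0 | h0
    · refine ⟨((⟨fun I => ⟨s.toFun I.1, ne_bot_of_le_ne_bot I.2 (s.le_star' _)⟩,
        fun I => s.le_star' _, fun I J h => s.mono' h, fun I => Subtype.ext (s.idem' _),
        fun g I => Subtype.ext ?_⟩ : Clo (modAct D K)) : WithTop (Clo (modAct D K))), ?_⟩
      · have := s.smul' g.1 g.2 I.1
        rwa [span_singleton_mul_eq_scl g.2, span_singleton_mul_eq_scl g.2] at this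
      · refine Semistar.ext' (funext fun I => ?_)
        by_cases hI : I = ⊥
        · rw [hI, h0]
          exact toSemistar_coe_bot D K _
        · exact toSemistar_coe_of_ne D K _ ⟨I, hI⟩
    · refine ⟨⊤, Semistar.ext' (funext fun I => ?_)⟩
      exact (top_le_iff.1 (h0 ▸ s.mono' bot_le)).symm)

theorem semistarIso_coe_one (c : Clo (modAct D K)) :
    (semistarIso D K (c : WithTop (Clo (modAct D K)))).toFun 1 = 1 ↔
      c.toFun ⟨1, one_ne_zero⟩ = ⟨1, one_ne_zero⟩ := by
  rw [Subtype.ext_iff]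
  exact iff_of_eq (congrArg (· = _) (toSemistar_coe_of_ne D K c ⟨1, one_ne_zero⟩))

theorem one_eq_top_iff : (1 : Submodule D K) = ⊤ ↔ (⊥ : Ideal D).IsMaximal := by
  rw [← Ring.isField_iff_maximal_bot]
  constructor
  · intro h
    refine ⟨⟨0, 1, zero_ne_one⟩, mul_comm, fun {a} ha => ?_⟩
    have hx : (algebraMap D K a)⁻¹ ∈ (1 : Submodule D K) := h ▸ Submodule.mem_top
    obtain ⟨b, hb⟩ := Submodule.mem_one.1 hx
    refine ⟨b, IsFractionRing.injective D K ?_⟩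
    rw [map_mul, hb, map_one, mul_inv_cancel₀]
    exact (map_ne_zero_iff _ (IsFractionRing.injective D K)).2 ha
  · intro h
    refine eq_top_iff.2 fun x _ => ?_
    obtain ⟨a, b, hb, rfl⟩ := IsFractionRing.div_surjective (A := D) x
    obtain ⟨b', hb'⟩ := h.mul_inv_cancel (nonZeroDivisors.ne_zero hb)
    refine Submodule.mem_one.2 ⟨a * b', ?_⟩
    have hb0 : algebraMap D K b ≠ 0 :=
      (map_ne_zero_iff _ (IsFractionRing.injective D K)).2 (nonZeroDivisors.ne_zero hb)
    rw [eq_div_iff hb0, ← map_mul, mul_assoc, mul_comm b', hb', mul_one]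

theorem semistarIso_top_one :
    (semistarIso D K ⊤).toFun 1 = 1 ↔ (⊥ : Ideal D).IsMaximal := by
  rw [← one_eq_top_iff D K]
  exact eq_comm

variable {D K}

theorem isFracOf_bot_iff {I : Submodule D K} : IsFracOf D K ⊥ I ↔
    ∃ d : K, d ≠ 0 ∧ ∀ x ∈ I, ∃ r, algebraMap D K r = d * x := by
  refine ⟨fun h => h.2, fun h => ⟨?_, h⟩⟩
  rintro _ ⟨a, rfl⟩ x hx
  have := I.smul_mem a hx
  rwa [Algebra.smul_def] at this

theorem isFracOf_bot : IsFracOf D K ⊥ (⊥ : Submodule D K) :=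
  isFracOf_bot_iff.2 ⟨1, one_ne_zero, fun x hx => ⟨0, by
    rw [(Submodule.mem_bot D).1 hx]; simp⟩⟩

/-- A nonzero fractional ideal, bundled as an element of the domain of star operations. -/
def NzFrac.bundle (J : NzFrac D K) : {I : Submodule D K // IsFracOf D K ⊥ I} :=
  ⟨J.1, isFracOf_bot_iff.2 J.2.2⟩

variable (D K)

open Classical in
/-- The fractional star operation defined by a closure operator on nonzero fractional ideals. -/
def toFracStar (c : Clo (fracAct D K)) : FracStar D K ⊥ where
  toFun I := if h : I.1 = ⊥ then I else (c.toFun ⟨I.1, h, isFracOf_bot_iff.1 I.2⟩).bundle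
  le_star' I := by
    split_ifs with h
    · exact le_rfl
    · exact c.le_cl ⟨I.1, h, isFracOf_bot_iff.1 I.2⟩
  mono' I J hIJ := by
    split_ifs with h h' h'
    · exact hIJ
    · exact h.le.trans bot_le
    · exact absurd (le_bot_iff.1 (h' ▸ hIJ)) h
    · exact c.mono (x := ⟨I.1, h, isFracOf_bot_iff.1 I.2⟩) (y := ⟨J.1, h', isFracOf_bot_iff.1 J.2⟩)
        hIJ
  idem' I := by
    by_cases h : I.1 = ⊥
    · simp [h]
    · have h2 := (c.toFun ⟨I.1, h, isFracOf_bot_iff.1 I.2⟩).2.1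
      have h3 := congrArg Subtype.val (c.idem ⟨I.1, h, isFracOf_bot_iff.1 I.2⟩)
      simp only [h, dif_neg, not_false_iff, NzFrac.bundle, h2]
      exact Subtype.ext h3
  smul' x hx I J hJ := by
    rw [span_singleton_mul_eq_scl hx] at hJ ⊢
    obtain ⟨J, hJ'⟩ := J
    subst hJ
    by_cases h : I.1 = ⊥
    · simp [h, scl_bot hx]
    · simp only [h, scl_ne_bot hx h, dif_neg, not_false_iff]
      exact congrArg Subtype.val (c.equivariant ⟨x, hx⟩ ⟨I.1, h, isFracOf_bot_iff.1 I.2⟩)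

theorem toFracStar_of_ne (c : Clo (fracAct D K)) (I : NzFrac D K) :
    (toFracStar D K c).toFun I.bundle = (c.toFun I).bundle := by
  have : (I.bundle).1 ≠ ⊥ := I.2.1
  simp only [toFracStar, this, dif_neg, not_false_iff]
  rfl

/-- Fractional star operations are closure operators on the nonzero fractional ideals, if the
ring is not a field. -/
def fracStarIso (hD : ¬ (⊥ : Ideal D).IsMaximal) : Clo (fracAct D K) ≃o FracStar D K ⊥ :=
  RelIso.ofSurjective (OrderEmbedding.ofMapLEIff (toFracStar D K) (by
    intro c c'
    constructor
    · intro h I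
      have := h I.bundle
      rwa [toFracStar_of_ne, toFracStar_of_ne] at this
    · intro h I
      by_cases hI : I.1 = ⊥
      · simp only [toFracStar, hI, dif_pos, le_refl]
      · have := h ⟨I.1, hI, isFracOf_bot_iff.1 I.2⟩
        simp only [toFracStar, hI, dif_neg, not_false_iff]
        exact this)) (by
    intro s
    let I₀ : {I : Submodule D K // IsFracOf D K ⊥ I} := ⟨⊥, isFracOf_bot⟩
    have h0 : (s.toFun I₀).1 = ⊥ := by
      have : (s.toFun I₀).1 = ⊥ ∨ (s.toFun I₀).1 = ⊤ := by
        refine eq_bot_or_eq_top_of_scl fun g hg => ?_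
        rw [← span_singleton_mul_eq_scl hg, ← s.smul' g hg I₀ I₀]
        rw [span_singleton_mul_eq_scl hg, scl_bot hg]
      refine this.resolve_right fun htop => hD ((one_eq_top_iff D K).1 (top_le_iff.1 ?_))
      obtain ⟨d, hd, h⟩ := isFracOf_bot_iff.1 (s.toFun I₀).2
      intro x _
      obtain ⟨r, hr⟩ := h (d⁻¹ * x) (by rw [htop]; trivial)
      rw [mul_inv_cancel_left₀ hd] at hr
      exact Submodule.mem_one.2 ⟨r, hr⟩
    have hidem := fun I : NzFrac D K => congrArg Subtype.val (s.idem' I.bundle)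
    refine ⟨⟨fun I => ⟨(s.toFun I.bundle).1, ne_bot_of_le_ne_bot I.2.1 (s.le_star' I.bundle),
      isFracOf_bot_iff.1 (s.toFun I.bundle).2⟩, fun I => s.le_star' I.bundle,
      fun I J h => s.mono' I.bundle J.bundle h,
      fun I => Subtype.ext (hidem I), fun g I => Subtype.ext ?_⟩, ?_⟩
    · have := s.smul' g.1 g.2 I.bundle (fracAct D K g I).bundle
        (span_singleton_mul_eq_scl g.2 _).symm
      rwa [span_singleton_mul_eq_scl g.2] at this
    · refine FracStar.ext' (funext fun I => Subtype.ext ?_)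
      by_cases hI : I.1 = ⊥
      · have : I = I₀ := Subtype.ext hI
        rw [this, h0]
        simp [toFracStar, I₀]
      · exact congrArg Subtype.val (toFracStar_of_ne D K _ ⟨I.1, hI, isFracOf_bot_iff.1 I.2⟩))

theorem isStarOp_fracStarIso (hD : ¬ (⊥ : Ideal D).IsMaximal) (c : Clo (fracAct D K)) :
    FracStar.IsStarOp D K (fracStarIso D K hD c) ↔ c.toFun (fracOne D K) = fracOne D K := by
  have h1 : Subalgebra.toSubmodule (⊥ : Subalgebra D K) = 1 := Algebra.toSubmodule_bot
  have h2 : (fracOne D K).bundle.1 = Subalgebra.toSubmodule (⊥ : Subalgebra D K) := h1.symm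
  have h3 := congrArg Subtype.val (toFracStar_of_ne D K c (fracOne D K))
  rw [FracStar.IsStarOp, Subtype.ext_iff]
  constructor
  · intro h
    have h4 := h (h2 ▸ (fracOne D K).bundle.2)
    have h5 : (fracOne D K).bundle = ⟨Subalgebra.toSubmodule ⊥, h2 ▸ (fracOne D K).bundle.2⟩ :=
      Subtype.ext h2
    rw [h5] at h3
    exact h3.symm.trans (h4.trans h1)
  · intro h h'
    have h5 : (fracOne D K).bundle = ⟨Subalgebra.toSubmodule ⊥, h'⟩ := Subtype.ext h2
    rw [h5] at h3
    exact h3.trans (h.trans h1.symm)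

/-- Over a field, star operations are semistar operations. -/
def fracStarIsoSemistar (hD : (⊥ : Ideal D).IsMaximal) : FracStar D K ⊥ ≃o Semistar D K :=
  have hI (I : Submodule D K) : IsFracOf D K ⊥ I := isFracOf_bot_iff.2 ⟨1, one_ne_zero, fun x _ =>
    Submodule.mem_one.1 (by rw [(one_eq_top_iff D K).2 hD]; trivial)⟩
  { toFun := fun s => ⟨fun I => (s.toFun ⟨I, hI I⟩).1, fun I => s.le_star' ⟨I, hI I⟩,
      fun I J h => s.mono' ⟨I, hI I⟩ ⟨J, hI J⟩ h,
      fun I => congrArg Subtype.val (s.idem' ⟨I, hI I⟩),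
      fun x hx I => s.smul' x hx ⟨I, hI I⟩ ⟨_, hI _⟩ rfl⟩
    invFun := fun s => ⟨fun I => ⟨s.toFun I.1, hI _⟩, fun I => s.le_star' I.1,
      fun I J h => s.mono' h, fun I => Subtype.ext (s.idem' I.1),
      fun x hx I J h => by
        have := s.smul' x hx I.1
        rwa [← h] at this⟩
    left_inv := fun _ => rfl
    right_inv := fun _ => rfl
    map_rel_iff' := ⟨fun h I => h I.1, fun h I => h ⟨I, hI I⟩⟩ }

theorem isStarOp_of_isMaximal_bot (hD : (⊥ : Ideal D).IsMaximal) (f : FracStar D K ⊥) :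
    FracStar.IsStarOp D K f := by
  intro h
  have h1 : Subalgebra.toSubmodule (⊥ : Subalgebra D K) = ⊤ :=
    Algebra.toSubmodule_bot.trans ((one_eq_top_iff D K).2 hD)
  exact le_antisymm (le_top.trans h1.ge) (f.le_star' ⟨_, h⟩)

end Nonzero

/-! ### Semistar and star operations as closure operators over the zero ideal -/

/-- Families with all entries proper. -/
def Fam.isoProper {ι : Type*} (Q : ι → Type*) [∀ i, PartialOrder (Q i)] [∀ i, OrderTop (Q i)] :
    Fam ({Set.univ} : Set (Set ι)) Q ≃o ∀ i, {q : Q i // q ≠ ⊤} where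
  toFun F i := ⟨F.1 ⟨Set.univ, rfl⟩ i, by
    obtain ⟨A', h, -⟩ := F.2.2.2 ⟨Set.univ, rfl⟩
    have : i ∈ A'.1 := by rw [show A'.1 = Set.univ from A'.2]; trivial
    rw [h] at this
    exact this⟩
  invFun f := ⟨fun _ i => (f i).1, fun A i hi => absurd (show i ∈ A.1 by
      rw [show A.1 = Set.univ from A.2]; trivial) hi, fun _ _ _ => le_rfl, fun A =>
      ⟨⟨Set.univ, rfl⟩, by
        ext i
        simpa using (f i).2, rfl⟩⟩
  left_inv F := Subtype.ext <| funext fun A => by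
    have : A = ⟨Set.univ, rfl⟩ := Subtype.ext A.2
    rw [this]
  right_inv f := rfl
  map_rel_iff' {F F'} := by
    constructor
    · intro h A i
      have : A = ⟨Set.univ, rfl⟩ := Subtype.ext A.2
      rw [this]
      exact h i
    · intro h i
      exact h ⟨Set.univ, rfl⟩ i

section Root

variable {D : Type*} [CommRing D] [IsDomain D]
variable {K : Type*} [Field K] [Algebra D K] [IsFractionRing D K]
variable (hp : IsPrufer D K)

theorem vl_bot_lt_one_iff {x : K} : vl hp ⊥ x < 1 ↔ x = 0 := by
  rw [vl_lt_one_iff]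
  constructor
  · rintro ⟨s, hs, a, ha, h⟩
    rw [PrimeSpectrum.asIdeal_bot, Ideal.mem_bot] at hs ha
    rw [ha, map_zero, mul_eq_zero] at h
    exact h.resolve_left ((map_ne_zero_iff _ (IsFractionRing.injective D K)).2 hs)
  · rintro rfl
    exact ⟨1, (Ideal.ne_top_iff_one _).1 (⊥ : PrimeSpectrum D).isPrime.ne_top, 0,
      zero_mem _, by simp⟩

theorem vl_bot_le_one (x : K) : vl hp ⊥ x ≤ 1 := by
  by_contra! h
  have h0 : x ≠ 0 := by rintro rfl; simp at h
  refine inv_ne_zero h0 ((vl_bot_lt_one_iff hp).1 ?_)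
  rw [map_inv₀]
  exact inv_lt_one_of_one_lt₀ h

theorem vl_bot_eq_one_iff {x : K} : vl hp ⊥ x = 1 ↔ x ≠ 0 := by
  rw [Ne, ← vl_bot_lt_one_iff hp, not_lt]
  exact ⟨fun h => h.ge, fun h => le_antisymm (vl_bot_le_one hp x) h⟩

theorem mP_bot : mP hp ⊥ = ⊥ := by
  ext x; rw [mem_mP, vl_bot_lt_one_iff, Submodule.mem_bot]

theorem oP_bot : oP hp ⊥ = ⊤ :=
  eq_top_iff.2 fun x _ => vl_bot_le_one hp x

theorem mem_oneAdd_bot {d : D} : d ∈ oneAdd (⊥ : PrimeSpectrum D) ↔ d = 1 := by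
  rw [mem_oneAdd, PrimeSpectrum.asIdeal_bot, Ideal.mem_bot, sub_eq_zero]

theorem locS_oneAdd_bot : locS K (oneAdd (⊥ : PrimeSpectrum D)) = 1 := by
  ext x
  rw [mem_locS, Submodule.mem_one]
  constructor
  · rintro ⟨d, hd, a, h⟩
    rw [mem_oneAdd_bot.1 hd, map_one, one_mul] at h
    exact ⟨a, h.symm⟩
  · rintro ⟨a, rfl⟩
    exact ⟨1, one_mem _, a, by simp⟩

/-- Nonzero submodules as modules over the zero ideal. -/
def rootIso : NzMod D K ≃o Lat hp ⊥ (oneAdd ⊥) where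
  toFun J := ⟨J.1, by rw [mP_bot]; exact bot_lt_iff_ne_bot.2 J.2, by rw [oP_bot]; exact le_top,
    fun d hd x _ h => by rwa [mem_oneAdd_bot.1 hd, one_smul] at h⟩
  invFun J := ⟨J.1, (lt_of_le_of_lt bot_le J.2.1).ne'⟩
  left_inv _ := rfl
  right_inv _ := rfl
  map_rel_iff' := Iff.rfl

/-- Semistar operations as closure operators over the zero ideal. -/
def semistarClo : Semistar D K ≃o WithTop (Clo (latAct hp ⊥ (oneAdd ⊥))) :=
  (semistarIso D K).symm.trans <| OrderIso.withTopCongr <| Clo.congr (rootIso hp)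
    (fun g => ⟨⟨g.1, (vl_bot_eq_one_iff hp).2 g.2⟩, fun _ => rfl⟩)
    (fun g => ⟨⟨g.1, (vl_bot_eq_one_iff hp).1 g.2⟩, fun _ => rfl⟩)

theorem semistarClo_symm_coe_one (c : Clo (latAct hp ⊥ (oneAdd ⊥))) :
    ((semistarClo hp).symm c).toFun 1 = 1 ↔ Closes c := by
  obtain ⟨c, rfl⟩ := (Clo.congr (act := modAct D K) (act' := latAct hp ⊥ (oneAdd ⊥)) (rootIso hp)
    (fun g => ⟨⟨g.1, (vl_bot_eq_one_iff hp).2 g.2⟩, fun _ => rfl⟩)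
    (fun g => ⟨⟨g.1, (vl_bot_eq_one_iff hp).1 g.2⟩, fun _ => rfl⟩)).surjective c
  have h1 : (semistarClo hp).symm ((Clo.congr (act := modAct D K)
      (act' := latAct hp ⊥ (oneAdd ⊥)) (rootIso hp)
      (fun g => ⟨⟨g.1, (vl_bot_eq_one_iff hp).2 g.2⟩, fun _ => rfl⟩)
      (fun g => ⟨⟨g.1, (vl_bot_eq_one_iff hp).1 g.2⟩, fun _ => rfl⟩) c :
        Clo (latAct hp ⊥ (oneAdd ⊥))) : WithTop (Clo (latAct hp ⊥ (oneAdd ⊥)))) =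
      semistarIso D K c := by
    rw [OrderIso.symm_apply_eq]
    simp [semistarClo]
  rw [h1, semistarIso_coe_one]
  have h2 : Closes (Clo.congr (act := modAct D K)
      (act' := latAct hp ⊥ (oneAdd ⊥)) (rootIso hp)
      (fun g => ⟨⟨g.1, (vl_bot_eq_one_iff hp).2 g.2⟩, fun _ => rfl⟩)
      (fun g => ⟨⟨g.1, (vl_bot_eq_one_iff hp).1 g.2⟩, fun _ => rfl⟩) c) ↔
      ∀ J : NzMod D K, J.1 = 1 → c.toFun J = J := by
    constructor
    · intro h J hJ
      have := h (rootIso hp J) (hJ.trans locS_oneAdd_bot.symm)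
      rw [Clo.congr_toFun] at this
      exact (rootIso hp).injective this
    · intro h J hJ
      obtain ⟨J, rfl⟩ := (rootIso hp).surjective J
      rw [Clo.congr_toFun, h J (hJ.trans locS_oneAdd_bot)]
  rw [h2]
  constructor
  · intro h J hJ
    have : J = ⟨1, one_ne_zero⟩ := Subtype.ext hJ
    rw [this, h]
  · intro h
    exact h _ rfl

theorem semistarClo_symm_top_one :
    ((semistarClo hp).symm ⊤).toFun 1 = 1 ↔ (⊥ : Ideal D).IsMaximal := by
  have : (semistarClo hp).symm ⊤ = semistarIso D K ⊤ := by
    rw [OrderIso.symm_apply_eq]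
    simp [semistarClo]
  rw [← semistarIso_top_one D K, this]

variable {ι : Type*} [Finite ι] {p : ι → PrimeSpectrum D}

theorem frac_iff_kidsIso_ne_top (hk : Kids ⊥ p) (J : Lat hp ⊥ (oneAdd ⊥)) :
    (∃ d : K, d ≠ 0 ∧ ∀ x ∈ J.1, ∃ r, algebraMap D K r = d * x) ↔
      ∀ i, kidsIso hp hk J i ≠ ⊤ := by
  have hgood := fun i => goodAct_lat (hp := hp) (mid_oneAdd (hk.lt i))
  set T : Lat hp ⊥ (oneAdd ⊥) := latT hp le_rfl fun _ hd => not_mem_of_mem_oneAdd le_rfl hd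
    with hT
  have hT1 : T.1 = 1 := locS_oneAdd_bot
  have hTi (i : ι) : kidsIso hp hk T i ≠ ⊤ :=
    ne_top_of_coe_eq_locS (mid_oneAdd (hk.lt i)) (kidsIso_latT hp hk i)
  constructor
  · rintro ⟨d, hd, h⟩ i hi
    have h1 : latAct hp ⊥ _ ⟨d, (vl_bot_eq_one_iff hp).2 hd⟩ J ≤ T := by
      intro y hy
      obtain ⟨r, hr⟩ := h _ hy
      rw [hT1, Submodule.mem_one]
      exact ⟨r, hr.trans (mul_inv_cancel_left₀ hd y)⟩
    have h2 := (kidsIso hp hk).monotone h1 i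
    rw [kidsIso_latAct, hi, FixesTop.act_top (act := latAct hp ⊥ (oneAdd (p i)))] at h2
    exact hTi i (top_le_iff.1 h2)
  · intro h
    choose g hg using fun i => GoodAct.cofinal (act := latAct hp ⊥ (oneAdd (p i)))
      (kidsIso hp hk J i) (kidsIso hp hk T i) (h i)
    obtain ⟨g', hg'⟩ := exists_latAct_eq hp hk g
    have h1 : latAct hp ⊥ _ g' J ≤ T := by
      rw [← (kidsIso hp hk).le_iff_le]
      intro i
      rw [kidsIso_latAct, ← hg']
      exact hg i
    have h0 := ne_zero_of_vl_eq_one g'.2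
    refine ⟨g'.1, h0, fun x hx => ?_⟩
    have h2 : g'.1 * x ∈ T.1 := h1 (by rwa [latAct_coe, mem_scl, inv_mul_cancel_left₀ h0])
    rwa [hT1, Submodule.mem_one] at h2

/-- Nonzero fractional ideals as families of proper modules. -/
def fracProd (hk : Kids ⊥ p) : NzFrac D K ≃o
    ProdOn ({Set.univ} : Set (Set ι)) (fun i => Lat hp ⊥ (oneAdd (p i))) where
  toFun J := ⟨kidsIso hp hk (rootIso hp ⟨J.1, J.2.1⟩),
    Set.eq_univ_iff_forall.2 ((frac_iff_kidsIso_ne_top hp hk _).1 J.2.2)⟩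
  invFun J := ⟨((kidsIso hp hk).symm J.1).1, ((rootIso hp).symm ((kidsIso hp hk).symm J.1)).2,
    (frac_iff_kidsIso_ne_top hp hk _).2 <| by
      rw [OrderIso.apply_symm_apply]
      exact Set.eq_univ_iff_forall.1 J.2⟩
  left_inv J := Subtype.ext <| by
    change ((kidsIso hp hk).symm (kidsIso hp hk (rootIso hp ⟨J.1, J.2.1⟩))).1 = J.1
    rw [OrderIso.symm_apply_apply]
    rfl
  right_inv J := Subtype.ext <| (kidsIso hp hk).apply_symm_apply J.1
  map_rel_iff' := (kidsIso hp hk).le_iff_le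

/-- The closure operators on the nonzero fractional ideals, in terms of those over the zero
ideal. -/
def fracCloProd (hk : Kids ⊥ p) : Clo (fracAct D K) ≃o
    Clo (haveI := fun i => goodAct_lat (hp := hp) (mid_oneAdd (hk.lt i))
      prodAct ({Set.univ} : Set (Set ι)) fun i => latAct hp ⊥ (oneAdd (p i))) :=
  Clo.congr (fracProd hp hk)
    (fun g => ⟨fun _ => ⟨g.1, (vl_bot_eq_one_iff hp).2 g.2⟩, fun J => Subtype.ext <| funext fun i =>
      kidsIso_latAct hp hk ⟨g.1, (vl_bot_eq_one_iff hp).2 g.2⟩ (rootIso hp ⟨J.1, J.2.1⟩) i⟩)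
    (fun g => by
      obtain ⟨h, hh⟩ := exists_latAct_eq hp hk g
      exact ⟨⟨h.1, (vl_bot_eq_one_iff hp).1 h.2⟩, fun J => Subtype.ext <| funext fun i =>
        (kidsIso_latAct hp hk h (rootIso hp ⟨J.1, J.2.1⟩) i).trans (hh i _).symm⟩)

/-- Fractional star operations as families of proper closure operators over the zero ideal. -/
def fracStarProd (hD : ¬ (⊥ : Ideal D).IsMaximal) (hk : Kids ⊥ p) :
    FracStar D K ⊥ ≃o ∀ i, {c : Clo (latAct hp ⊥ (oneAdd (p i))) // c ≠ ⊤} :=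
  haveI := fun i => goodAct_lat (hp := hp) (mid_oneAdd (hk.lt i))
  (fracStarIso D K hD).symm.trans <| (fracCloProd hp hk).trans <|
    (Fam.isoClo {Set.univ} fun i => latAct hp ⊥ (oneAdd (p i))).symm.trans (Fam.isoProper _)

theorem isStarOp_iff_closes (hD : ¬ (⊥ : Ideal D).IsMaximal) (hk : Kids ⊥ p)
    (f : FracStar D K ⊥) :
    FracStar.IsStarOp D K f ↔ ∀ i, Closes (fracStarProd hp hD hk f i).1 := by
  have hgood := fun i => goodAct_lat (hp := hp) (mid_oneAdd (hk.lt i))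
  obtain ⟨c, rfl⟩ := (fracStarIso D K hD).surjective f
  rw [isStarOp_fracStarIso]
  obtain ⟨F, hF⟩ := (Fam.isoClo {Set.univ} fun i => latAct hp ⊥ (oneAdd (p i))).surjective
    (fracCloProd hp hk c)
  have h1 : fracStarProd hp hD hk (fracStarIso D K hD c) = Fam.isoProper _ F := by
    simp only [fracStarProd, OrderIso.trans_apply, OrderIso.symm_apply_apply]
    rw [← hF, OrderIso.symm_apply_apply]
  rw [h1]
  have hT (i : ι) : ((fracProd hp hk (fracOne D K)).1 i).1 = locS K (oneAdd (p i)) := by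
    rw [← kidsIso_latT hp hk i]
    have : rootIso hp ⟨(fracOne D K).1, (fracOne D K).2.1⟩ =
        latT hp le_rfl fun _ hd => not_mem_of_mem_oneAdd le_rfl hd :=
      Subtype.ext locS_oneAdd_bot.symm
    rw [← this]
    rfl
  have h2 : (fracCloProd hp hk c).toFun (fracProd hp hk (fracOne D K)) =
      fracProd hp hk (c.toFun (fracOne D K)) := Clo.congr_toFun ..
  rw [← (fracProd hp hk).injective.eq_iff, ← h2, ← hF, Subtype.ext_iff, funext_iff]
  refine forall_congr' fun i => ?_
  have h3 : (((Fam.isoClo {Set.univ} fun i => latAct hp ⊥ (oneAdd (p i))) F).toFun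
      (fracProd hp hk (fracOne D K))).1 i =
      ((Fam.isoProper _ F) i).1.toFun ((fracProd hp hk (fracOne D K)).1 i) := by
    change (F.1 ⟨_, (fracProd hp hk (fracOne D K)).2⟩ i).toFun _ = (F.1 ⟨Set.univ, rfl⟩ i).toFun _
    have : (⟨_, (fracProd hp hk (fracOne D K)).2⟩ : ({Set.univ} : Set (Set ι))) =
        ⟨Set.univ, rfl⟩ := Subtype.ext (fracProd hp hk (fracOne D K)).2
    rw [this]
  rw [h3]
  constructor
  · intro h J hJ
    have : J = (fracProd hp hk (fracOne D K)).1 i := Subtype.ext (hJ.trans (hT i).symm)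
    rw [this, h]
  · intro h
    exact h _ (hT i)

end Root

/-! ### Fractional ideals of a valuation ring between two primes -/

section Residue

variable {D : Type*} [CommRing D] [IsDomain D]
variable {K : Type*} [Field K] [Algebra D K] [IsFractionRing D K]

/-- A surjection from the localization at `Q` to the quotient field `F` of `A`, whose kernel is
the maximal ideal and which pulls `A` back to the localization at `P`. -/
structure ResidueMap (hp : IsPrufer D K) (Q P : PrimeSpectrum D)
    (A : Type*) [CommRing A] [IsDomain A] (F : Type*) [Field F] [Algebra A F] where
  toFun : K → F
  map_add : ∀ x y, vl hp Q x ≤ 1 → vl hp Q y ≤ 1 → toFun (x + y) = toFun x + toFun y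
  map_mul : ∀ x y, vl hp Q x ≤ 1 → vl hp Q y ≤ 1 → toFun (x * y) = toFun x * toFun y
  eq_zero_iff : ∀ x, vl hp Q x ≤ 1 → (toFun x = 0 ↔ vl hp Q x < 1)
  surj : ∀ y, ∃ x, vl hp Q x ≤ 1 ∧ toFun x = y
  mem_range_iff : ∀ x, vl hp Q x ≤ 1 → ((∃ a, algebraMap A F a = toFun x) ↔ vl hp P x ≤ 1)

namespace ResidueMap

variable {hp : IsPrufer D K} {Q P : PrimeSpectrum D}
variable {A : Type*} [CommRing A] [IsDomain A]
variable {F : Type*} [Field F] [Algebra A F] [IsFractionRing A F]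
variable (φ : ResidueMap hp Q P A F)

theorem map_zero : φ.toFun 0 = 0 := (φ.eq_zero_iff 0 (by simp)).2 (by simp)

theorem ne_zero_iff {x : K} (hx : vl hp Q x ≤ 1) : φ.toFun x ≠ 0 ↔ vl hp Q x = 1 := by
  rw [Ne, φ.eq_zero_iff x hx, not_lt]
  exact ⟨fun h => le_antisymm hx h, fun h => h.ge⟩

theorem map_one : φ.toFun 1 = 1 := by
  have h1 : vl hp Q (1 : K) ≤ 1 := by simp
  have h := φ.map_mul 1 1 h1 h1
  rw [mul_one] at h
  exact mul_left_cancel₀ ((φ.ne_zero_iff h1).2 (by simp)) (by rw [← h, mul_one])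

theorem vl_inv {x : K} (hx : vl hp Q x = 1) : vl hp Q x⁻¹ = 1 := by rw [map_inv₀, hx, inv_one]

theorem map_inv {x : K} (hx : vl hp Q x = 1) : φ.toFun x⁻¹ = (φ.toFun x)⁻¹ := by
  refine eq_inv_of_mul_eq_one_left ?_
  rw [← φ.map_mul _ _ (vl_inv hx).le hx.le, inv_mul_cancel₀ (ne_zero_of_vl_eq_one hx), φ.map_one]

theorem vl_sub_lt {x y : K} (hx : vl hp Q x ≤ 1) (hy : vl hp Q y ≤ 1)
    (h : φ.toFun x = φ.toFun y) : vl hp Q (x - y) < 1 := by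
  have h1 : vl hp Q (x - y) ≤ 1 := ((vl hp Q).map_sub x y).trans (max_le hx hy)
  rw [← φ.eq_zero_iff _ h1]
  have h2 := φ.map_add (x - y) y h1 hy
  rw [sub_add_cancel, h] at h2
  exact add_eq_right.1 h2.symm

variable (h : Q < P)

include h in
theorem exists_algebraMap (a : A) :
    ∃ x, vl hp P x ≤ 1 ∧ vl hp Q x ≤ 1 ∧ φ.toFun x = algebraMap A F a := by
  obtain ⟨x, hx, hxa⟩ := φ.surj (algebraMap A F a)
  exact ⟨x, (φ.mem_range_iff x hx).1 ⟨a, hxa.symm⟩, hx, hxa⟩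

/-- The preimage of a submodule. -/
def lift (N : Submodule A F) : Submodule D K where
  carrier := {x | vl hp Q x ≤ 1 ∧ φ.toFun x ∈ N}
  zero_mem' := ⟨by simp, by rw [φ.map_zero]; exact N.zero_mem⟩
  add_mem' := by
    rintro x y ⟨hx, hx'⟩ ⟨hy, hy'⟩
    exact ⟨((vl hp Q).map_add x y).trans (max_le hx hy), by
      rw [φ.map_add x y hx hy]; exact N.add_mem hx' hy'⟩
  smul_mem' := by
    rintro d x ⟨hx, hx'⟩
    have hd := vl_algebraMap_le hp Q d
    refine ⟨(oP hp Q).smul_mem d hx, ?_⟩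
    obtain ⟨a, ha⟩ := (φ.mem_range_iff _ hd).2 (vl_algebraMap_le hp P d)
    rw [Algebra.smul_def, φ.map_mul _ _ hd hx, ← ha, ← Algebra.smul_def]
    exact N.smul_mem a hx'

include h in
theorem lift_sat (N : Submodule A F) (d : D) (hd : d ∈ P.asIdeal.primeCompl) (x : K)
    (hx : vl hp Q x ≤ 1) (hdx : d • x ∈ φ.lift N) : x ∈ φ.lift N := by
  refine ⟨hx, ?_⟩
  have hP : vl hp P (algebraMap D K d) = 1 := (vl_algebraMap_eq_one hp P).2 hd
  have hQ : vl hp Q (algebraMap D K d) = 1 := vl_eq_one_of_le hp h.le hP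
  obtain ⟨a, ha⟩ := (φ.mem_range_iff _ (vl_inv hQ).le).2
    (show vl hp P (algebraMap D K d)⁻¹ ≤ 1 by rw [map_inv₀, hP, inv_one])
  have : x = (algebraMap D K d)⁻¹ * (d • x) := by
    rw [Algebra.smul_def, inv_mul_cancel_left₀ (ne_zero_of_vl_eq_one hQ)]
  rw [this, φ.map_mul _ _ (vl_inv hQ).le hdx.1, ← ha, ← Algebra.smul_def]
  exact N.smul_mem a hdx.2

/-- The preimage of a nonzero submodule, as a module over `Q`. -/
def liftLat (N : NzMod A F) : Lat hp Q P.asIdeal.primeCompl :=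
  ⟨φ.lift N.1, lt_of_le_of_ne
    (fun x hx => ⟨(mem_mP.1 hx).le, by
      rw [(φ.eq_zero_iff x (mem_mP.1 hx).le).2 hx]; exact N.1.zero_mem⟩)
    (fun he => by
      obtain ⟨y, hy, hy0⟩ := Submodule.exists_mem_ne_zero_of_ne_bot N.2
      obtain ⟨x, hx, rfl⟩ := φ.surj y
      have : x ∈ mP hp Q := he ▸ (⟨hx, hy⟩ : x ∈ φ.lift N.1)
      exact hy0 ((φ.eq_zero_iff x hx).2 this)),
    fun x hx => hx.1, φ.lift_sat h N.1⟩

/-- The image of a module over `Q`. -/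
def push (J : Lat hp Q P.asIdeal.primeCompl) : NzMod A F :=
  ⟨{  carrier := {y | ∃ x ∈ J.1, φ.toFun x = y}
      zero_mem' := ⟨0, J.1.zero_mem, φ.map_zero⟩
      add_mem' := by
        rintro _ _ ⟨x, hx, rfl⟩ ⟨y, hy, rfl⟩
        exact ⟨x + y, J.1.add_mem hx hy, φ.map_add x y (J.2.2.1 hx) (J.2.2.1 hy)⟩
      smul_mem' := by
        rintro a _ ⟨x, hx, rfl⟩
        obtain ⟨z, hz, hz', hza⟩ := φ.exists_algebraMap h a
        exact ⟨z * x, J.mul_mem_of_vl_le_one h.le hz hx, by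
          rw [φ.map_mul z x hz' (J.2.2.1 hx), hza, Algebra.smul_def]⟩ },
    by
      obtain ⟨x, hx, hx1⟩ := J.exists_vl_eq_one
      exact (Submodule.ne_bot_iff _).2 ⟨φ.toFun x, ⟨x, hx, rfl⟩, (φ.ne_zero_iff hx1.le).2 hx1⟩⟩

/-- Nonzero submodules of the residue field correspond to modules over `Q`. -/
def latIso : NzMod A F ≃o Lat hp Q P.asIdeal.primeCompl where
  toFun := φ.liftLat h
  invFun := φ.push h
  left_inv N := by
    refine Subtype.ext (Submodule.ext fun y => ⟨?_, fun hy => ?_⟩)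
    · rintro ⟨x, hx, rfl⟩
      exact hx.2
    · obtain ⟨x, hx, rfl⟩ := φ.surj y
      exact ⟨x, ⟨hx, hy⟩, rfl⟩
  right_inv J := by
    refine Subtype.ext (Submodule.ext fun x => ⟨?_, fun hx => ⟨J.2.2.1 hx, x, hx, rfl⟩⟩)
    rintro ⟨hx, x', hx', he⟩
    have := J.2.1.le (φ.vl_sub_lt hx (J.2.2.1 hx') he.symm)
    simpa using J.1.add_mem this hx'
  map_rel_iff' {N N'} := by
    refine ⟨fun hle y hy => ?_, fun hle x hx => ⟨hx.1, hle hx.2⟩⟩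
    obtain ⟨x, hx, rfl⟩ := φ.surj y
    exact (hle (show x ∈ φ.lift N.1 from ⟨hx, hy⟩)).2

theorem mem_latIso {N : NzMod A F} {x : K} :
    x ∈ (φ.latIso h N).1 ↔ vl hp Q x ≤ 1 ∧ φ.toFun x ∈ N.1 := Iff.rfl

include φ h in
theorem one_ne_top : (1 : Submodule A F) ≠ ⊤ := by
  intro h1
  obtain ⟨x, hx, hx'⟩ := exists_not_mem_oP (hp := hp) h
  refine hx' ((φ.mem_range_iff x hx).1 (Submodule.mem_one.1 ?_))
  rw [h1]
  trivial

theorem frac_iff_ne_top (N : NzMod A F) :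
    (∃ d : F, d ≠ 0 ∧ ∀ x ∈ N.1, ∃ r, algebraMap A F r = d * x) ↔ φ.latIso h N ≠ ⊤ := by
  constructor
  · rintro ⟨d, hd, hN⟩ htop
    refine φ.one_ne_top h (eq_top_iff.2 fun y _ => Submodule.mem_one.2 ?_)
    obtain ⟨x, hx, hxy⟩ := φ.surj (d⁻¹ * y)
    have : x ∈ (φ.latIso h N).1 := by rw [htop]; exact hx
    obtain ⟨r, hr⟩ := hN _ (hxy ▸ this.2)
    exact ⟨r, by rw [hr, mul_inv_cancel_left₀ hd]⟩
  · intro hne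
    obtain ⟨z, hz, hz'⟩ := Lat.exists_not_mem_of_ne_top hne
    have hz1 := Lat.vl_eq_one_of_not_mem _ hz hz'
    refine ⟨φ.toFun z⁻¹, (φ.ne_zero_iff (vl_inv hz1).le).2 (vl_inv hz1), fun y hy => ?_⟩
    obtain ⟨x, hx, rfl⟩ := φ.surj y
    have hle : vl hp P x ≤ vl hp P z := not_lt.1 fun hc => hz' <|
      (φ.latIso h N).mem_of_vl_le h.le (show x ∈ (φ.latIso h N).1 from ⟨hx, hy⟩) hc.le
    rw [← φ.map_mul _ _ (vl_inv hz1).le hx, φ.mem_range_iff]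
    · have hz0 : vl hp P z ≠ 0 := (Valuation.ne_zero_iff _).2 (ne_zero_of_vl_eq_one hz1)
      rw [_root_.map_mul, map_inv₀]
      exact (inv_mul_le_one₀ (zero_lt_iff.2 hz0)).2 hle
    · rw [_root_.map_mul, vl_inv hz1, one_mul]
      exact hx

theorem latIso_scl {g : K} (hg : vl hp Q g = 1) (N : NzMod A F)
    (hN : φ.toFun g ≠ 0) :
    φ.latIso h ⟨scl (φ.toFun g) N.1, scl_ne_bot hN N.2⟩ =
      latAct hp Q _ ⟨g, hg⟩ (φ.latIso h N) := by
  refine Subtype.ext (Submodule.ext fun x => ?_)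
  have h1 : vl hp Q (g⁻¹ * x) = vl hp Q x := by rw [_root_.map_mul, vl_inv hg, one_mul]
  rw [latAct_coe, mem_scl, mem_latIso, mem_latIso, h1]
  refine and_congr_right fun hx => ?_
  rw [mem_scl, φ.map_mul _ _ (vl_inv hg).le hx, φ.map_inv hg]

/-- Nonzero fractional ideals correspond to proper modules over `Q`. -/
def fracIso : NzFrac A F ≃o
    ProdOn ({Set.univ} : Set (Set Unit)) (fun _ => Lat hp Q P.asIdeal.primeCompl) where
  toFun N := ⟨fun _ => φ.latIso h ⟨N.1, N.2.1⟩,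
    Set.eq_univ_iff_forall.2 fun _ => (φ.frac_iff_ne_top h _).1 N.2.2⟩
  invFun J := ⟨((φ.latIso h).symm (J.1 ())).1, ((φ.latIso h).symm (J.1 ())).2,
    (φ.frac_iff_ne_top h _).2 <| by
      rw [OrderIso.apply_symm_apply]
      exact Set.eq_univ_iff_forall.1 J.2 ()⟩
  left_inv N := Subtype.ext <| by
    change ((φ.latIso h).symm (φ.latIso h ⟨N.1, N.2.1⟩)).1 = N.1
    rw [OrderIso.symm_apply_apply]
  right_inv J := Subtype.ext <| funext fun _ => (φ.latIso h).apply_symm_apply (J.1 ())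
  map_rel_iff' := ⟨fun hle => (φ.latIso h).le_iff_le.1 (hle ()),
    fun hle _ => (φ.latIso h).le_iff_le.2 hle⟩

include h in
theorem mid_primeCompl : Mid Q P P.asIdeal.primeCompl :=
  ⟨h, fun _ hd => not_mem_of_mem_oneAdd le_rfl hd, fun _ hd => hd⟩

/-- The closure operators on nonzero fractional ideals in terms of modules over `Q`. -/
def cloFracIso : Clo (fracAct A F) ≃o
    Clo (haveI : GoodAct (latAct hp Q P.asIdeal.primeCompl) := goodAct_lat (mid_primeCompl h)
      prodAct ({Set.univ} : Set (Set Unit)) fun _ => latAct hp Q P.asIdeal.primeCompl) :=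
  Clo.congr (φ.fracIso h)
    (fun g => by
      obtain ⟨x, hx, hxg⟩ := φ.surj g.1
      have hx1 : vl hp Q x = 1 := (φ.ne_zero_iff hx).1 (hxg ▸ g.2)
      refine ⟨fun _ => ⟨x, hx1⟩, fun J => Subtype.ext <| funext fun i => ?_⟩
      refine Eq.trans ?_ (φ.latIso_scl h hx1 ⟨J.1, J.2.1⟩ (hxg ▸ g.2))
      refine congrArg (φ.latIso h) (Subtype.ext ?_)
      change scl g.1 J.1 = scl (φ.toFun x) J.1
      rw [hxg])
    (fun g => ⟨⟨φ.toFun (g ()).1, (φ.ne_zero_iff (g ()).2.le).2 (g ()).2⟩, fun J =>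
      Subtype.ext <| funext fun i => φ.latIso_scl h (g ()).2 ⟨J.1, J.2.1⟩
        ((φ.ne_zero_iff (g ()).2.le).2 (g ()).2)⟩)

/-- The closure operators on nonzero fractional ideals are the proper ones on modules over `Q`. -/
def cloFracEquiv : Clo (fracAct A F) ≃o
    ∀ _ : Unit, {c : Clo (latAct hp Q P.asIdeal.primeCompl) // c ≠ ⊤} :=
  haveI : GoodAct (latAct hp Q P.asIdeal.primeCompl) := goodAct_lat (mid_primeCompl h)
  (φ.cloFracIso h).trans <|
    (Fam.isoClo {Set.univ} fun _ : Unit => latAct hp Q P.asIdeal.primeCompl).symm.trans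
      (Fam.isoProper _)

theorem cloFracEquiv_closes (c : Clo (fracAct A F)) :
    c.toFun (fracOne A F) = fracOne A F ↔ Closes (φ.cloFracEquiv h c ()).1 := by
  have hgood : GoodAct (latAct hp Q P.asIdeal.primeCompl) := goodAct_lat (mid_primeCompl h)
  obtain ⟨G, hG⟩ := (Fam.isoClo {Set.univ} fun _ : Unit =>
    latAct hp Q P.asIdeal.primeCompl).surjective (φ.cloFracIso h c)
  have h1 : φ.cloFracEquiv h c = Fam.isoProper _ G := by
    simp only [cloFracEquiv, OrderIso.trans_apply]
    rw [← hG, OrderIso.symm_apply_apply]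
  rw [h1]
  have hT : ((φ.fracIso h (fracOne A F)).1 ()).1 = locS K P.asIdeal.primeCompl := by
    rw [locS_primeCompl hp P]
    ext x
    change (vl hp Q x ≤ 1 ∧ φ.toFun x ∈ (1 : Submodule A F)) ↔ vl hp P x ≤ 1
    rw [Submodule.mem_one]
    exact ⟨fun hx => (φ.mem_range_iff x hx.1).1 hx.2, fun hx =>
      ⟨vl_le_one_of_le hp h.le hx, (φ.mem_range_iff x (vl_le_one_of_le hp h.le hx)).2 hx⟩⟩
  have h2 : (φ.cloFracIso h c).toFun (φ.fracIso h (fracOne A F)) =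
      φ.fracIso h (c.toFun (fracOne A F)) := by
    unfold cloFracIso
    exact Clo.congr_toFun _ _ _ _ _
  rw [← (φ.fracIso h).injective.eq_iff, ← h2, ← hG, Subtype.ext_iff, funext_iff]
  have h3 : (((Fam.isoClo {Set.univ} fun _ : Unit => latAct hp Q P.asIdeal.primeCompl) G).toFun
      (φ.fracIso h (fracOne A F))).1 () =
      ((Fam.isoProper _ G) ()).1.toFun ((φ.fracIso h (fracOne A F)).1 ()) := by
    change (G.1 ⟨_, (φ.fracIso h (fracOne A F)).2⟩ ()).toFun _ = (G.1 ⟨Set.univ, rfl⟩ ()).toFun _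
    have : (⟨_, (φ.fracIso h (fracOne A F)).2⟩ : ({Set.univ} : Set (Set Unit))) =
        ⟨Set.univ, rfl⟩ := Subtype.ext (φ.fracIso h (fracOne A F)).2
    rw [this]
  constructor
  · intro h4 J hJ
    have : J = (φ.fracIso h (fracOne A F)).1 () := Subtype.ext (hJ.trans hT.symm)
    rw [this, ← h3, h4]
  · intro h4 _
    rw [h3]
    exact h4 _ hT

end ResidueMap

end Residue

/-! ### Counting abstract star operations -/

section Abstract

variable (A : Type*) [CommRing A] [IsDomain A]

/-- Fractional ideals in the two descriptions. -/
def fracIdealIso : FractionalIdeal (nonZeroDivisors A) (FractionRing A) ≃o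
    {I : Submodule A (FractionRing A) // IsFracOf A (FractionRing A) ⊥ I} where
  toFun I := ⟨I.1, isFracOf_bot_iff.2 <| by
    obtain ⟨a, ha, h⟩ := I.2
    refine ⟨algebraMap A _ a, (map_ne_zero_iff _ (IsFractionRing.injective A _)).2
      (nonZeroDivisors.ne_zero ha), fun x hx => ?_⟩
    obtain ⟨r, hr⟩ := h x hx
    exact ⟨r, by rw [hr, Algebra.smul_def]⟩⟩
  invFun I := ⟨I.1, by
    obtain ⟨d, hd, h⟩ := isFracOf_bot_iff.1 I.2
    obtain ⟨a, b, hb, rfl⟩ := IsFractionRing.div_surjective (A := A) d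
    have hb0 : algebraMap A (FractionRing A) b ≠ 0 :=
      (map_ne_zero_iff _ (IsFractionRing.injective A _)).2 (nonZeroDivisors.ne_zero hb)
    have ha0 : a ≠ 0 := by rintro rfl; simp at hd
    refine ⟨a, mem_nonZeroDivisors_of_ne_zero ha0, fun x hx => ?_⟩
    obtain ⟨r, hr⟩ := h x hx
    refine ⟨b * r, ?_⟩
    rw [map_mul, hr, Algebra.smul_def]
    field_simp⟩
  left_inv _ := rfl
  right_inv _ := rfl
  map_rel_iff' := Iff.rfl

theorem fracIdealIso_span_mul (x : FractionRing A)
    (I : FractionalIdeal (nonZeroDivisors A) (FractionRing A)) :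
    (fracIdealIso A (FractionalIdeal.spanSingleton (nonZeroDivisors A) x * I)).1 =
      Submodule.span A {x} * (fracIdealIso A I).1 := by
  change ((FractionalIdeal.spanSingleton (nonZeroDivisors A) x * I :
    FractionalIdeal (nonZeroDivisors A) (FractionRing A)) : Submodule A (FractionRing A)) = _
  rw [FractionalIdeal.coe_mul, FractionalIdeal.coe_spanSingleton]
  rfl

/-- Abstract fractional star operations are the fractional star operations. -/
def aFracStarEquiv : AFracStar A ≃ FracStar A (FractionRing A) ⊥ where
  toFun s :=
    { toFun := fun I => fracIdealIso A (s.toFun ((fracIdealIso A).symm I))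
      le_star' := fun I => s.le_star' ((fracIdealIso A).symm I)
      mono' := fun I J h => s.mono' (show (fracIdealIso A).symm I ≤ (fracIdealIso A).symm J from h)
      idem' := fun I => by rw [OrderIso.symm_apply_apply, s.idem']
      smul' := fun x hx I J hJ => by
        have : (fracIdealIso A).symm J =
            FractionalIdeal.spanSingleton (nonZeroDivisors A) x * (fracIdealIso A).symm I := by
          rw [OrderIso.symm_apply_eq]
          refine Subtype.ext ?_
          rw [fracIdealIso_span_mul, OrderIso.apply_symm_apply, hJ]
        rw [this, s.smul' x hx, fracIdealIso_span_mul] }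
  invFun s :=
    { toFun := fun I => (fracIdealIso A).symm (s.toFun (fracIdealIso A I))
      le_star' := fun I => s.le_star' (fracIdealIso A I)
      mono' := fun I J h => s.mono' (fracIdealIso A I) (fracIdealIso A J) h
      idem' := fun I => by rw [OrderIso.apply_symm_apply, s.idem']
      smul' := fun x hx I => by
        rw [OrderIso.symm_apply_eq]
        refine Subtype.ext ?_
        rw [fracIdealIso_span_mul, OrderIso.apply_symm_apply]
        exact s.smul' x hx _ _ (fracIdealIso_span_mul A x I) }
  left_inv s := AFracStar.ext' (funext fun I => by simp)
  right_inv s := FracStar.ext' (funext fun I => by simp)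

theorem isStarOp_aFracStarEquiv (s : AFracStar A) :
    FracStar.IsStarOp A (FractionRing A) (aFracStarEquiv A s) ↔ s.toFun 1 = 1 := by
  have h1 : (fracIdealIso A 1).1 = Subalgebra.toSubmodule ⊥ := by
    change ((1 : FractionalIdeal (nonZeroDivisors A) (FractionRing A)) :
      Submodule A (FractionRing A)) = _
    rw [FractionalIdeal.coe_one, Algebra.toSubmodule_bot]
  have h2 (h : IsFracOf A (FractionRing A) ⊥ (Subalgebra.toSubmodule ⊥)) :
      (⟨_, h⟩ : {I : Submodule A (FractionRing A) // IsFracOf A (FractionRing A) ⊥ I}) =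
        fracIdealIso A 1 := Subtype.ext h1.symm
  have h3 : (aFracStarEquiv A s).toFun (fracIdealIso A 1) = fracIdealIso A (s.toFun 1) := by
    simp [aFracStarEquiv]
  constructor
  · intro h
    have h4 := h (h1 ▸ (fracIdealIso A 1).2)
    rw [h2, h3, ← h1] at h4
    exact (fracIdealIso A).injective (Subtype.ext h4)
  · intro h h'
    rw [h2, h3, h, h1]

variable {A}
variable {D : Type*} [CommRing D] [IsDomain D]
variable {K : Type*} [Field K] [Algebra D K] [IsFractionRing D K]
variable {hp : IsPrufer D K} {Q P : PrimeSpectrum D}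

theorem ResidueMap.not_isMaximal_bot (φ : ResidueMap hp Q P A (FractionRing A)) (h : Q < P) :
    ¬ (⊥ : Ideal A).IsMaximal := fun hA =>
  φ.one_ne_top h ((one_eq_top_iff A (FractionRing A)).2 hA)

/-- Abstract fractional star operations of a valuation ring between two primes. -/
def ResidueMap.aFracStarEquivClo (φ : ResidueMap hp Q P A (FractionRing A)) (h : Q < P) :
    AFracStar A ≃ {c : Clo (latAct hp Q P.asIdeal.primeCompl) // c ≠ ⊤} :=
  (aFracStarEquiv A).trans <| (fracStarIso A (FractionRing A)
    (φ.not_isMaximal_bot h)).symm.toEquiv.trans <|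
      (φ.cloFracEquiv h).toEquiv.trans (Equiv.funUnique Unit _)

theorem ResidueMap.closes_aFracStarEquivClo (φ : ResidueMap hp Q P A (FractionRing A))
    (h : Q < P) (s : AFracStar A) :
    Closes (φ.aFracStarEquivClo h s).1 ↔ s.toFun 1 = 1 := by
  rw [← isStarOp_aFracStarEquiv]
  obtain ⟨c, hc⟩ := (fracStarIso A (FractionRing A) (φ.not_isMaximal_bot h)).surjective
    (aFracStarEquiv A s)
  rw [← hc, isStarOp_fracStarIso, φ.cloFracEquiv_closes h]
  have : φ.aFracStarEquivClo h s = φ.cloFracEquiv h c () := by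
    simp only [aFracStarEquivClo, Equiv.trans_apply]
    rw [← hc]
    simp
  rw [this]

theorem ne_top_of_closes {S : Submonoid D} (hm : Mid Q P S) {c : Clo (latAct hp Q S)}
    (hc : Closes c) : c ≠ ⊤ := by
  intro hct
  have h : oneAdd Q ≤ S := fun d hd => hm.le (mem_oneAdd.2 (hm.lt.le (mem_oneAdd.1 hd)))
  have h' : ∀ d ∈ S, d ∉ Q.asIdeal := fun d hd hd' => hm.not_mem d hd (hm.lt.le hd')
  have h1 : c.toFun (latT hp h h') = latT hp h h' := (closes_iff h h').1 hc
  have h2 : c.toFun (latT hp h h') = ⊤ := by rw [hct]; rfl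
  exact ne_top_of_coe_eq_locS hm (J := latT hp h h') rfl (h1.symm.trans h2)

theorem ResidueMap.card_aFracStar (φ : ResidueMap hp Q P A (FractionRing A)) (h : Q < P) :
    Nat.card (AFracStar A) = Nat.card {c : Clo (latAct hp Q P.asIdeal.primeCompl) // c ≠ ⊤} :=
  Nat.card_congr (φ.aFracStarEquivClo h)

theorem ResidueMap.card_aStar (φ : ResidueMap hp Q P A (FractionRing A)) (h : Q < P) :
    Nat.card (AStar A) =
      Nat.card {c : Clo (latAct hp Q P.asIdeal.primeCompl) // Closes c} :=
  Nat.card_congr <|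
    ((φ.aFracStarEquivClo h).subtypeEquiv fun s => (φ.closes_aFracStarEquivClo h s).symm).trans
      (Equiv.subtypeSubtypeEquivSubtype fun hc => ne_top_of_closes (ResidueMap.mid_primeCompl h) hc)

end Abstract

/-! ### Residue maps and the invariants `ω` and `ε` -/

section Residue

variable {D : Type*} [CommRing D] [IsDomain D]
variable {K : Type*} [Field K] [Algebra D K] [IsFractionRing D K]
variable {Q P : PrimeSpectrum D}

section Quot

variable {F : Type*} [Field F]

open Classical in
/-- The extension to the localization at `Q` of a ring homomorphism to a field with kernel `Q`,
extended by zero. -/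
def quotFun (K : Type*) [Field K] [Algebra D K] (Q : PrimeSpectrum D) (g : D →+* F) (x : K) : F :=
  if h : ∃ s ∉ Q.asIdeal, ∃ a, algebraMap D K s * x = algebraMap D K a then
    g h.choose_spec.2.choose / g h.choose else 0

variable {g : D →+* F}

theorem quotFun_mul (hg : ∀ a, g a = 0 ↔ a ∈ Q.asIdeal) {x : K} {s a : D} (hs : s ∉ Q.asIdeal)
    (h : algebraMap D K s * x = algebraMap D K a) : quotFun K Q g x * g s = g a := by
  have hx : ∃ s ∉ Q.asIdeal, ∃ a, algebraMap D K s * x = algebraMap D K a := ⟨s, hs, a, h⟩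
  rw [quotFun, dif_pos hx]
  have h1 := hx.choose_spec.2.choose_spec
  have h2 := hx.choose_spec.1
  set t := hx.choose
  set b := hx.choose_spec.2.choose
  have h3 : b * s = a * t := by
    apply IsFractionRing.injective D K
    rw [map_mul, map_mul, ← h1, ← h]
    ring
  have ht : g t ≠ 0 := fun h' => h2 ((hg t).1 h')
  rw [div_mul_eq_mul_div, div_eq_iff ht, ← map_mul, ← map_mul, h3]

theorem quotFun_eq_div (hg : ∀ a, g a = 0 ↔ a ∈ Q.asIdeal) {x : K} {s a : D}
    (hs : s ∉ Q.asIdeal) (h : algebraMap D K s * x = algebraMap D K a) :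
    quotFun K Q g x = g a / g s := by
  rw [eq_div_iff fun h' => hs ((hg s).1 h'), quotFun_mul hg hs h]

end Quot

variable {A : Type*} [CommRing A] [IsDomain A] {F : Type*} [Field F] [Algebra A F]
  [IsFractionRing A F]

/-- The residue map given by a presentation of `A` as a quotient of the localization at `P` by the
extension of `Q`. -/
def residueMap (hp : IsPrufer D K) (h : Q < P) (π : locRing D P.asIdeal P.isPrime →+* A)
    (hπ : Function.Surjective π)
    (hker : ∀ a : D, π (algebraMap D _ a) = 0 ↔ a ∈ Q.asIdeal) :
    ResidueMap hp Q P A F := by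
  have hA := IsFractionRing.injective A F
  let g : D →+* F := (algebraMap A F).comp (π.comp (algebraMap D (locRing D P.asIdeal P.isPrime)))
  have hg : ∀ a, g a = 0 ↔ a ∈ Q.asIdeal := fun a => by
    rw [← hker]
    exact map_eq_zero_iff _ hA
  have hg0 : ∀ {s}, s ∉ Q.asIdeal → g s ≠ 0 := fun hs h' => hs ((hg _).1 h')
  have hrange : ∀ x : K, vl hp P x ≤ 1 → ∃ α, algebraMap A F α = quotFun K Q g x := fun x hx => by
    obtain ⟨s, hs, a, hsa⟩ := (vl_le_one_iff hp P).1 hx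
    have hsQ : s ∉ Q.asIdeal := fun h' => hs (h.le h')
    refine ⟨π (Localization.mk a ⟨s, hs⟩), ?_⟩
    rw [quotFun_eq_div hg hsQ hsa, eq_div_iff (hg0 hsQ)]
    change _ * algebraMap A F (π (algebraMap D _ s)) = algebraMap A F (π (algebraMap D _ a))
    rw [← map_mul, ← map_mul, Localization.mk_eq_mk']
    exact congrArg (fun z => algebraMap A F (π z)) (IsLocalization.mk'_spec _ a
      (⟨s, hs⟩ : P.asIdeal.primeCompl))
  have hlift : ∀ α : A, ∃ x : K, vl hp P x ≤ 1 ∧ quotFun K Q g x = algebraMap A F α := fun α => by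
    obtain ⟨z, rfl⟩ := hπ α
    obtain ⟨a, s, rfl⟩ := IsLocalization.exists_mk'_eq P.asIdeal.primeCompl z
    have hs0 : algebraMap D K s.1 ≠ 0 :=
      ne_zero_of_vl_eq_one ((vl_algebraMap_eq_one hp P).2 s.2)
    have hsx : algebraMap D K s.1 * (algebraMap D K a / algebraMap D K s.1) = algebraMap D K a := by
      field_simp
    have hsQ : s.1 ∉ Q.asIdeal := fun h' => s.2 (h.le h')
    refine ⟨algebraMap D K a / algebraMap D K s.1, (vl_le_one_iff hp P).2 ⟨s.1, s.2, a, hsx⟩, ?_⟩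
    rw [quotFun_eq_div hg hsQ hsx, div_eq_iff (hg0 hsQ)]
    change algebraMap A F (π (algebraMap D _ a)) = _ * algebraMap A F (π (algebraMap D _ s.1))
    rw [← map_mul, ← map_mul, IsLocalization.mk'_spec]
  have hadd : ∀ x y : K, vl hp Q x ≤ 1 → vl hp Q y ≤ 1 →
      quotFun K Q g (x + y) = quotFun K Q g x + quotFun K Q g y := fun x y hx hy => by
    obtain ⟨s, hs, a, hsa⟩ := (vl_le_one_iff hp Q).1 hx
    obtain ⟨t, ht, b, htb⟩ := (vl_le_one_iff hp Q).1 hy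
    have hst : s * t ∉ Q.asIdeal := Q.asIdeal.primeCompl.mul_mem hs ht
    have : algebraMap D K (s * t) * (x + y) = algebraMap D K (a * t + b * s) := by
      simp only [map_add, map_mul, ← hsa, ← htb]
      ring
    rw [quotFun_eq_div hg hst this, quotFun_eq_div hg hs hsa, quotFun_eq_div hg ht htb, map_add,
      map_mul, map_mul, map_mul]
    have := hg0 hs
    have := hg0 ht
    field_simp
  have hmul : ∀ x y : K, vl hp Q x ≤ 1 → vl hp Q y ≤ 1 →
      quotFun K Q g (x * y) = quotFun K Q g x * quotFun K Q g y := fun x y hx hy => by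
    obtain ⟨s, hs, a, hsa⟩ := (vl_le_one_iff hp Q).1 hx
    obtain ⟨t, ht, b, htb⟩ := (vl_le_one_iff hp Q).1 hy
    have hst : s * t ∉ Q.asIdeal := Q.asIdeal.primeCompl.mul_mem hs ht
    have : algebraMap D K (s * t) * (x * y) = algebraMap D K (a * b) := by
      simp only [map_mul, ← hsa, ← htb]
      ring
    rw [quotFun_eq_div hg hst this, quotFun_eq_div hg hs hsa, quotFun_eq_div hg ht htb,
      map_mul, map_mul]
    have := hg0 hs
    have := hg0 ht
    field_simp
  have hzero : ∀ x : K, vl hp Q x ≤ 1 → (quotFun K Q g x = 0 ↔ vl hp Q x < 1) := fun x hx => by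
    obtain ⟨s, hs, a, hsa⟩ := (vl_le_one_iff hp Q).1 hx
    rw [quotFun_eq_div hg hs hsa, div_eq_zero_iff, or_iff_left (hg0 hs), hg,
      ← vl_algebraMap_lt_one hp Q, ← hsa, map_mul, (vl_algebraMap_eq_one hp Q).2 hs, one_mul]
  refine ⟨quotFun K Q g, hadd, hmul, hzero, fun y => ?_, fun x hx => ⟨?_, hrange x⟩⟩
  · obtain ⟨α, β, hβ, rfl⟩ := IsFractionRing.div_surjective (A := A) y
    obtain ⟨x, hx, hxα⟩ := hlift α
    obtain ⟨z, hz, hzβ⟩ := hlift β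
    have hβ0 : algebraMap A F β ≠ 0 := IsFractionRing.to_map_ne_zero_of_mem_nonZeroDivisors hβ
    have hx' := vl_le_one_of_le hp h.le hx
    have hz' := vl_le_one_of_le hp h.le hz
    have hz1 : vl hp Q z = 1 := le_antisymm hz' <| not_lt.1 fun h' =>
      hβ0 (by rw [← hzβ]; exact (hzero z hz').2 h')
    have hxz : vl hp Q (x / z) ≤ 1 := by rwa [map_div₀, hz1, div_one]
    refine ⟨x / z, hxz, ?_⟩
    rw [eq_div_iff hβ0, ← hxα, ← hzβ, ← hmul _ _ hxz hz',
      div_mul_cancel₀ _ (ne_zero_of_vl_eq_one hz1)]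
  · rintro ⟨α, hα⟩
    obtain ⟨z, hz, hzα⟩ := hlift α
    have hz' := vl_le_one_of_le hp h.le hz
    have hxz : vl hp Q (x - z) ≤ 1 := ((vl hp Q).map_sub x z).trans (max_le hx hz')
    have h1 : vl hp Q (x - z) < 1 := by
      rw [← hzero _ hxz]
      have := hadd (x - z) z hxz hz'
      rw [sub_add_cancel, hzα, hα] at this
      exact add_eq_right.1 this.symm
    have h2 : vl hp P (x - z) ≤ 1 := (vl_lt_one_of_le hp h.le h1).le
    calc vl hp P x = vl hp P ((x - z) + z) := by rw [sub_add_cancel]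
      _ ≤ max (vl hp P (x - z)) (vl hp P z) := (vl hp P).map_add _ _
      _ ≤ 1 := max_le h2 hz

theorem card_aStar_eq_of_surjective (hp : IsPrufer D K) (h : Q < P)
    (π : locRing D P.asIdeal P.isPrime →+* A) (hπ : Function.Surjective π)
    (hker : ∀ a : D, π (algebraMap D _ a) = 0 ↔ a ∈ Q.asIdeal) :
    Nat.card (AStar A) = Nat.card {c : Clo (latAct hp Q P.asIdeal.primeCompl) // Closes c} :=
  (residueMap (F := FractionRing A) hp h π hπ hker).card_aStar h

theorem card_clo_eq_omegaAt_add_one (hp : IsPrufer D K) (hdim : ringKrullDim D < ⊤) (h : Q < P) :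
    Nat.card (Clo (latAct hp Q P.asIdeal.primeCompl)) =
      omegaAt D P.asIdeal Q.asIdeal P.isPrime + 1 := by
  have hdisj : Disjoint (P.asIdeal.primeCompl : Set D) (Q.asIdeal : Set D) :=
    Set.disjoint_left.2 fun s hs hs' => hs (h.le hs')
  have hprime := IsLocalization.isPrime_of_isPrime_disjoint P.asIdeal.primeCompl
    (locRing D P.asIdeal P.isPrime) Q.asIdeal Q.isPrime hdisj
  have : IsDomain (Zring D P.asIdeal Q.asIdeal P.isPrime) := Ideal.Quotient.isDomain _
  have hker : ∀ a : D, Ideal.Quotient.mk (Ideal.map (algebraMap D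
      (locRing D P.asIdeal P.isPrime)) Q.asIdeal) (algebraMap D _ a) = 0 ↔ a ∈ Q.asIdeal := by
    intro a
    rw [Ideal.Quotient.eq_zero_iff_mem]
    exact SetLike.ext_iff.1 (IsLocalization.under_map_of_isPrime_disjoint P.asIdeal.primeCompl
      (locRing D P.asIdeal P.isPrime) Q.isPrime hdisj) a
  let φ : ResidueMap hp Q P (Zring D P.asIdeal Q.asIdeal P.isPrime)
      (FractionRing (Zring D P.asIdeal Q.asIdeal P.isPrime)) :=
    residueMap hp h (Ideal.Quotient.mk _) Ideal.Quotient.mk_surjective hker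
  have := finite_clo (hp := hp) hdim h.le
  have h1 : omegaAt D P.asIdeal Q.asIdeal P.isPrime =
      Nat.card {c : Clo (latAct hp Q P.asIdeal.primeCompl) // c ≠ ⊤} := φ.card_aFracStar h
  rw [h1, ← Finite.card_option]
  classical
  exact Nat.card_congr (Equiv.optionSubtypeNe (⊤ : Clo (latAct hp Q P.asIdeal.primeCompl))).symm

theorem card_closers_eq_epsilonOf (hp : IsPrufer D K) (h : Q < P) :
    Nat.card {c : Clo (latAct hp Q P.asIdeal.primeCompl) // Closes c} =
      epsilonOf D P.asIdeal := by
  have key : ∀ h0 : ⊥ < P, Nat.card {c : Clo (latAct hp ⊥ P.asIdeal.primeCompl) // Closes c} =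
      epsilonOf D P.asIdeal := by
    intro h0
    have : IsDomain (locRing D P.asIdeal P.isPrime) :=
      IsLocalization.isDomain_localization P.asIdeal.primeCompl_le_nonZeroDivisors
    rw [epsilonOf, dif_pos P.isPrime]
    refine (card_aStar_eq_of_surjective hp h0 (RingHom.id _) Function.surjective_id
      fun a => ?_).symm
    exact map_eq_zero_iff _ (IsLocalization.injective
      (locRing D P.asIdeal P.isPrime) P.asIdeal.primeCompl_le_nonZeroDivisors)
  rw [← key (bot_le.trans_lt h)]
  rcases eq_bot_or_bot_lt Q with rfl | hQ
  · rfl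
  · have hm : Mid ⊥ Q P.asIdeal.primeCompl :=
      ⟨hQ, fun d hd => not_mem_of_mem_oneAdd le_rfl (oneAdd_le h.le hd),
        fun d hd hd' => hd (h.le hd')⟩
    have hne : locS K P.asIdeal.primeCompl ≠ oP hp Q := by
      rw [locS_primeCompl hp P]
      obtain ⟨z, hz, hz'⟩ := exists_not_mem_oP (hp := hp) h
      exact fun h' => hz' (h' ▸ hz)
    exact (closersExt hm hne).elim fun e => Nat.card_congr e.toEquiv

end Residue

/-! ### The tree of branching points -/

section Tree

variable {D : Type*} [CommRing D] [IsDomain D]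
variable {K : Type*} [Field K] [Algebra D K] [IsFractionRing D K]

/-- An element of `hiSpec D` as a point of the spectrum. -/
def hiPrime (P : ↥(hiSpec D)) : PrimeSpectrum D := ⟨P.1, P.2.1⟩

theorem hiPrime_lt {P Q : ↥(hiSpec D)} : hiPrime P < hiPrime Q ↔ P < Q := Iff.rfl

theorem hiPrime_le {P Q : ↥(hiSpec D)} : hiPrime P ≤ hiPrime Q ↔ P ≤ Q := Iff.rfl

theorem hiPrime_injective : Function.Injective (hiPrime : ↥(hiSpec D) → PrimeSpectrum D) :=
  fun _ _ h => Subtype.ext (congrArg PrimeSpectrum.asIdeal h)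

theorem finite_hiSpec (hp : IsPrufer D K) (hsl : IsSemilocal D) (hdim : ringKrullDim D < ⊤) :
    Finite ↥(hiSpec D) :=
  have := finite_primeSpectrum hp hsl hdim
  Finite.of_injective _ hiPrime_injective

/-- The zero ideal as an element of `hiSpec D`. -/
def hiBot (D : Type*) [CommRing D] [IsDomain D] : ↥(hiSpec D) := ⟨⊥, Ideal.isPrime_bot, Or.inl rfl⟩

theorem hiBot_le (P : ↥(hiSpec D)) : hiBot D ≤ P := bot_le (a := P.1)

theorem hiPrime_hiBot : hiPrime (hiBot D) = ⊥ := rfl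

theorem isMax_iff_isMaximal {P : ↥(hiSpec D)} : IsMax P ↔ P.1.IsMaximal := by
  constructor
  · intro h
    obtain ⟨M, hM, hle⟩ := P.1.exists_le_maximal P.2.1.ne_top
    have : M ≤ P.1 := h (b := ⟨M, maximal_mem_hiSpec hM⟩) hle
    exact le_antisymm hle this ▸ hM
  · intro h Q hQ
    exact (h.eq_of_le Q.2.1.ne_top hQ).ge

theorem directlyBelow_iff_covBy {Q P : ↥(hiSpec D)} : DirectlyBelow D Q.1 P.1 ↔ Q ⋖ P :=
  ⟨fun h => ⟨h.2.2.1, fun R h1 h2 => h.2.2.2 R.1 R.2 h1 h2⟩,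
    fun h => ⟨Q.2, P.2, h.1, fun R hR h1 h2 => h.2 (c := ⟨R, hR⟩) h1 h2⟩⟩

/-- The largest prime ideal contained in two incomparable prime ideals is a branching point. -/
theorem exists_hiSpec_isGreatest (hp : IsPrufer D K) [Finite (PrimeSpectrum D)]
    {Q Q' : PrimeSpectrum D} (h : ¬ Q ≤ Q') (h' : ¬ Q' ≤ Q) :
    ∃ R : ↥(hiSpec D), hiPrime R ≤ Q ∧ hiPrime R ≤ Q' ∧
      ∀ P : PrimeSpectrum D, P ≤ Q → P ≤ Q' → P ≤ hiPrime R := by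
  obtain ⟨R, ⟨hR, hR'⟩, hmax⟩ :=
    (Set.toFinite {P : PrimeSpectrum D | P ≤ Q ∧ P ≤ Q'}).exists_maximal ⟨⊥, bot_le, bot_le⟩
  have key : ∀ P : PrimeSpectrum D, P ≤ Q → P ≤ Q' → P ≤ R := fun P hP hP' =>
    (le_total_of_le hp hP hR).elim id fun hle => hmax ⟨hP, hP'⟩ hle
  refine ⟨⟨R.asIdeal, R.isPrime, Or.inr (Or.inr ⟨{Q.asIdeal, Q'.asIdeal}, ?_, ?_, ?_, ?_, ?_⟩)⟩,
    hR, hR', key⟩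
  · rintro _ (rfl | rfl)
    exacts [Q.isPrime, Q'.isPrime]
  · exact Set.pairwise_pair.2 fun _ => ⟨⟨h, h'⟩, ⟨h', h⟩⟩
  · rintro (h1 | h1)
    · exact h (show Q.asIdeal ≤ Q'.asIdeal from h1 ▸ hR')
    · exact h' (show Q'.asIdeal ≤ Q.asIdeal from h1 ▸ hR)
  · rintro _ (rfl | rfl)
    exacts [hR, hR']
  · intro P hP hle
    exact key ⟨P, hP⟩ (hle _ (Or.inl rfl)) (hle _ (Or.inr rfl))

theorem kids_of_covBy (hp : IsPrufer D K) [Finite (PrimeSpectrum D)] {ι : Type*}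
    {P : ↥(hiSpec D)} {p : ι → ↥(hiSpec D)} (hinj : Function.Injective p)
    (hpι : ∀ R, P ⋖ R ↔ ∃ i, p i = R) : Kids (hiPrime P) fun i => hiPrime (p i) where
  lt i := ((hpι _).2 ⟨i, rfl⟩).lt
  exists_le M hM hPM := by
    have : Finite ↥(hiSpec D) := Finite.of_injective _ hiPrime_injective
    obtain ⟨R, ⟨hR, hR'⟩, hmin⟩ :=
      (Set.toFinite {R : ↥(hiSpec D) | P < R ∧ hiPrime R ≤ M}).exists_minimal ⟨⟨M.asIdeal, maximal_mem_hiSpec hM⟩, hPM, le_rfl⟩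
    obtain ⟨i, rfl⟩ := (hpι R).1 ⟨hR, fun c hc hcR =>
      (hmin ⟨hc, (hiPrime_le.2 hcR.le).trans hR'⟩ hcR.le).not_gt hcR⟩
    exact ⟨i, hR'⟩
  le_of_le i j hij Q hQi hQj := by
    have hi := (hpι (p i)).2 ⟨i, rfl⟩
    have hj := (hpι (p j)).2 ⟨j, rfl⟩
    have hne : p i ≠ p j := fun h => hij (hinj h)
    have h : ¬ hiPrime (p i) ≤ hiPrime (p j) := fun h => hj.2 hi.1 (lt_of_le_of_ne h hne)
    have h' : ¬ hiPrime (p j) ≤ hiPrime (p i) := fun h => hi.2 hj.1 (lt_of_le_of_ne h hne.symm)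
    obtain ⟨R, hRi, hRj, hR⟩ := exists_hiSpec_isGreatest hp h h'
    have hPR : P ≤ R := hR (hiPrime P) hi.1.le hj.1.le
    have hRi' : R < p i := lt_of_le_of_ne hRi fun h1 => h (h1 ▸ hRj)
    have : P = R := hPR.eq_of_not_lt fun h1 => hi.2 h1 hRi'
    exact this ▸ hR Q hQi hQj

end Tree

section Compare

variable {D₁ : Type*} [CommRing D₁] [IsDomain D₁]
variable {K₁ : Type*} [Field K₁] [Algebra D₁ K₁] [IsFractionRing D₁ K₁]
variable {D₂ : Type*} [CommRing D₂] [IsDomain D₂]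
variable {K₂ : Type*} [Field K₂] [Algebra D₂ K₂] [IsFractionRing D₂ K₂]
variable (ν : ↥(hiSpec D₁) ≃o ↥(hiSpec D₂))

theorem map_hiBot : ν (hiBot D₁) = hiBot D₂ :=
  le_antisymm (by rw [← ν.apply_symm_apply (hiBot D₂), ν.le_iff_le]; exact hiBot_le _) (hiBot_le _)

theorem isMaximal_map_iff (P : ↥(hiSpec D₁)) : P.1.IsMaximal ↔ (ν P).1.IsMaximal := by
  rw [← isMax_iff_isMaximal, ← isMax_iff_isMaximal, ν.isMax_apply]

include ν in
theorem isMaximal_bot_iff : (⊥ : Ideal D₁).IsMaximal ↔ (⊥ : Ideal D₂).IsMaximal := by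
  have := isMaximal_map_iff ν (hiBot D₁)
  rwa [map_hiBot ν] at this

theorem kids_map (hp₁ : IsPrufer D₁ K₁) [Finite (PrimeSpectrum D₁)] (P : ↥(hiSpec D₁)) :
    Kids (hiPrime P) fun R : {R : ↥(hiSpec D₁) // P ⋖ R} => hiPrime R.1 :=
  kids_of_covBy hp₁ Subtype.val_injective fun R =>
    ⟨fun h => ⟨⟨R, h⟩, rfl⟩, by rintro ⟨i, rfl⟩; exact i.2⟩

theorem kids_map' (hp₂ : IsPrufer D₂ K₂) [Finite (PrimeSpectrum D₂)] (P : ↥(hiSpec D₁)) :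
    Kids (hiPrime (ν P)) fun R : {R : ↥(hiSpec D₁) // P ⋖ R} => hiPrime (ν R.1) := by
  refine kids_of_covBy hp₂ (p := fun R : {R : ↥(hiSpec D₁) // P ⋖ R} => ν R.1)
    (ν.injective.comp Subtype.val_injective) fun R => ⟨fun h => ?_, ?_⟩
  · refine ⟨⟨ν.symm R, ?_⟩, ν.apply_symm_apply R⟩
    rwa [← apply_covBy_apply_iff ν, ν.apply_symm_apply]
  · rintro ⟨i, rfl⟩
    exact (apply_covBy_apply_iff ν).2 i.2

variable {ν} {hp₁ : IsPrufer D₁ K₁} {hp₂ : IsPrufer D₂ K₂}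

theorem card_closers_eq (hp₁ : IsPrufer D₁ K₁) (hp₂ : IsPrufer D₂ K₂)
    (hε : ∀ (M : Ideal D₁) (hM : M.IsMaximal),
      epsilonOf D₁ M = epsilonOf D₂ (ν ⟨M, maximal_mem_hiSpec hM⟩).1)
    {P R : ↥(hiSpec D₁)} (h : P < R) (hR : R.1.IsMaximal) :
    Nat.card {c : Clo (latAct hp₁ (hiPrime P) (hiPrime R).asIdeal.primeCompl) // Closes c} =
      Nat.card {c : Clo (latAct hp₂ (hiPrime (ν P)) (hiPrime (ν R)).asIdeal.primeCompl) //
        Closes c} := by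
  rw [card_closers_eq_epsilonOf hp₁ (hiPrime_lt.2 h),
    card_closers_eq_epsilonOf hp₂ (hiPrime_lt.2 (ν.lt_iff_lt.2 h))]
  exact hε R.1 hR

theorem matches_of_covBy (hd₁ : ringKrullDim D₁ < ⊤) (hd₂ : ringKrullDim D₂ < ⊤)
    (hε : ∀ (M : Ideal D₁) (hM : M.IsMaximal),
      epsilonOf D₁ M = epsilonOf D₂ (ν ⟨M, maximal_mem_hiSpec hM⟩).1)
    {P R : ↥(hiSpec D₁)} (h : P ⋖ R)
    (hω : omegaAt D₁ R.1 P.1 (mem_hiSpec_prime R.2) =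
      omegaAt D₂ (ν R).1 (ν P).1 (mem_hiSpec_prime (ν R).2))
    (hm : Matches hp₁ hp₂ (hiPrime R) (oneAdd (hiPrime R)) (hiPrime (ν R))
      (oneAdd (hiPrime (ν R)))) :
    Matches hp₁ hp₂ (hiPrime P) (oneAdd (hiPrime R)) (hiPrime (ν P)) (oneAdd (hiPrime (ν R))) := by
  have h₁ := hiPrime_lt.2 h.lt
  have h₂ := hiPrime_lt.2 (ν.lt_iff_lt.2 h.lt)
  refine hm.extend hd₁ hd₂ h₁ h₂ (isMaximal_map_iff ν R) ?_ (card_closers_eq hp₁ hp₂ hε h.lt)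
  rw [card_clo_eq_omegaAt_add_one hp₁ hd₁ h₁, card_clo_eq_omegaAt_add_one hp₂ hd₂ h₂]
  exact congrArg (· + 1) hω

theorem matches_of_omega_eq (hsl₁ : IsSemilocal D₁) (hd₁ : ringKrullDim D₁ < ⊤)
    (hsl₂ : IsSemilocal D₂) (hd₂ : ringKrullDim D₂ < ⊤)
    (hε : ∀ (M : Ideal D₁) (hM : M.IsMaximal),
      epsilonOf D₁ M = epsilonOf D₂ (ν ⟨M, maximal_mem_hiSpec hM⟩).1)
    (P : ↥(hiSpec D₁))
    (hω : ∀ Q R : ↥(hiSpec D₁), P ≤ Q → Q ⋖ R → omegaAt D₁ R.1 Q.1 (mem_hiSpec_prime R.2) =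
      omegaAt D₂ (ν R).1 (ν Q).1 (mem_hiSpec_prime (ν R).2)) :
    Matches hp₁ hp₂ (hiPrime P) (oneAdd (hiPrime P)) (hiPrime (ν P)) (oneAdd (hiPrime (ν P))) := by
  have := finite_primeSpectrum hp₁ hsl₁ hd₁
  have := finite_primeSpectrum hp₂ hsl₂ hd₂
  have := finite_hiSpec hp₁ hsl₁ hd₁
  induction P using WellFoundedGT.induction with
  | ind P ih =>
    exact Matches.glue (kids_map hp₁ P) (kids_map' ν hp₂ P) fun R =>
      matches_of_covBy hd₁ hd₂ hε R.2 (hω P R.1 le_rfl R.2)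
        (ih R.1 R.2.lt fun Q R' h => hω Q R' (R.2.le.trans h))

/-- A product of order isomorphisms. -/
def piOrderIso {ι : Type*} {α β : ι → Type*} [∀ i, LE (α i)] [∀ i, LE (β i)]
    (e : ∀ i, α i ≃o β i) : (∀ i, α i) ≃o ∀ i, β i where
  toEquiv := Equiv.piCongrRight fun i => (e i).toEquiv
  map_rel_iff' := forall_congr' fun i => (e i).map_rel_iff

end Compare

/-! ### Semistar and star operations on two domains -/

section Star

variable {D : Type*} [CommRing D] [IsDomain D]
variable {K : Type*} [Field K] [Algebra D K] [IsFractionRing D K]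
variable {hp : IsPrufer D K} {ι : Type*} [Finite ι] {p : ι → PrimeSpectrum D}

/-- Star operations as families of closure operators. -/
def starProd (hD : ¬ (⊥ : Ideal D).IsMaximal) (hk : Kids ⊥ p) :
    {f : FracStar D K ⊥ // FracStar.IsStarOp D K f} ≃o
      ∀ i, {c : Clo (latAct hp ⊥ (oneAdd (p i))) // Closes c} where
  toFun f i := ⟨(fracStarProd hp hD hk f.1 i).1, (isStarOp_iff_closes hp hD hk f.1).1 f.2 i⟩
  invFun g := ⟨(fracStarProd hp hD hk).symm fun i =>
    ⟨(g i).1, ne_top_of_closes (mid_oneAdd (hk.lt i)) (g i).2⟩, by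
      rw [isStarOp_iff_closes hp hD hk, OrderIso.apply_symm_apply]
      exact fun i => (g i).2⟩
  left_inv f := Subtype.ext ((fracStarProd hp hD hk).symm_apply_apply f.1)
  right_inv g := by
    funext i
    apply Subtype.ext
    dsimp only
    rw [OrderIso.apply_symm_apply]
  map_rel_iff' {f g} := (fracStarProd hp hD hk).map_rel_iff (a := f.1) (b := g.1)

theorem finite_closers (hdim : ringKrullDim D < ⊤) {P M : PrimeSpectrum D} (h : P ≤ M) :
    Finite {c : Clo (latAct hp P M.asIdeal.primeCompl) // Closes c} :=
  have := finite_clo (hp := hp) hdim h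
  inferInstance

end Star

section Compare

variable {D₁ : Type*} [CommRing D₁] [IsDomain D₁]
variable {K₁ : Type*} [Field K₁] [Algebra D₁ K₁] [IsFractionRing D₁ K₁]
variable {D₂ : Type*} [CommRing D₂] [IsDomain D₂]
variable {K₂ : Type*} [Field K₂] [Algebra D₂ K₂] [IsFractionRing D₂ K₂]
variable {ν : ↥(hiSpec D₁) ≃o ↥(hiSpec D₂)} {hp₁ : IsPrufer D₁ K₁} {hp₂ : IsPrufer D₂ K₂}

theorem exists_semistar_orderIso (hbot : (⊥ : Ideal D₁).IsMaximal ↔ (⊥ : Ideal D₂).IsMaximal)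
    (h : Matches hp₁ hp₂ ⊥ (oneAdd ⊥) ⊥ (oneAdd ⊥)) :
    ∃ e : Semistar D₁ K₁ ≃o Semistar D₂ K₂,
      ∀ s : Semistar D₁ K₁, s.toFun 1 = 1 ↔ (e s).toFun 1 = 1 := by
  obtain ⟨e, he⟩ := h
  refine ⟨(semistarClo hp₁).trans (e.withTopCongr.trans (semistarClo hp₂).symm), fun s => ?_⟩
  obtain ⟨c, rfl⟩ := (semistarClo hp₁).symm.surjective s
  rw [OrderIso.trans_apply, OrderIso.apply_symm_apply, OrderIso.trans_apply]
  induction c using WithTop.recTopCoe with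
  | top =>
    rw [semistarClo_symm_top_one]
    exact hbot.trans (semistarClo_symm_top_one hp₂).symm
  | coe c =>
    rw [semistarClo_symm_coe_one, he]
    exact (semistarClo_symm_coe_one hp₂ (e c)).symm

theorem exists_fracStar_orderIso_of_field (h₁ : (⊥ : Ideal D₁).IsMaximal)
    (h₂ : (⊥ : Ideal D₂).IsMaximal) (e : Semistar D₁ K₁ ≃o Semistar D₂ K₂) :
    ∃ e : FracStar D₁ K₁ ⊥ ≃o FracStar D₂ K₂ ⊥, ∀ f : FracStar D₁ K₁ ⊥,
      FracStar.IsStarOp D₁ K₁ f ↔ FracStar.IsStarOp D₂ K₂ (e f) :=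
  ⟨(fracStarIsoSemistar D₁ K₁ h₁).trans (e.trans (fracStarIsoSemistar D₂ K₂ h₂).symm),
    fun f => ⟨fun _ => isStarOp_of_isMaximal_bot D₂ K₂ h₂ _,
      fun _ => isStarOp_of_isMaximal_bot D₁ K₁ h₁ f⟩⟩

theorem exists_fracStar_orderIso {ι : Type*} [Finite ι] {p₁ : ι → PrimeSpectrum D₁}
    {p₂ : ι → PrimeSpectrum D₂} (h₁ : ¬ (⊥ : Ideal D₁).IsMaximal)
    (h₂ : ¬ (⊥ : Ideal D₂).IsMaximal) (hk₁ : Kids ⊥ p₁) (hk₂ : Kids ⊥ p₂)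
    (h : ∀ i, Matches hp₁ hp₂ ⊥ (oneAdd (p₁ i)) ⊥ (oneAdd (p₂ i))) :
    ∃ e : FracStar D₁ K₁ ⊥ ≃o FracStar D₂ K₂ ⊥, ∀ f : FracStar D₁ K₁ ⊥,
      FracStar.IsStarOp D₁ K₁ f ↔ FracStar.IsStarOp D₂ K₂ (e f) := by
  choose e he using h
  refine ⟨(fracStarProd hp₁ h₁ hk₁).trans ((piOrderIso fun i => neTopOrderIso (e i)).trans
    (fracStarProd hp₂ h₂ hk₂).symm), fun f => ?_⟩
  rw [isStarOp_iff_closes hp₁ h₁ hk₁, isStarOp_iff_closes hp₂ h₂ hk₂, OrderIso.trans_apply,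
    OrderIso.trans_apply, OrderIso.apply_symm_apply]
  exact forall_congr' fun i => he i _

/-- The closers over a prime directly above the root only depend on what is above that prime. -/
theorem closers_of_hiBot_covBy (hd₁ : ringKrullDim D₁ < ⊤) (hd₂ : ringKrullDim D₂ < ⊤)
    (hε : ∀ (M : Ideal D₁) (hM : M.IsMaximal),
      epsilonOf D₁ M = epsilonOf D₂ (ν ⟨M, maximal_mem_hiSpec hM⟩).1)
    {R : ↥(hiSpec D₁)} (h : hiBot D₁ < R)
    (hm : Matches hp₁ hp₂ (hiPrime R) (oneAdd (hiPrime R)) (hiPrime (ν R))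
      (oneAdd (hiPrime (ν R)))) :
    Nonempty ({c : Clo (latAct hp₁ ⊥ (oneAdd (hiPrime R))) // Closes c} ≃o
      {c : Clo (latAct hp₂ ⊥ (oneAdd (hiPrime (ν R)))) // Closes c}) := by
  have h₁ : ⊥ < hiPrime R := h
  have h₂ : ⊥ < hiPrime (ν R) := by
    rw [← hiPrime_hiBot, ← map_hiBot ν, hiPrime_lt, ν.lt_iff_lt]
    exact h
  by_cases hR : R.1.IsMaximal
  · obtain ⟨e₁⟩ := closersCoarse (hp := hp₁) (P' := hiPrime R) hR h₁
    obtain ⟨e₂⟩ := closersCoarse (hp := hp₂) (P' := hiPrime (ν R))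
      ((isMaximal_map_iff ν R).1 hR) h₂
    have := finite_closers (hp := hp₁) hd₁ h₁.le
    have := finite_closers (hp := hp₂) hd₂ h₂.le
    have hcard := card_closers_eq hp₁ hp₂ hε h hR
    rw [map_hiBot ν] at hcard
    obtain ⟨e, -⟩ := exists_orderIso_of_total
      (α := {c : Clo (latAct hp₁ ⊥ (hiPrime R).asIdeal.primeCompl) // Closes c})
      (β := {c : Clo (latAct hp₂ ⊥ (hiPrime (ν R)).asIdeal.primeCompl) // Closes c})
      (fun a b => Clo.le_total (hp := hp₁) h₁.le a.1 b.1)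
      (fun a b => Clo.le_total (hp := hp₂) h₂.le a.1 b.1) hcard (fun _ => True) (fun _ => True)
      (fun _ _ _ => id) (fun _ _ _ => id)
      (((Nat.card_congr (Equiv.subtypeUnivEquiv fun _ => trivial)).trans hcard).trans
        (Nat.card_congr (Equiv.subtypeUnivEquiv fun _ => trivial)).symm)
    exact ⟨e₁.symm.trans (e.trans e₂)⟩
  · obtain ⟨e₁⟩ := closersExt (hp := hp₁) (mid_oneAdd h₁)
      (mt (locS_oneAdd_eq_iff hp₁ (hiPrime R)).1 hR)
    obtain ⟨e₂⟩ := closersExt (hp := hp₂) (mid_oneAdd h₂)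
      (mt (locS_oneAdd_eq_iff hp₂ (hiPrime (ν R))).1 (mt (isMaximal_map_iff ν R).2 hR))
    obtain ⟨e, he⟩ := hm
    exact ⟨e₁.symm.trans (OrderIso.trans
      { toEquiv := e.toEquiv.subtypeEquiv he, map_rel_iff' := e.map_rel_iff } e₂)⟩

end Compare

end Paper

namespace Paper

/-- (Finite-dimensional case.) Let `ν : hiSpec(D₁) → hiSpec(D₂)` be
an order isomorphism with `ε(M) = ε(ν(M))` for every maximal ideal `M` of `D₁`.
(a) If `ω(P) = ω(ν(P))` for every `P ∈ hiSpec(D₁)`, the isomorphisms `𝛎`, `𝛎_F`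
restrict to order isomorphisms between the (semi)star operations and between
`Star(D₁)` and `Star(D₂)`. (b) If `ω(P) = ω(ν(P))` for every `P` not minimal in
`hiSpec(D₁) \ {(0)}`, then `Star(D₁)` and `Star(D₂)` are order isomorphic. -/
theorem statement15
    (D₁ : Type*) [CommRing D₁] [IsDomain D₁]
    (K₁ : Type*) [Field K₁] [Algebra D₁ K₁] [IsFractionRing D₁ K₁]
    (D₂ : Type*) [CommRing D₂] [IsDomain D₂]
    (K₂ : Type*) [Field K₂] [Algebra D₂ K₂] [IsFractionRing D₂ K₂]
    (hp₁ : IsPrufer D₁ K₁) (hsl₁ : IsSemilocal D₁) (hdim₁ : ringKrullDim D₁ < ⊤)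
    (hp₂ : IsPrufer D₂ K₂) (hsl₂ : IsSemilocal D₂) (hdim₂ : ringKrullDim D₂ < ⊤)
    (ν : ↥(hiSpec D₁) ≃o ↥(hiSpec D₂))
    (hε : ∀ (M : Ideal D₁) (hM : M.IsMaximal),
      epsilonOf D₁ M = epsilonOf D₂ (ν ⟨M, maximal_mem_hiSpec hM⟩).1) :
    ((∀ P Q : ↥(hiSpec D₁), DirectlyBelow D₁ Q.1 P.1 →
        omegaAt D₁ P.1 Q.1 (mem_hiSpec_prime P.2) =
          omegaAt D₂ (ν P).1 (ν Q).1 (mem_hiSpec_prime (ν P).2)) →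
      ∃ (bnu : Semistar D₁ K₁ ≃o Semistar D₂ K₂)
        (bnuF : FracStar D₁ K₁ ⊥ ≃o FracStar D₂ K₂ ⊥),
        (∀ s : Semistar D₁ K₁, s.toFun 1 = 1 ↔ (bnu s).toFun 1 = 1) ∧
        (∀ f : FracStar D₁ K₁ ⊥,
          FracStar.IsStarOp D₁ K₁ f ↔ FracStar.IsStarOp D₂ K₂ (bnuF f))) ∧
    ((∀ P Q : ↥(hiSpec D₁), DirectlyBelow D₁ Q.1 P.1 →
        (∃ R ∈ hiSpec D₁, R ≠ ⊥ ∧ R < P.1) →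
        omegaAt D₁ P.1 Q.1 (mem_hiSpec_prime P.2) =
          omegaAt D₂ (ν P).1 (ν Q).1 (mem_hiSpec_prime (ν P).2)) →
      Nonempty ({f : FracStar D₁ K₁ ⊥ // FracStar.IsStarOp D₁ K₁ f} ≃o
        {f : FracStar D₂ K₂ ⊥ // FracStar.IsStarOp D₂ K₂ f})) := by
  have hbot := isMaximal_bot_iff ν
  have hfin₁ := finite_primeSpectrum hp₁ hsl₁ hdim₁
  have hfin₂ := finite_primeSpectrum hp₂ hsl₂ hdim₂
  have hfin := finite_hiSpec hp₁ hsl₁ hdim₁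
  have hk₁ := kids_map hp₁ (hiBot D₁)
  have hk₂ := kids_map' ν hp₂ (hiBot D₁)
  rw [map_hiBot ν] at hk₂
  have hA : (∀ P Q : ↥(hiSpec D₁), DirectlyBelow D₁ Q.1 P.1 →
        omegaAt D₁ P.1 Q.1 (mem_hiSpec_prime P.2) =
          omegaAt D₂ (ν P).1 (ν Q).1 (mem_hiSpec_prime (ν P).2)) →
      ∃ (bnu : Semistar D₁ K₁ ≃o Semistar D₂ K₂)
        (bnuF : FracStar D₁ K₁ ⊥ ≃o FracStar D₂ K₂ ⊥),
        (∀ s : Semistar D₁ K₁, s.toFun 1 = 1 ↔ (bnu s).toFun 1 = 1) ∧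
        (∀ f : FracStar D₁ K₁ ⊥,
          FracStar.IsStarOp D₁ K₁ f ↔ FracStar.IsStarOp D₂ K₂ (bnuF f)) := by
    intro hω
    have hM : ∀ P, Matches hp₁ hp₂ (hiPrime P) (oneAdd (hiPrime P)) (hiPrime (ν P))
        (oneAdd (hiPrime (ν P))) := fun P =>
      matches_of_omega_eq hsl₁ hdim₁ hsl₂ hdim₂ hε P fun Q R _ hQR =>
        hω R Q (directlyBelow_iff_covBy.2 hQR)
    have h0 := hM (hiBot D₁)
    rw [map_hiBot ν] at h0
    obtain ⟨e, he⟩ := exists_semistar_orderIso hbot h0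
    by_cases hD : (⊥ : Ideal D₁).IsMaximal
    · obtain ⟨e', he'⟩ := exists_fracStar_orderIso_of_field hD (hbot.1 hD) e
      exact ⟨e, e', he, he'⟩
    · obtain ⟨e', he'⟩ := exists_fracStar_orderIso hD (mt hbot.2 hD) hk₁ hk₂ fun R => by
        have := matches_of_covBy hdim₁ hdim₂ hε R.2
          (hω R.1 _ (directlyBelow_iff_covBy.2 R.2)) (hM R.1)
        rwa [map_hiBot ν] at this
      exact ⟨e, e', he, he'⟩
  refine ⟨hA, fun hω => ?_⟩
  by_cases hD : (⊥ : Ideal D₁).IsMaximal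
  · obtain ⟨-, e, -, he⟩ := hA fun P Q h => absurd h.2.2.1 <|
      (isMax_iff_isMaximal (P := hiBot D₁)).2 hD |>.mono (hiBot_le Q) |>.not_lt (b := P)
    exact ⟨⟨e.toEquiv.subtypeEquiv he, e.map_rel_iff⟩⟩
  · have key : ∀ R : {R : ↥(hiSpec D₁) // hiBot D₁ ⋖ R}, Nonempty
        ({c : Clo (latAct hp₁ ⊥ (oneAdd (hiPrime R.1))) // Closes c} ≃o
          {c : Clo (latAct hp₂ ⊥ (oneAdd (hiPrime (ν R.1)))) // Closes c}) := fun R =>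
      closers_of_hiBot_covBy hdim₁ hdim₂ hε R.2.lt <|
        matches_of_omega_eq hsl₁ hdim₁ hsl₂ hdim₂ hε R.1 fun Q Q' hQ hQQ' =>
          hω Q' Q (directlyBelow_iff_covBy.2 hQQ') ⟨R.1.1, R.1.2, (bot_le.trans_lt
            (show (hiBot D₁).1 < R.1.1 from R.2.lt)).ne', lt_of_le_of_lt hQ hQQ'.lt⟩
    exact ⟨(starProd hD hk₁).trans ((piOrderIso fun R => (key R).some).trans
      (starProd (mt hbot.2 hD) hk₂).symm)⟩

end Paper
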